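/- Let ρ : Q → ℝ be a Lipschitz continuous function on the unit square Q = [0,1]² with ρ(x) ≥ a for some constant a > 0 and ∫_Q ρ(x) dx = 1, and let μ be the probability measure on Q with density ρ. For each N, let x_1,…,x_N be N points sampled independently with distribution μ, with empirical measure X^N = (1/N) Σ_{i=1}^N δ_{x_i}. Then limsup_{N→∞} (4πN / log N) · E_μ[W₂²(X^N, μ)] ≤ 1. -/

import Mathlib

open MeasureTheory Filter
open scoped ENNReal NNReal Topology

noncomputable section

/-- The plane, with the Euclidean norm. -/
abbrev E2 : Type := EuclideanSpace ℝ (Fin 2)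

/-- The unit square `Q = [0,1]²`. -/
def unitSq : Set E2 := {x | ∀ i, x i ∈ Set.Icc (0 : ℝ) 1}

/-- The squared 2-Wasserstein distance `W₂²(ν₁, ν₂)`: the infimum of
`∫ |x − y|² dJ` over all couplings `J` of `ν₁` and `ν₂`. -/
def W2sq (ν₁ ν₂ : Measure E2) : ℝ :=
  sInf {c | ∃ J : Measure (E2 × E2), IsProbabilityMeasure J ∧
    J.map Prod.fst = ν₁ ∧ J.map Prod.snd = ν₂ ∧
    c = ∫ p, ‖p.1 - p.2‖ ^ 2 ∂J}

/-- The empirical measure `X^N = (1/N) Σ_{i=1}^N δ_{x_i}`. -/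
def empMeas {N : ℕ} (x : Fin N → E2) : Measure E2 :=
  (N : ℝ≥0∞)⁻¹ • ∑ i, Measure.dirac (x i)


/-! ### Part A: discrete transport -/

/-- There is a coupling of the weights `m`, `m'` with quadratic cost at most `c`. -/
def Cpl {V : Type*} [Fintype V] (z : V → E2) (m m' : V → ℝ) (c : ℝ) : Prop :=
  ∃ π : V → V → ℝ, (∀ x y, 0 ≤ π x y) ∧ (∀ x, ∑ y, π x y = m x) ∧ (∀ y, ∑ x, π x y = m' y) ∧
    ∑ x, ∑ y, π x y * ‖z x - z y‖ ^ 2 ≤ c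

lemma norm_sq_split (x y : E2) {ε : ℝ} (hε : 0 < ε) :
    ‖x + y‖ ^ 2 ≤ (1 + ε) * ‖x‖ ^ 2 + (1 + 1 / ε) * ‖y‖ ^ 2 := by
  have h1 : ‖x + y‖ ^ 2 ≤ (‖x‖ + ‖y‖) ^ 2 := by gcongr; exact norm_add_le x y
  have h2 : (1 + ε) * ‖x‖ ^ 2 + (1 + 1 / ε) * ‖y‖ ^ 2 - (‖x‖ + ‖y‖) ^ 2
      = (ε * ‖x‖ - ‖y‖) ^ 2 / ε := by
    field_simp; ring
  have h3 : 0 ≤ (ε * ‖x‖ - ‖y‖) ^ 2 / ε := by positivity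
  linarith

section
variable {V : Type*} [Fintype V] {z : V → E2}

lemma Cpl.mono {m m' : V → ℝ} {c c' : ℝ} (h : Cpl z m m' c) (hc : c ≤ c') : Cpl z m m' c' := by
  obtain ⟨π, h1, h2, h3, h4⟩ := h
  exact ⟨π, h1, h2, h3, h4.trans hc⟩

lemma Cpl.symm {m m' : V → ℝ} {c : ℝ} (h : Cpl z m m' c) : Cpl z m' m c := by
  obtain ⟨π, h1, h2, h3, h4⟩ := h
  refine ⟨fun x y => π y x, fun x y => h1 y x, h3, h2, ?_⟩
  rw [Finset.sum_comm]
  simpa only [norm_sub_rev] using h4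

lemma Cpl.comp {m₀ m₁ m₂ : V → ℝ} {c₁ c₂ ε : ℝ} (hA : Cpl z m₀ m₁ c₁) (hB : Cpl z m₁ m₂ c₂)
    (hε : 0 < ε) : Cpl z m₀ m₂ ((1 + ε) * c₁ + (1 + 1 / ε) * c₂) := by
  obtain ⟨π, h1, h2, h3, h4⟩ := hA
  obtain ⟨τ, g1, g2, g3, g4⟩ := hB
  have hm : ∀ b, 0 ≤ m₁ b := fun b => by rw [← h3]; exact Finset.sum_nonneg fun x _ => h1 x b
  have e1 : ∀ a b, π a b * (m₁ b / m₁ b) = π a b := by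
    intro a b
    by_cases hb : m₁ b = 0
    · have : π a b = 0 := by
        have := h3 b
        rw [hb] at this
        exact (Finset.sum_eq_zero_iff_of_nonneg (fun x _ => h1 x b)).1 this a (Finset.mem_univ _)
      simp [this]
    · rw [div_self hb, mul_one]
  have e2 : ∀ b c, τ b c * (m₁ b / m₁ b) = τ b c := by
    intro b c
    by_cases hb : m₁ b = 0
    · have : τ b c = 0 := by
        have := g2 b
        rw [hb] at this
        exact (Finset.sum_eq_zero_iff_of_nonneg (fun x _ => g1 b x)).1 this c (Finset.mem_univ _)
      simp [this]
    · rw [div_self hb, mul_one]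
  have s1 : ∀ a b, ∑ c, π a b * τ b c / m₁ b = π a b := by
    intro a b
    rw [← Finset.sum_div, ← Finset.mul_sum, g2, mul_div_assoc, e1]
  have s2 : ∀ b c, ∑ a, π a b * τ b c / m₁ b = τ b c := by
    intro b c
    rw [← Finset.sum_div, ← Finset.sum_mul, h3, mul_comm, mul_div_assoc, e2]
  refine ⟨fun a c => ∑ b, π a b * τ b c / m₁ b, ?_, ?_, ?_, ?_⟩
  · intro a c
    exact Finset.sum_nonneg fun b _ => div_nonneg (mul_nonneg (h1 _ _) (g1 _ _)) (hm b)
  · intro a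
    rw [Finset.sum_comm]
    simp only [s1, h2]
  · intro c
    rw [Finset.sum_comm]
    simp only [s2, g3]
  · calc ∑ a, ∑ c, (∑ b, π a b * τ b c / m₁ b) * ‖z a - z c‖ ^ 2
        ≤ ∑ a, ∑ c, ∑ b, ((1 + ε) * (π a b * τ b c / m₁ b * ‖z a - z b‖ ^ 2)
            + (1 + 1 / ε) * (π a b * τ b c / m₁ b * ‖z b - z c‖ ^ 2)) := by
          refine Finset.sum_le_sum fun a _ => Finset.sum_le_sum fun c _ => ?_
          rw [Finset.sum_mul]
          refine Finset.sum_le_sum fun b _ => ?_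
          have hw : 0 ≤ π a b * τ b c / m₁ b :=
            div_nonneg (mul_nonneg (h1 _ _) (g1 _ _)) (hm b)
          have := norm_sq_split (z a - z b) (z b - z c) hε
          rw [sub_add_sub_cancel] at this
          have := mul_le_mul_of_nonneg_left this hw
          linarith
      _ = (1 + ε) * ∑ a, ∑ b, π a b * ‖z a - z b‖ ^ 2
            + (1 + 1 / ε) * ∑ b, ∑ c, τ b c * ‖z b - z c‖ ^ 2 := by
          simp only [Finset.sum_add_distrib]
          congr 1
          · simp only [← Finset.mul_sum]
            congr 1
            refine Finset.sum_congr rfl fun a _ => ?_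
            rw [Finset.sum_comm]
            refine Finset.sum_congr rfl fun b _ => ?_
            rw [← Finset.sum_mul, s1]
          · simp only [← Finset.mul_sum]
            congr 1
            calc ∑ a, ∑ c, ∑ b, π a b * τ b c / m₁ b * ‖z b - z c‖ ^ 2
                = ∑ c, ∑ b, ∑ a, π a b * τ b c / m₁ b * ‖z b - z c‖ ^ 2 := by
                  rw [Finset.sum_comm]
                  refine Finset.sum_congr rfl fun c _ => ?_
                  rw [Finset.sum_comm]
              _ = ∑ c, ∑ b, τ b c * ‖z b - z c‖ ^ 2 := by
                  simp only [← Finset.sum_mul, s2]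
              _ = _ := Finset.sum_comm
      _ ≤ _ := by gcongr

lemma Cpl.kernel (K : V → V → ℝ) (m : V → ℝ) (hm : ∀ x, 0 ≤ m x) (hK : ∀ x y, 0 ≤ K x y)
    (hK1 : ∀ x, ∑ y, K x y = 1) :
    Cpl z m (fun y => ∑ x, m x * K x y) (∑ x, m x * ∑ y, K x y * ‖z x - z y‖ ^ 2) := by
  refine ⟨fun x y => m x * K x y, fun x y => mul_nonneg (hm x) (hK x y), ?_, fun _ => rfl, ?_⟩
  · intro x; rw [← Finset.mul_sum, hK1, mul_one]
  · simp only [Finset.mul_sum, mul_assoc, le_refl]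

lemma Cpl.mix [DecidableEq V] {u q : V → ℝ} {c η : ℝ} (hu : ∀ x, 0 ≤ u x) (hη : 0 ≤ η) (hη1 : η ≤ 1)
    (h : Cpl z u q c) : Cpl z u (fun x => (1 - η) * u x + η * q x) (η * c) := by
  obtain ⟨π, h1, h2, h3, h4⟩ := h
  refine ⟨fun x y => (1 - η) * (if x = y then u x else 0) + η * π x y, ?_, ?_, ?_, ?_⟩
  · intro x y
    have := h1 x y
    have := hu x
    have : 0 ≤ 1 - η := by linarith
    beta_reduce
    split_ifs <;> positivity
  · intro x
    simp only [Finset.sum_add_distrib, ← Finset.mul_sum, h2]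
    simp only [Finset.sum_ite_eq, Finset.mem_univ, if_true]
    ring
  · intro y
    simp only [Finset.sum_add_distrib, ← Finset.mul_sum, h3]
    simp
  · calc _ = η * ∑ x, ∑ y, π x y * ‖z x - z y‖ ^ 2 := by
          simp only [Finset.mul_sum]
          refine Finset.sum_congr rfl fun x _ => Finset.sum_congr rfl fun y _ => ?_
          split_ifs with hxy
          · simp [hxy]
          · ring
      _ ≤ _ := by gcongr

lemma Cpl.improve [DecidableEq V] {u q : V → ℝ} {c η ε ζ : ℝ} (hu : ∀ x, 0 ≤ u x)
    (hq : ∀ x, 0 ≤ q x)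
    (hu1 : ∑ x, u x = 1) (hq1 : ∑ x, q x = 1) (hη : 0 ≤ η) (hη1 : η ≤ 1) (hε : 0 < ε) (hε1 : ε < 1)
    (hηε : (1 + 1 / ε) * η ≤ ε) (hζ : 0 < ζ)
    (h : Cpl z q (fun x => (1 - η) * u x + η * q x) c) :
    Cpl z u q ((1 + ε) / (1 - ε) * c + ζ) := by
  set S : Set ℝ := {c | Cpl z u q c} with hS
  have hpos : ∀ c ∈ S, 0 ≤ c := by
    rintro c ⟨π, h1, h2, h3, h4⟩
    refine le_trans ?_ h4
    exact Finset.sum_nonneg fun x _ => Finset.sum_nonneg fun y _ =>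
      mul_nonneg (h1 x y) (by positivity)
  have hne : S.Nonempty := by
    refine ⟨_, fun x y => u x * q y, fun x y => mul_nonneg (hu x) (hq y), ?_, ?_, le_refl _⟩
    · intro x; rw [← Finset.mul_sum, hq1, mul_one]
    · intro x; rw [← Finset.sum_mul, hu1, one_mul]
  have hbdd : BddBelow S := ⟨0, hpos⟩
  have step : ∀ c₀ ∈ S, ε * c₀ + (1 + ε) * c ∈ S := by
    intro c₀ hc₀
    have h1 := Cpl.comp (h) ((Cpl.mix hu hη hη1 hc₀).symm) hε
    refine h1.symm.mono ?_
    have := mul_le_mul_of_nonneg_right hηε (hpos c₀ hc₀)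
    linarith
  have hI : sInf S ≤ ε * sInf S + (1 + ε) * c := by
    have : ∀ c₀ ∈ S, (sInf S - (1 + ε) * c) / ε ≤ c₀ := by
      intro c₀ hc₀
      rw [div_le_iff₀ hε]
      have := csInf_le hbdd (step c₀ hc₀)
      linarith
    have := le_csInf hne this
    rw [div_le_iff₀ hε] at this
    linarith
  have hI2 : sInf S ≤ (1 + ε) / (1 - ε) * c := by
    rw [div_mul_eq_mul_div, le_div_iff₀ (by linarith)]
    linarith
  obtain ⟨c', hc', hlt⟩ := exists_lt_of_csInf_lt hne (lt_of_le_of_lt hI2 (lt_add_of_pos_right _ hζ))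
  exact Cpl.mono hc' hlt.le

lemma Cpl.step {m₀ m : V → ℝ} {Φ : V → V → ℝ} {D h B : ℝ} (hΦ : ∀ x y, 0 ≤ Φ x y)
    (hm : ∀ x, 0 < m x) (hD : 0 ≤ D) (hh : 0 ≤ h) (hB : 0 ≤ B)
    (hsmall : ∀ x, h * ∑ y, Φ x y ≤ m x)
    (hBm : ∑ x, ‖∑ y, Φ x y • (z y - z x)‖ ^ 2 / m x ≤ B ^ 2)
    (hC : Cpl z m₀ m (D ^ 2)) :
    Cpl z m₀ (fun x => m x + h * (∑ y, Φ y x - ∑ y, Φ x y))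
      ((D + h * B) ^ 2 + h * ∑ x, ∑ y, Φ x y * ‖z y - z x‖ ^ 2) := by
  classical
  obtain ⟨π, h1, h2, h3, h4⟩ := hC
  set d : V → E2 := fun x => ∑ y, Φ x y • (z y - z x) with hd
  have hmne : ∀ x, m x ≠ 0 := fun x => (hm x).ne'
  refine ⟨fun a c => π a c * (1 - h * (∑ y, Φ c y) / m c) + ∑ b, π a b * (h * Φ b c / m b),
    ?_, ?_, ?_, ?_⟩
  · intro a c
    have : 0 ≤ 1 - h * (∑ y, Φ c y) / m c := by
      rw [sub_nonneg, div_le_one (hm c)]; exact hsmall c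
    refine add_nonneg (mul_nonneg (h1 _ _) this) (Finset.sum_nonneg fun b _ => ?_)
    exact mul_nonneg (h1 _ _) (div_nonneg (mul_nonneg hh (hΦ _ _)) (hm b).le)
  · intro a
    rw [Finset.sum_add_distrib, Finset.sum_comm (f := fun c b => π a b * (h * Φ b c / m b))]
    rw [← h2 a, ← Finset.sum_add_distrib]
    refine Finset.sum_congr rfl fun c _ => ?_
    rw [← Finset.mul_sum, ← Finset.sum_div, ← Finset.mul_sum]
    ring
  · intro c
    rw [Finset.sum_add_distrib, ← Finset.sum_mul, h3,
      Finset.sum_comm (f := fun a b => π a b * (h * Φ b c / m b))]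
    simp only [← Finset.sum_mul, h3]
    have : ∀ b, m b * (h * Φ b c / m b) = h * Φ b c := fun b => by
      have := hmne b; field_simp
    simp only [this]
    rw [← Finset.mul_sum]
    have := hmne c
    field_simp
    ring
  · -- cost
    have key : ∑ a, ∑ c, (π a c * (1 - h * (∑ y, Φ c y) / m c)
        + ∑ b, π a b * (h * Φ b c / m b)) * ‖z a - z c‖ ^ 2
        = ∑ a, ∑ b, π a b * ‖z a - z b‖ ^ 2
          + h * (∑ a, ∑ b, π a b * (2 * inner ℝ (z b - z a) ((m b)⁻¹ • d b)))
          + h * ∑ b, ∑ c, Φ b c * ‖z c - z b‖ ^ 2 := by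
      have e : ∀ a b c, ‖z a - z c‖ ^ 2
          = ‖z a - z b‖ ^ 2 + 2 * inner ℝ (z b - z a) (z c - z b) + ‖z c - z b‖ ^ 2 := by
        intro a b c
        have : z c - z a = (z b - z a) + (z c - z b) := by abel
        rw [norm_sub_rev, this, norm_add_sq_real, norm_sub_rev (z a)]
      have e2 : ∀ a b, ∑ c, π a b * (h * Φ b c / m b) * ‖z a - z c‖ ^ 2
          = π a b * (h * (∑ y, Φ b y) / m b) * ‖z a - z b‖ ^ 2
            + h * (π a b * (2 * inner ℝ (z b - z a) ((m b)⁻¹ • d b)))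
            + h * (π a b / m b * ∑ c, Φ b c * ‖z c - z b‖ ^ 2) := by
        intro a b
        simp only [hd, inner_smul_right, inner_sum, Finset.mul_sum, Finset.sum_div, Finset.sum_mul]
        rw [← Finset.sum_add_distrib, ← Finset.sum_add_distrib]
        refine Finset.sum_congr rfl fun c _ => ?_
        rw [e a b c]
        ring
      calc _ = ∑ a, (∑ b, π a b * (1 - h * (∑ y, Φ b y) / m b) * ‖z a - z b‖ ^ 2
              + ∑ b, ∑ c, π a b * (h * Φ b c / m b) * ‖z a - z c‖ ^ 2) := by
            refine Finset.sum_congr rfl fun a _ => ?_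
            rw [Finset.sum_comm (f := fun b c => π a b * (h * Φ b c / m b) * ‖z a - z c‖ ^ 2),
              ← Finset.sum_add_distrib]
            refine Finset.sum_congr rfl fun c _ => ?_
            rw [add_mul, Finset.sum_mul]
        _ = ∑ a, ∑ b, (π a b * ‖z a - z b‖ ^ 2
            + h * (π a b * (2 * inner ℝ (z b - z a) ((m b)⁻¹ • d b)))
            + h * (π a b / m b * ∑ c, Φ b c * ‖z c - z b‖ ^ 2)) := by
            refine Finset.sum_congr rfl fun a _ => ?_
            rw [← Finset.sum_add_distrib]
            refine Finset.sum_congr rfl fun b _ => ?_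
            rw [e2]; ring
        _ = _ := by
            simp only [Finset.sum_add_distrib, ← Finset.mul_sum]
            congr 2
            rw [Finset.sum_comm]
            refine Finset.sum_congr rfl fun b _ => ?_
            rw [← Finset.sum_mul, ← Finset.sum_div, h3, div_self (hmne b), one_mul]
    rw [key]
    have hcs : ∑ a, ∑ b, π a b * (2 * inner ℝ (z b - z a) ((m b)⁻¹ • d b)) ≤ 2 * (D * B) := by
      -- for every λ > 0
      have hE : ∑ a, ∑ b, π a b * ‖(m b)⁻¹ • d b‖ ^ 2 ≤ B ^ 2 := by
        rw [Finset.sum_comm]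
        simp only [← Finset.sum_mul, h3]
        refine le_trans (le_of_eq ?_) hBm
        refine Finset.sum_congr rfl fun b _ => ?_
        rw [norm_smul, Real.norm_of_nonneg (inv_nonneg.2 (hm b).le)]
        have := hmne b
        field_simp
        rfl
      have hlam : ∀ l : ℝ, 0 < l →
          ∑ a, ∑ b, π a b * (2 * inner ℝ (z b - z a) ((m b)⁻¹ • d b))
            ≤ l * D ^ 2 + l⁻¹ * B ^ 2 := by
        intro l hl
        calc _ ≤ ∑ a, ∑ b, (l * (π a b * ‖z a - z b‖ ^ 2)
              + l⁻¹ * (π a b * ‖(m b)⁻¹ • d b‖ ^ 2)) := by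
              refine Finset.sum_le_sum fun a _ => Finset.sum_le_sum fun b _ => ?_
              have i1 := real_inner_le_norm (z b - z a) ((m b)⁻¹ • d b)
              rw [norm_sub_rev] at i1
              have i2 : 2 * (‖z a - z b‖ * ‖(m b)⁻¹ • d b‖)
                  ≤ l * ‖z a - z b‖ ^ 2 + l⁻¹ * ‖(m b)⁻¹ • d b‖ ^ 2 := by
                have : l * ‖z a - z b‖ ^ 2 + l⁻¹ * ‖(m b)⁻¹ • d b‖ ^ 2
                    - 2 * (‖z a - z b‖ * ‖(m b)⁻¹ • d b‖)
                    = l⁻¹ * (l * ‖z a - z b‖ - ‖(m b)⁻¹ • d b‖) ^ 2 := by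
                  field_simp; ring
                have : 0 ≤ l⁻¹ * (l * ‖z a - z b‖ - ‖(m b)⁻¹ • d b‖) ^ 2 := by positivity
                linarith
              have i3 : 2 * inner ℝ (z b - z a) ((m b)⁻¹ • d b)
                  ≤ l * ‖z a - z b‖ ^ 2 + l⁻¹ * ‖(m b)⁻¹ • d b‖ ^ 2 := by linarith
              have := mul_le_mul_of_nonneg_left i3 (h1 a b)
              linarith
          _ = l * ∑ a, ∑ b, π a b * ‖z a - z b‖ ^ 2
              + l⁻¹ * ∑ a, ∑ b, π a b * ‖(m b)⁻¹ • d b‖ ^ 2 := by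
              simp only [Finset.sum_add_distrib, Finset.mul_sum]
          _ ≤ _ := by gcongr
      refine le_of_forall_pos_le_add fun e he => ?_
      -- choose l = (B+t)/(D+t)
      obtain ⟨t, ht, hte⟩ : ∃ t : ℝ, 0 < t ∧ t * (D + B) ≤ e := by
        refine ⟨e / (D + B + 1), by positivity, ?_⟩
        rw [div_mul_eq_mul_div, div_le_iff₀ (by positivity)]
        nlinarith
      have hl := hlam ((B + t) / (D + t)) (by positivity)
      have j1 : (B + t) / (D + t) * D ^ 2 ≤ (B + t) * D := by
        rw [div_mul_eq_mul_div, div_le_iff₀ (by positivity)]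
        nlinarith [mul_nonneg hB hD, mul_nonneg (mul_nonneg hB hD) ht.le, mul_nonneg (mul_nonneg ht.le hD) ht.le]
      have j2 : ((B + t) / (D + t))⁻¹ * B ^ 2 ≤ (D + t) * B := by
        rw [inv_div, div_mul_eq_mul_div, div_le_iff₀ (by positivity)]
        nlinarith [mul_nonneg hB hD, mul_nonneg (mul_nonneg hB hD) ht.le, mul_nonneg (mul_nonneg ht.le hB) ht.le]
      nlinarith
    have := mul_le_mul_of_nonneg_left hcs hh
    nlinarith [sq_nonneg (h * B)]

lemma Cpl.flow {m₀ m₁ : V → ℝ} {Φ : V → V → ℝ} {B : ℝ} (hΦ : ∀ x y, 0 ≤ Φ x y)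
    (hm₀ : ∀ x, 0 < m₀ x) (hm₁ : ∀ x, 0 < m₁ x) (hB : 0 ≤ B)
    (hbal : ∀ x, m₁ x - m₀ x = ∑ y, Φ y x - ∑ y, Φ x y)
    (hBm : ∀ s ∈ Set.Icc (0 : ℝ) 1,
      ∑ x, ‖∑ y, Φ x y • (z y - z x)‖ ^ 2 / (m₀ x + s * (m₁ x - m₀ x)) ≤ B ^ 2) :
    Cpl z m₀ m₁ ((B + √(∑ x, ∑ y, Φ x y * ‖z y - z x‖ ^ 2)) ^ 2) := by
  classical
  set σ : ℝ := ∑ x, ∑ y, Φ x y * ‖z y - z x‖ ^ 2 with hσ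
  have hσ0 : 0 ≤ σ := Finset.sum_nonneg fun x _ => Finset.sum_nonneg fun y _ =>
      mul_nonneg (hΦ x y) (by positivity)
  have hms : ∀ x, ∀ s ∈ Set.Icc (0 : ℝ) 1, min (m₀ x) (m₁ x) ≤ m₀ x + s * (m₁ x - m₀ x) := by
    rintro x s ⟨hs0, hs1⟩
    have a1 := min_le_left (m₀ x) (m₁ x)
    have a2 := min_le_right (m₀ x) (m₁ x)
    nlinarith
  obtain ⟨M, hM⟩ : ∃ M : ℕ, ∀ x, (∑ y, Φ x y) / min (m₀ x) (m₁ x) ≤ M := by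
    obtain ⟨M, hM⟩ := exists_nat_ge (∑ x, (∑ y, Φ x y) / min (m₀ x) (m₁ x))
    refine ⟨M, fun x => le_trans ?_ hM⟩
    refine Finset.single_le_sum (f := fun x => (∑ y, Φ x y) / min (m₀ x) (m₁ x)) ?_ (Finset.mem_univ x)
    intro i _
    exact div_nonneg (Finset.sum_nonneg fun y _ => hΦ i y) (lt_min (hm₀ i) (hm₁ i)).le
  set h : ℝ := 1 / (M + 1) with hh
  have hM1 : (0 : ℝ) < M + 1 := by positivity
  have hh0 : 0 < h := by positivity
  have main : ∀ j : ℕ, j ≤ M + 1 → Cpl z m₀ (fun x => m₀ x + (j * h) * (m₁ x - m₀ x))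
      ((j * h * B + √(j * h * σ)) ^ 2) := by
    intro j
    induction j with
    | zero =>
      intro _
      refine ⟨fun x y => if x = y then m₀ x else 0, ?_, ?_, ?_, ?_⟩
      · intro x y; beta_reduce; split_ifs; exacts [(hm₀ x).le, le_rfl]
      · intro x; simp
      · intro x; simp
      · simp
    | succ j ih =>
      intro hj
      have hs : (j * h : ℝ) ∈ Set.Icc (0 : ℝ) 1 := by
        refine ⟨by positivity, ?_⟩
        rw [hh, mul_one_div, div_le_one hM1]
        have : j ≤ M + 1 := by omega
        exact_mod_cast this
      have hst := Cpl.step (h := h) (B := B) hΦ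
        (fun x => lt_of_lt_of_le (lt_min (hm₀ x) (hm₁ x)) (hms x _ hs))
        (by positivity) hh0.le hB ?_ (hBm _ hs) (ih (by omega))
      · convert hst.mono (c' := ((((j + 1 : ℕ) : ℝ) * h * B + √(((j + 1 : ℕ) : ℝ) * h * σ)) ^ 2)) ?_ using 1
        · funext x
          rw [← hbal]; push_cast; ring
        · have q1 : √(j * h * σ) ^ 2 = j * h * σ := Real.sq_sqrt (by positivity)
          have q2 : √(((j + 1 : ℕ) : ℝ) * h * σ) ^ 2 = ((j + 1 : ℕ) : ℝ) * h * σ :=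
            Real.sq_sqrt (by positivity)
          have q3 : √(j * h * σ) ≤ √(((j + 1 : ℕ) : ℝ) * h * σ) := by
            apply Real.sqrt_le_sqrt; gcongr; simp
          have q4 : 0 ≤ ((j + 1 : ℕ) : ℝ) * h * B := by positivity
          have q5 : (j : ℝ) * h * B + √(j * h * σ) + h * B
            = ((j + 1 : ℕ) : ℝ) * h * B + √(j * h * σ) := by push_cast; ring
          rw [q5]
          have q6 : ((j + 1 : ℕ) : ℝ) * h * σ = j * h * σ + h * σ := by push_cast; ring
          nlinarith [mul_le_mul_of_nonneg_left q3 q4]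
      · intro x
        have := hM x
        rw [div_le_iff₀ (lt_min (hm₀ x) (hm₁ x))] at this
        have h5 := hms x _ hs
        have hmin := lt_min (hm₀ x) (hm₁ x)
        calc h * ∑ y, Φ x y ≤ h * (M * min (m₀ x) (m₁ x)) := by gcongr
          _ ≤ 1 * min (m₀ x) (m₁ x) := by
            rw [← mul_assoc]
            gcongr
            rw [hh, div_mul_eq_mul_div, div_le_one hM1]; linarith
          _ ≤ _ := by rw [one_mul]; exact h5
  have := main (M + 1) le_rfl
  have e : (((M + 1 : ℕ) : ℝ) * h) = 1 := by rw [hh]; push_cast; field_simp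
  simp only [e, one_mul] at this
  simpa using this

end


/-! ### Part B: from discrete couplings to the Wasserstein distance -/

section
variable {V : Type*} [Fintype V] [MeasurableSpace V] [MeasurableSingletonClass V]

lemma cond_marginal (s : E2 → V) (hs : Measurable s) (ν : Measure E2) [IsProbabilityMeasure ν]
    (A : Set E2) (hA : MeasurableSet A) :
    ∑ a, ν (s ⁻¹' {a}) * ProbabilityTheory.cond ν (s ⁻¹' {a}) A = ν A := by
  have hm : ∀ a, MeasurableSet (s ⁻¹' {a}) := fun a => hs (measurableSet_singleton a)
  have e : ∀ a, ν (s ⁻¹' {a}) * ProbabilityTheory.cond ν (s ⁻¹' {a}) A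
      = (ν.restrict A) (s ⁻¹' {a}) := by
    intro a
    rw [ProbabilityTheory.cond_apply (hm a), Measure.restrict_apply (hm a)]
    by_cases h0 : ν (s ⁻¹' {a}) = 0
    · rw [h0, zero_mul]
      exact (measure_mono_null Set.inter_subset_left h0).symm
    · rw [← mul_assoc, ENNReal.mul_inv_cancel h0 (measure_ne_top _ _), one_mul]
  simp only [e]
  rw [sum_measure_preimage_singleton _ (fun a _ => hm a)]
  simp

lemma W2sq_le_of_Cpl (s : E2 → V) (hs : Measurable s) (z : V → E2) (ν μ : Measure E2)
    [IsProbabilityMeasure ν] [IsProbabilityMeasure μ] {δ c ε : ℝ} (hε : 0 < ε)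
    (hν : ∀ᵐ x ∂ν, ‖x - z (s x)‖ ≤ δ) (hμ : ∀ᵐ x ∂μ, ‖x - z (s x)‖ ≤ δ)
    (h : Cpl z (fun a => (ν (s ⁻¹' {a})).toReal) (fun a => (μ (s ⁻¹' {a})).toReal) c) :
    W2sq ν μ ≤ (1 + ε) * c + (1 + 1 / ε) * (4 * δ ^ 2) := by
  classical
  obtain ⟨π, h1, h2, h3, h4⟩ := h
  have hm : ∀ a, MeasurableSet (s ⁻¹' {a}) := fun a => hs (measurableSet_singleton a)
  set J : Measure (E2 × E2) := ∑ a, ∑ b, ENNReal.ofReal (π a b) •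
    (ProbabilityTheory.cond ν (s ⁻¹' {a})).prod (ProbabilityTheory.cond μ (s ⁻¹' {b})) with hJ
  have hJapp : ∀ A B : Set E2, J (A ×ˢ B) = ∑ a, ∑ b, ENNReal.ofReal (π a b) *
      (ProbabilityTheory.cond ν (s ⁻¹' {a}) A * ProbabilityTheory.cond μ (s ⁻¹' {b}) B) := by
    intro A B
    simp [hJ, Measure.finset_sum_apply, Measure.smul_apply, Measure.prod_prod]
  have pν : ∀ a b, ENNReal.ofReal (π a b) * ProbabilityTheory.cond ν (s ⁻¹' {a}) Set.univ
      = ENNReal.ofReal (π a b) := by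
    intro a b
    by_cases h0 : ν (s ⁻¹' {a}) = 0
    · have : π a b = 0 := by
        have := h2 a
        simp only [h0, ENNReal.toReal_zero] at this
        exact (Finset.sum_eq_zero_iff_of_nonneg (fun x _ => h1 a x)).1 this b (Finset.mem_univ _)
      simp [this]
    · have := ProbabilityTheory.cond_isProbabilityMeasure h0
      rw [measure_univ, mul_one]
  have pμ : ∀ a b, ENNReal.ofReal (π a b) * ProbabilityTheory.cond μ (s ⁻¹' {b}) Set.univ
      = ENNReal.ofReal (π a b) := by
    intro a b
    by_cases h0 : μ (s ⁻¹' {b}) = 0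
    · have : π a b = 0 := by
        have := h3 b
        simp only [h0, ENNReal.toReal_zero] at this
        exact (Finset.sum_eq_zero_iff_of_nonneg (fun x _ => h1 x b)).1 this a (Finset.mem_univ _)
      simp [this]
    · have := ProbabilityTheory.cond_isProbabilityMeasure h0
      rw [measure_univ, mul_one]
  have sν : ∀ a, ∑ b, ENNReal.ofReal (π a b) = ν (s ⁻¹' {a}) := by
    intro a
    rw [← ENNReal.ofReal_sum_of_nonneg (fun b _ => h1 a b), h2,
      ENNReal.ofReal_toReal (measure_ne_top _ _)]
  have sμ : ∀ b, ∑ a, ENNReal.ofReal (π a b) = μ (s ⁻¹' {b}) := by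
    intro b
    rw [← ENNReal.ofReal_sum_of_nonneg (fun a _ => h1 a b), h3,
      ENNReal.ofReal_toReal (measure_ne_top _ _)]
  have mfst : J.map Prod.fst = ν := by
    ext A hA
    rw [Measure.map_apply measurable_fst hA, ← Set.prod_univ, hJapp, ← cond_marginal s hs ν A hA]
    refine Finset.sum_congr rfl fun a _ => ?_
    rw [← sν, Finset.sum_mul]
    refine Finset.sum_congr rfl fun b _ => ?_
    conv_rhs => rw [← pμ]
    ring
  have msnd : J.map Prod.snd = μ := by
    ext A hA
    rw [Measure.map_apply measurable_snd hA, ← Set.univ_prod, hJapp, ← cond_marginal s hs μ A hA,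
      Finset.sum_comm]
    refine Finset.sum_congr rfl fun b _ => ?_
    rw [← sμ, Finset.sum_mul]
    refine Finset.sum_congr rfl fun a _ => ?_
    conv_rhs => rw [← pν]
    ring
  have hprob : IsProbabilityMeasure J := by
    constructor
    rw [← Set.preimage_univ (f := Prod.fst), ← Measure.map_apply measurable_fst MeasurableSet.univ,
      mfst, measure_univ]
  have hle : W2sq ν μ ≤ ∫ p, ‖p.1 - p.2‖ ^ 2 ∂J := by
    refine csInf_le ⟨0, ?_⟩ ⟨J, hprob, mfst, msnd, rfl⟩
    rintro c ⟨J', -, -, -, rfl⟩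
    exact integral_nonneg fun p => by positivity
  refine hle.trans ?_
  set S : E2 × E2 → V × V := fun p => (s p.1, s p.2) with hS
  have hSm : Measurable S := (hs.comp measurable_fst).prodMk (hs.comp measurable_snd)
  set g : V × V → ℝ := fun v => (1 + ε) * ‖z v.1 - z v.2‖ ^ 2 + (1 + 1 / ε) * (4 * δ ^ 2) with hg
  have hfin : IsProbabilityMeasure (J.map S) := Measure.isProbabilityMeasure_map hSm.aemeasurable
  have hgm : Measurable g := measurable_of_finite g
  have hgi : Integrable g (J.map S) := Integrable.of_finite
  have hgi2 : Integrable (fun p => g (S p)) J := hgi.comp_measurable hSm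
  have a1 : ∀ᵐ p ∂J, ‖p.1 - z (s p.1)‖ ≤ δ := by
    apply ae_of_ae_map (f := Prod.fst) (p := fun x => ‖x - z (s x)‖ ≤ δ) measurable_fst.aemeasurable
    rwa [mfst]
  have a2 : ∀ᵐ p ∂J, ‖p.2 - z (s p.2)‖ ≤ δ := by
    apply ae_of_ae_map (f := Prod.snd) (p := fun x => ‖x - z (s x)‖ ≤ δ) measurable_snd.aemeasurable
    rwa [msnd]
  calc ∫ p, ‖p.1 - p.2‖ ^ 2 ∂J ≤ ∫ p, g (S p) ∂J := by
        refine integral_mono_of_nonneg (Eventually.of_forall fun p => by positivity) hgi2 ?_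
        filter_upwards [a1, a2] with p b1 b2
        have := norm_sq_split (z (s p.1) - z (s p.2)) ((p.1 - z (s p.1)) - (p.2 - z (s p.2))) hε
        have e : z (s p.1) - z (s p.2) + ((p.1 - z (s p.1)) - (p.2 - z (s p.2))) = p.1 - p.2 := by
          abel
        rw [e] at this
        refine this.trans ?_
        have b3 : ‖(p.1 - z (s p.1)) - (p.2 - z (s p.2))‖ ≤ 2 * δ :=
          (norm_sub_le _ _).trans (by linarith)
        have b4 : ‖(p.1 - z (s p.1)) - (p.2 - z (s p.2))‖ ^ 2 ≤ 4 * δ ^ 2 := by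
          calc _ ≤ (2 * δ) ^ 2 := by gcongr
            _ = _ := by ring
        simp only [hg, hS]
        gcongr
    _ = ∫ v, g v ∂(J.map S) := by
        rw [integral_map hSm.aemeasurable hgm.aestronglyMeasurable]
    _ = ∑ v, (J.map S).real {v} * g v := by
        rw [integral_fintype hgi]
        simp
    _ = ∑ a, ∑ b, π a b * g (a, b) := by
        rw [Fintype.sum_prod_type]
        refine Finset.sum_congr rfl fun a _ => Finset.sum_congr rfl fun b _ => ?_
        congr 1
        rw [Measure.real, Measure.map_apply hSm (measurableSet_singleton _)]
        have : S ⁻¹' {(a, b)} = (s ⁻¹' {a}) ×ˢ (s ⁻¹' {b}) := by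
          ext p; simp [hS, Prod.ext_iff]
        rw [this, hJapp]
        have cz : ∀ (ν : Measure E2) (a a' : V), a' ≠ a →
            ProbabilityTheory.cond ν (s ⁻¹' {a'}) (s ⁻¹' {a}) = 0 := by
          intro ν a a' hne
          rw [ProbabilityTheory.cond_apply (hm a')]
          have : s ⁻¹' {a'} ∩ s ⁻¹' {a} = ∅ := by
            ext x; simp; intro h h'; exact hne (h.symm.trans h')
          simp [this]
        have cu : ∀ (ν : Measure E2) (a : V),
            ProbabilityTheory.cond ν (s ⁻¹' {a}) (s ⁻¹' {a})
              = ProbabilityTheory.cond ν (s ⁻¹' {a}) Set.univ := by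
          intro ν a
          rw [ProbabilityTheory.cond_apply (hm a), ProbabilityTheory.cond_apply (hm a)]
          simp
        rw [Finset.sum_eq_single a, Finset.sum_eq_single b, cu, cu, ← mul_assoc, pν, pμ,
          ENNReal.toReal_ofReal (h1 a b)]
        · intro b' _ hb'; rw [cz μ b b' hb']; simp
        · simp
        · intro a' _ ha'
          refine Finset.sum_eq_zero fun b' _ => ?_
          rw [cz ν a a' ha']; simp
        · simp
    _ = (1 + ε) * ∑ a, ∑ b, π a b * ‖z a - z b‖ ^ 2 + (1 + 1 / ε) * (4 * δ ^ 2) := by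
        have tot : ∑ a, ∑ b, π a b = 1 := by
          have : ∑ a, (ν (s ⁻¹' {a})) = 1 := by
            rw [sum_measure_preimage_singleton _ (fun a _ => hm a)]; simp
          simp only [h2]
          rw [← ENNReal.toReal_sum (fun a _ => measure_ne_top _ _), this]; simp
        calc _ = ∑ a, ∑ b, ((1 + ε) * (π a b * ‖z a - z b‖ ^ 2)
                  + (1 + 1 / ε) * (4 * δ ^ 2) * π a b) := by
              refine Finset.sum_congr rfl fun a _ => Finset.sum_congr rfl fun b _ => ?_
              simp only [hg]; ring
          _ = _ := by
              simp only [Finset.sum_add_distrib, ← Finset.mul_sum, tot, mul_one]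
    _ ≤ _ := by gcongr

end


/-! ### Part C: moments of sums of i.i.d. variables on a finite space -/

/-- Expectation under the product law `p^{⊗ N}`. -/
def Ex {V : Type*} [Fintype V] (p : V → ℝ) (N : ℕ) (f : (Fin N → V) → ℝ) : ℝ :=
  ∑ ω : Fin N → V, (∏ i, p (ω i)) * f ω

section
variable {V : Type*} [Fintype V] {p : V → ℝ} {N : ℕ}

lemma Ex_add (f g : (Fin N → V) → ℝ) : Ex p N (fun ω => f ω + g ω) = Ex p N f + Ex p N g := by
  simp [Ex, mul_add, Finset.sum_add_distrib]

lemma Ex_mul (c : ℝ) (f : (Fin N → V) → ℝ) : Ex p N (fun ω => c * f ω) = c * Ex p N f := by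
  simp only [Ex, Finset.mul_sum]
  exact Finset.sum_congr rfl fun ω _ => by ring

lemma Ex_sum {ι : Type*} (s : Finset ι) (f : ι → (Fin N → V) → ℝ) :
    Ex p N (fun ω => ∑ i ∈ s, f i ω) = ∑ i ∈ s, Ex p N (f i) := by
  simp only [Ex, Finset.mul_sum]
  rw [Finset.sum_comm]

lemma Ex_mono (hp : ∀ x, 0 ≤ p x) {f g : (Fin N → V) → ℝ} (h : ∀ ω, f ω ≤ g ω) :
    Ex p N f ≤ Ex p N g :=
  Finset.sum_le_sum fun ω _ =>
    mul_le_mul_of_nonneg_left (h ω) (Finset.prod_nonneg fun i _ => hp _)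

lemma Ex_succ (f : (Fin (N + 1) → V) → ℝ) :
    Ex p (N + 1) f = ∑ v, p v * Ex p N (fun ω => f (Fin.cons v ω)) := by
  unfold Ex
  rw [← (Fin.consEquiv (fun _ : Fin (N + 1) => V)).sum_comp, Fintype.sum_prod_type]
  refine Finset.sum_congr rfl fun v _ => ?_
  rw [Finset.mul_sum]
  refine Finset.sum_congr rfl fun ω _ => ?_
  simp [Fin.consEquiv, Fin.prod_univ_succ, mul_assoc]

lemma Ex_const (h1 : ∑ x, p x = 1) (c : ℝ) : Ex p N (fun _ => c) = c := by
  induction N with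
  | zero => simp [Ex]
  | succ N ih => rw [Ex_succ]; simp only [ih]; rw [← Finset.sum_mul, h1, one_mul]

lemma Ex_lin (h1 : ∑ x, p x = 1) {Y : V → ℝ} (hY : ∑ x, p x * Y x = 0) :
    Ex p N (fun ω => ∑ i, Y (ω i)) = 0 := by
  induction N with
  | zero => simp [Ex]
  | succ N ih =>
    rw [Ex_succ]
    simp only [Fin.sum_univ_succ, Fin.cons_zero, Fin.cons_succ, Ex_add, Ex_const h1, ih, add_zero]
    exact hY

lemma Ex_bil (h1 : ∑ x, p x = 1) {Y Z : V → ℝ} (hY : ∑ x, p x * Y x = 0)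
    (hZ : ∑ x, p x * Z x = 0) :
    Ex p N (fun ω => (∑ i, Y (ω i)) * (∑ i, Z (ω i))) = N * ∑ x, p x * (Y x * Z x) := by
  induction N with
  | zero => simp [Ex]
  | succ N ih =>
    rw [Ex_succ]
    simp only [Fin.sum_univ_succ, Fin.cons_zero, Fin.cons_succ]
    have e : ∀ v, Ex p N (fun ω => (Y v + ∑ i, Y (ω i)) * (Z v + ∑ i, Z (ω i)))
        = Y v * Z v + N * ∑ x, p x * (Y x * Z x) := by
      intro v
      have : (fun ω : Fin N → V => (Y v + ∑ i, Y (ω i)) * (Z v + ∑ i, Z (ω i)))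
        = fun ω => Y v * Z v + (Y v * (∑ i, Z (ω i)) + (Z v * (∑ i, Y (ω i))
          + (∑ i, Y (ω i)) * (∑ i, Z (ω i)))) := by funext ω; ring
      simp only [this, Ex_add, Ex_mul, Ex_const h1, Ex_lin h1 hY, Ex_lin h1 hZ, ih]
      ring
    simp only [e]
    simp only [mul_add, Finset.sum_add_distrib]
    rw [← Finset.sum_mul, h1]
    push_cast; ring

lemma Ex_quad (hp : ∀ x, 0 ≤ p x) (h1 : ∑ x, p x = 1) {Y Z : V → ℝ} (hY : ∑ x, p x * Y x = 0)
    (hZ : ∑ x, p x * Z x = 0) :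
    Ex p N (fun ω => (∑ i, Y (ω i)) ^ 2 * (∑ i, Z (ω i)) ^ 2)
      ≤ N * ∑ x, p x * (Y x ^ 2 * Z x ^ 2)
        + 3 * N ^ 2 * ((∑ x, p x * Y x ^ 2) * ∑ x, p x * Z x ^ 2) := by
  have hcs : (∑ x, p x * (Y x * Z x)) ^ 2 ≤ (∑ x, p x * Y x ^ 2) * ∑ x, p x * Z x ^ 2 := by
    refine Finset.sum_sq_le_sum_mul_sum_of_sq_le_mul _ (fun x _ => ?_) (fun x _ => ?_)
      (fun x _ => ?_)
    · exact mul_nonneg (hp x) (sq_nonneg _)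
    · exact mul_nonneg (hp x) (sq_nonneg _)
    · apply le_of_eq; ring
  have hYZ : 0 ≤ (∑ x, p x * Y x ^ 2) * ∑ x, p x * Z x ^ 2 := (sq_nonneg _).trans hcs
  induction N with
  | zero => simp [Ex]
  | succ N ih =>
    rw [Ex_succ]
    simp only [Fin.sum_univ_succ, Fin.cons_zero, Fin.cons_succ]
    set A := ∑ x, p x * Y x ^ 2 with hA
    set B := ∑ x, p x * Z x ^ 2 with hB
    set C := ∑ x, p x * (Y x * Z x) with hC
    set D := ∑ x, p x * (Y x ^ 2 * Z x ^ 2) with hD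
    set q1 := Ex p N (fun ω => (∑ i, Y (ω i)) * (∑ i, Z (ω i)) ^ 2) with hq1
    set q2 := Ex p N (fun ω => (∑ i, Y (ω i)) ^ 2 * (∑ i, Z (ω i))) with hq2
    set q := Ex p N (fun ω => (∑ i, Y (ω i)) ^ 2 * (∑ i, Z (ω i)) ^ 2) with hq
    have hYY : Ex p N (fun ω => (∑ i, Y (ω i)) ^ 2) = N * A := by
      have := Ex_bil (N := N) h1 hY hY
      simpa only [← sq] using this
    have hZZ : Ex p N (fun ω => (∑ i, Z (ω i)) ^ 2) = N * B := by
      have := Ex_bil (N := N) h1 hZ hZ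
      simpa only [← sq] using this
    have e : ∀ v, Ex p N (fun ω => (Y v + ∑ i, Y (ω i)) ^ 2 * (Z v + ∑ i, Z (ω i)) ^ 2)
        = Y v ^ 2 * Z v ^ 2 + (Y v ^ 2 * (N * B) + (Z v ^ 2 * (N * A) + (4 * (Y v * Z v) * (N * C)
          + (2 * Y v * q1 + (2 * Z v * q2 + q))))) := by
      intro v
      have : (fun ω : Fin N → V => (Y v + ∑ i, Y (ω i)) ^ 2 * (Z v + ∑ i, Z (ω i)) ^ 2)
        = fun ω => Y v ^ 2 * Z v ^ 2 + (2 * Y v ^ 2 * Z v * (∑ i, Z (ω i))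
          + (2 * Y v * Z v ^ 2 * (∑ i, Y (ω i))
          + (Y v ^ 2 * (∑ i, Z (ω i)) ^ 2 + (Z v ^ 2 * (∑ i, Y (ω i)) ^ 2
          + (4 * (Y v * Z v) * ((∑ i, Y (ω i)) * (∑ i, Z (ω i)))
          + (2 * Y v * ((∑ i, Y (ω i)) * (∑ i, Z (ω i)) ^ 2)
          + (2 * Z v * ((∑ i, Y (ω i)) ^ 2 * (∑ i, Z (ω i)))
          + (∑ i, Y (ω i)) ^ 2 * (∑ i, Z (ω i)) ^ 2))))))) := by
        funext ω; ring
      rw [this]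
      simp only [Ex_add, Ex_mul, Ex_const h1, Ex_lin h1 hY, Ex_lin h1 hZ, hYY, hZZ,
        Ex_bil h1 hY hZ]
      ring
    have e2 : ∑ v, p v * Ex p N (fun ω => (Y v + ∑ i, Y (ω i)) ^ 2 * (Z v + ∑ i, Z (ω i)) ^ 2)
        = D + A * (N * B) + B * (N * A) + 4 * C * (N * C) + q := by
      simp only [e]
      calc _ = ∑ v, (p v * (Y v ^ 2 * Z v ^ 2) + (p v * Y v ^ 2) * (N * B)
              + (p v * Z v ^ 2) * (N * A) + (p v * (Y v * Z v)) * (4 * (N * C))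
              + (p v * Y v) * (2 * q1) + (p v * Z v) * (2 * q2) + p v * q) := by
            refine Finset.sum_congr rfl fun v _ => ?_
            ring
        _ = _ := by
            simp only [Finset.sum_add_distrib, ← Finset.sum_mul, hY, hZ, h1]
            rw [← hA, ← hB, ← hC, ← hD]
            ring
    rw [e2]
    have hN : (0 : ℝ) ≤ N := Nat.cast_nonneg N
    push_cast
    have := mul_le_mul_of_nonneg_left hcs hN
    nlinarith

end


/-! ### Part D: trigonometric kernels on the grid -/

/-- Midpoints of the cells of the 1D grid. -/
def zg (L : ℕ) (j : Fin L) : ℝ := ((j : ℕ) + 1 / 2) / L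

lemma sum_cos_grid (L : ℕ) (m : ℕ) (hm : 0 < m) (hm2 : m < 2 * L) :
    ∑ j : Fin L, Real.cos (Real.pi * m * zg L j) = 0 := by
  have hL : (0 : ℝ) < L := by
    have : 0 < L := by omega
    exact_mod_cast this
  have hs : Real.sin (Real.pi * m / (2 * L)) ≠ 0 := by
    apply ne_of_gt
    apply Real.sin_pos_of_pos_of_lt_pi
    · have : (0 : ℝ) < m := by exact_mod_cast hm
      positivity
    · rw [div_lt_iff₀ (by positivity)]
      have : (m : ℝ) < 2 * L := by exact_mod_cast hm2
      have := Real.pi_pos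
      nlinarith
  have tel : ∀ M : ℕ, 2 * Real.sin (Real.pi * m / (2 * L)) *
      ∑ j ∈ Finset.range M, Real.cos (Real.pi * m * (((j : ℝ) + 1 / 2) / L))
      = Real.sin (Real.pi * m * M / L) := by
    intro M
    induction M with
    | zero => simp
    | succ M ih =>
      rw [Finset.sum_range_succ, mul_add, ih]
      have e1 : Real.pi * m * (M : ℝ) / L
        = Real.pi * m * (((M : ℝ) + 1 / 2) / L) - Real.pi * m / (2 * L) := by
        field_simp; ring
      have e2 : Real.pi * m * ((M + 1 : ℕ) : ℝ) / L
        = Real.pi * m * (((M : ℝ) + 1 / 2) / L) + Real.pi * m / (2 * L) := by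
        push_cast; field_simp; ring
      rw [e1, e2, Real.sin_sub, Real.sin_add]
      ring
  have h := tel L
  have e : Real.pi * m * (L : ℝ) / L = m * Real.pi := by field_simp
  rw [e, Real.sin_nat_mul_pi] at h
  have h2 : (2 * Real.sin (Real.pi * m / (2 * L))) ≠ 0 := mul_ne_zero two_ne_zero hs
  have := (mul_eq_zero.1 h).resolve_left h2
  rw [Finset.sum_range] at this
  simpa [zg] using this

lemma sum_cos_grid_int (L : ℕ) (j l : ℕ) (hj : j < 2 * L) (hl : l < 2 * L) :
    ∑ x : Fin L, Real.cos (Real.pi * ((j : ℝ) - l) * zg L x) = if j = l then (L : ℝ) else 0 := by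
  split_ifs with h
  · simp [h]
  · rcases lt_or_gt_of_ne h with h | h
    · have := sum_cos_grid L (l - j) (by omega) (by omega)
      rw [← this]
      refine Finset.sum_congr rfl fun x _ => ?_
      rw [← Real.cos_neg, Nat.cast_sub h.le]
      congr 1; ring
    · have := sum_cos_grid L (j - l) (by omega) (by omega)
      rw [← this]
      refine Finset.sum_congr rfl fun x _ => ?_
      rw [Nat.cast_sub h.le]

/-- Normalised cosines. -/
def nrm (L k : ℕ) : ℝ := if k = 0 then √(1 / L) else √(2 / L)

def eh (L k : ℕ) (j : Fin L) : ℝ := nrm L k * Real.cos (Real.pi * k * zg L j)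

lemma eh_orth (L : ℕ) (k l : ℕ) (hk : k < L) (hl : l < L) :
    ∑ x : Fin L, eh L k x * eh L l x = if k = l then 1 else 0 := by
  have hL : (0 : ℝ) < L := by
    have : 0 < L := by omega
    exact_mod_cast this
  have e : ∑ x : Fin L, eh L k x * eh L l x = nrm L k * nrm L l / 2 *
      (∑ x : Fin L, Real.cos (Real.pi * ((k : ℝ) - l) * zg L x)
        + ∑ x : Fin L, Real.cos (Real.pi * (((k + l : ℕ) : ℝ) - (0 : ℕ)) * zg L x)) := by
    rw [← Finset.sum_add_distrib, Finset.mul_sum]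
    refine Finset.sum_congr rfl fun x _ => ?_
    have a1 : Real.pi * ((k : ℝ) - l) * zg L x
      = Real.pi * k * zg L x - Real.pi * l * zg L x := by ring
    have a2 : Real.pi * (((k + l : ℕ) : ℝ) - (0 : ℕ)) * zg L x
      = Real.pi * k * zg L x + Real.pi * l * zg L x := by push_cast; ring
    rw [a1, a2, Real.cos_sub, Real.cos_add]
    unfold eh
    ring
  rw [e, sum_cos_grid_int L k l (by omega) (by omega),
    sum_cos_grid_int L (k + l) 0 (by omega) (by omega)]
  by_cases hkl : k = l
  · subst hkl
    by_cases hk0 : k = 0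
    · subst hk0
      simp only [nrm, if_true]
      rw [Real.mul_self_sqrt (by positivity)]
      field_simp; norm_num
    · have : k + k ≠ 0 := by omega
      simp only [nrm, hk0, this, if_false, if_true]
      rw [Real.mul_self_sqrt (by positivity)]
      field_simp; norm_num
  · have : k + l ≠ 0 := by omega
    simp [hkl]
    omega

/-- Squared modulus of a trigonometric polynomial. -/
def kap (M : ℕ) (c : ℕ → ℝ) (θ : ℝ) : ℝ :=
  (∑ j ∈ Finset.range M, c j * Real.cos (j * θ)) ^ 2
    + (∑ j ∈ Finset.range M, c j * Real.sin (j * θ)) ^ 2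

lemma kap_nonneg (M : ℕ) (c : ℕ → ℝ) (θ : ℝ) : 0 ≤ kap M c θ := by unfold kap; positivity

lemma kap_expand (M : ℕ) (c : ℕ → ℝ) (θ : ℝ) :
    kap M c θ = ∑ j ∈ Finset.range M, ∑ l ∈ Finset.range M,
      c j * c l * Real.cos (((j : ℝ) - l) * θ) := by
  unfold kap
  rw [sq, sq, Finset.sum_mul_sum, Finset.sum_mul_sum, ← Finset.sum_add_distrib]
  refine Finset.sum_congr rfl fun j _ => ?_
  rw [← Finset.sum_add_distrib]
  refine Finset.sum_congr rfl fun l _ => ?_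
  rw [sub_mul, Real.cos_sub]
  ring

lemma kap_le (M : ℕ) (c : ℕ → ℝ) (θ : ℝ) (hc : ∑ j ∈ Finset.range M, c j ^ 2 = 1) :
    kap M c θ ≤ M := by
  unfold kap
  have h1 := Finset.sum_mul_sq_le_sq_mul_sq (Finset.range M) c (fun j => Real.cos (j * θ))
  have h2 := Finset.sum_mul_sq_le_sq_mul_sq (Finset.range M) c (fun j => Real.sin (j * θ))
  rw [hc, one_mul] at h1 h2
  have h3 : ∑ j ∈ Finset.range M, Real.cos (j * θ) ^ 2 + ∑ j ∈ Finset.range M, Real.sin (j * θ) ^ 2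
      = M := by
    rw [← Finset.sum_add_distrib]; simp [Real.cos_sq_add_sin_sq]
  linarith

/-- The one-dimensional reflected kernel. -/
def K1 (L M : ℕ) (c : ℕ → ℝ) (x y : Fin L) : ℝ :=
  (kap M c (Real.pi * (zg L x - zg L y)) + kap M c (Real.pi * (zg L x + zg L y))) / (2 * L)

lemma K1_expand (L M : ℕ) (c : ℕ → ℝ) (x y : Fin L) :
    K1 L M c x y = (1 / L : ℝ) * ∑ j ∈ Finset.range M, ∑ l ∈ Finset.range M, c j * c l *
      (Real.cos (Real.pi * ((j : ℝ) - l) * zg L x) * Real.cos (Real.pi * ((j : ℝ) - l) * zg L y)) := by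
  unfold K1
  rw [kap_expand, kap_expand, ← Finset.sum_add_distrib, Finset.sum_div, Finset.mul_sum]
  refine Finset.sum_congr rfl fun j _ => ?_
  rw [← Finset.sum_add_distrib, Finset.sum_div, Finset.mul_sum]
  refine Finset.sum_congr rfl fun l _ => ?_
  have e1 : ((j : ℝ) - l) * (Real.pi * (zg L x - zg L y))
    = Real.pi * ((j : ℝ) - l) * zg L x - Real.pi * ((j : ℝ) - l) * zg L y := by ring
  have e2 : ((j : ℝ) - l) * (Real.pi * (zg L x + zg L y))
    = Real.pi * ((j : ℝ) - l) * zg L x + Real.pi * ((j : ℝ) - l) * zg L y := by ring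
  rw [e1, e2, Real.cos_sub, Real.cos_add]
  field_simp
  ring

lemma K1_nonneg (L M : ℕ) (c : ℕ → ℝ) (x y : Fin L) : 0 ≤ K1 L M c x y :=
  div_nonneg (add_nonneg (kap_nonneg _ _ _) (kap_nonneg _ _ _)) (by positivity)

lemma K1_symm (L M : ℕ) (c : ℕ → ℝ) (x y : Fin L) : K1 L M c x y = K1 L M c y x := by
  rw [K1_expand, K1_expand]
  congr 1
  refine Finset.sum_congr rfl fun j _ => Finset.sum_congr rfl fun l _ => ?_
  ring

lemma K1_sum (L M : ℕ) (c : ℕ → ℝ) (hM : M ≤ 2 * L) (hL : 0 < L) (y : Fin L) :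
    ∑ x, K1 L M c x y = ∑ j ∈ Finset.range M, c j ^ 2 := by
  have hL' : (L : ℝ) ≠ 0 := by positivity
  simp only [K1_expand]
  rw [← Finset.mul_sum, Finset.sum_comm, Finset.mul_sum]
  refine Finset.sum_congr rfl fun j hj => ?_
  rw [Finset.sum_comm]
  have : ∀ l ∈ Finset.range M, ∑ x : Fin L, c j * c l *
      (Real.cos (Real.pi * ((j : ℝ) - l) * zg L x) * Real.cos (Real.pi * ((j : ℝ) - l) * zg L y))
      = if j = l then c j ^ 2 * L else 0 := by
    intro l hl
    rw [Finset.mem_range] at hj hl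
    rw [← Finset.mul_sum, ← Finset.sum_mul, sum_cos_grid_int L j l (by omega) (by omega)]
    split_ifs with h
    · subst h; simp only [sub_self, mul_zero, zero_mul, Real.cos_zero, mul_one]; ring
    · simp
  rw [Finset.sum_congr rfl this, Finset.sum_ite_eq, if_pos hj]
  field_simp

lemma K1_le (L M : ℕ) (c : ℕ → ℝ) (hL : 0 < L) (hc : ∑ j ∈ Finset.range M, c j ^ 2 = 1)
    (x y : Fin L) : K1 L M c x y ≤ M / L := by
  unfold K1
  have hL' : (0 : ℝ) < L := by positivity
  rw [div_le_div_iff₀ (by positivity) hL']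
  have h1 := kap_le M c (Real.pi * (zg L x - zg L y)) hc
  have h2 := kap_le M c (Real.pi * (zg L x + zg L y)) hc
  nlinarith

/-- The sine coefficients. -/
def cs (M : ℕ) (j : ℕ) : ℝ := √(2 / M) * Real.sin (Real.pi * j / M)

lemma cs_sum (M : ℕ) (hM : 2 ≤ M) : ∑ j ∈ Finset.range M, cs M j ^ 2 = 1 := by
  have hM' : (2 : ℝ) ≤ M := by exact_mod_cast hM
  have hM0 : (M : ℝ) ≠ 0 := by positivity
  have hs : Real.sin (Real.pi / M) ≠ 0 := by
    apply ne_of_gt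
    apply Real.sin_pos_of_pos_of_lt_pi
    · positivity
    · rw [div_lt_iff₀ (by positivity)]; nlinarith [Real.pi_pos]
  have tel : ∀ m : ℕ, 2 * Real.sin (Real.pi / M) *
      ∑ j ∈ Finset.range m, Real.cos (2 * (Real.pi * j / M))
      = Real.sin ((2 * m - 1) * (Real.pi / M)) + Real.sin (Real.pi / M) := by
    intro m
    induction m with
    | zero => simp
    | succ m ih =>
      rw [Finset.sum_range_succ, mul_add, ih]
      have e1 : (2 * ((m : ℕ) : ℝ) - 1) * (Real.pi / M) = 2 * (Real.pi * m / M) - Real.pi / M := by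
        ring
      have e2 : (2 * ((m + 1 : ℕ) : ℝ) - 1) * (Real.pi / M) = 2 * (Real.pi * m / M) + Real.pi / M := by
        push_cast; ring
      rw [e1, e2, Real.sin_sub, Real.sin_add]; ring
  have h := tel M
  have e : (2 * (M : ℝ) - 1) * (Real.pi / M) = 2 * Real.pi - Real.pi / M := by field_simp
  rw [e, Real.sin_two_pi_sub, neg_add_cancel] at h
  have h0 := (mul_eq_zero.1 h).resolve_left (mul_ne_zero two_ne_zero hs)
  have : ∀ j ∈ Finset.range M, cs M j ^ 2 = (1 / M : ℝ) - (1 / M) * Real.cos (2 * (Real.pi * j / M)) := by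
    intro j _
    unfold cs
    rw [mul_pow, Real.sq_sqrt (by positivity), Real.sin_sq_eq_half_sub]
    ring
  rw [Finset.sum_congr rfl this, Finset.sum_sub_distrib, ← Finset.mul_sum, h0]
  simp [hM0]

/-- Differences of the sine coefficients. -/
def ds (M : ℕ) : ℕ → ℝ
  | 0 => 0
  | j + 1 => cs M (j + 1) - cs M j

lemma ds_sum (M : ℕ) (hM : 2 ≤ M) : ∑ j ∈ Finset.range (M + 1), ds M j ^ 2 ≤ 20 / M ^ 2 := by
  have hM' : (2 : ℝ) ≤ M := by exact_mod_cast hM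
  have hM0 : (0 : ℝ) < M := by positivity
  rw [Finset.sum_range_succ']
  have h : ∀ j ∈ Finset.range M, ds M (j + 1) ^ 2 ≤ 20 / M ^ 3 := by
    intro j _
    simp only [ds, cs]
    rw [← mul_sub, mul_pow, Real.sq_sqrt (by positivity)]
    have h1 : |Real.sin (Real.pi * ((j + 1 : ℕ) : ℝ) / M) - Real.sin (Real.pi * j / M)|
        ≤ Real.pi / M := by
      have := Real.lipschitzWith_sin.dist_le_mul (Real.pi * ((j + 1 : ℕ) : ℝ) / M) (Real.pi * j / M)
      rw [Real.dist_eq, Real.dist_eq, NNReal.coe_one, one_mul] at this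
      refine this.trans (le_of_eq ?_)
      have e : Real.pi * ((j + 1 : ℕ) : ℝ) / M - Real.pi * j / M = Real.pi / M := by
        push_cast; ring
      rw [e, abs_of_nonneg]
      positivity
    have h2 := sq_le_sq' (by linarith [neg_abs_le (Real.sin (Real.pi * ((j + 1 : ℕ) : ℝ) / M) - Real.sin (Real.pi * j / M))]) ((le_abs_self _).trans h1)
    have h3 : (Real.pi / M) ^ 2 ≤ 10 / M ^ 2 := by
      rw [div_pow]
      gcongr
      nlinarith [Real.pi_lt_d2, Real.pi_pos]
    calc _ ≤ 2 / (M : ℝ) * (10 / M ^ 2) := by gcongr; exact h2.trans h3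
      _ = _ := by field_simp; norm_num
  calc _ ≤ ∑ j ∈ Finset.range M, (20 / M ^ 3 : ℝ) + 0 := by
        refine add_le_add (Finset.sum_le_sum h) (by simp [ds])
    _ = _ := by simp; field_simp

lemma kap_ds (M : ℕ) (hM : 2 ≤ M) (θ : ℝ) :
    (2 - 2 * Real.cos θ) * kap M (cs M) θ = kap (M + 1) (ds M) θ := by
  have hM0 : (M : ℝ) ≠ 0 := by positivity
  have c0 : cs M 0 = 0 := by simp [cs]
  have cM : cs M M = 0 := by
    unfold cs; rw [mul_div_assoc, div_self hM0, mul_one, Real.sin_pi, mul_zero]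
  have gen : ∀ g : ℕ → ℝ, ∑ j ∈ Finset.range (M + 1), ds M j * g j
      = ∑ j ∈ Finset.range M, cs M j * g j - ∑ j ∈ Finset.range M, cs M j * g (j + 1) := by
    intro g
    rw [Finset.sum_range_succ']
    have e : ∑ j ∈ Finset.range M, cs M (j + 1) * g (j + 1) = ∑ j ∈ Finset.range M, cs M j * g j := by
      have h1 := Finset.sum_range_succ' (fun j => cs M j * g j) M
      have h2 := Finset.sum_range_succ (fun j => cs M j * g j) M
      rw [c0] at h1
      rw [cM] at h2
      linarith
    rw [← e, ← Finset.sum_sub_distrib]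
    simp only [ds, zero_mul, add_zero]
    exact Finset.sum_congr rfl fun j _ => by ring
  unfold kap
  rw [gen (fun j => Real.cos (j * θ)), gen (fun j => Real.sin (j * θ))]
  set P := ∑ j ∈ Finset.range M, cs M j * Real.cos (j * θ) with hP
  set S := ∑ j ∈ Finset.range M, cs M j * Real.sin (j * θ) with hS
  have e1 : ∑ j ∈ Finset.range M, cs M j * Real.cos (((j + 1 : ℕ) : ℝ) * θ)
      = P * Real.cos θ - S * Real.sin θ := by
    rw [hP, hS, Finset.sum_mul, Finset.sum_mul, ← Finset.sum_sub_distrib]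
    refine Finset.sum_congr rfl fun j _ => ?_
    push_cast; rw [add_mul, one_mul, Real.cos_add]; ring
  have e2 : ∑ j ∈ Finset.range M, cs M j * Real.sin (((j + 1 : ℕ) : ℝ) * θ)
      = S * Real.cos θ + P * Real.sin θ := by
    rw [hP, hS, Finset.sum_mul, Finset.sum_mul, ← Finset.sum_add_distrib]
    refine Finset.sum_congr rfl fun j _ => ?_
    push_cast; rw [add_mul, one_mul, Real.sin_add]; ring
  rw [e1, e2]
  have := Real.sin_sq_add_cos_sq θ
  have h2 : Real.sin θ ^ 2 = 1 - Real.cos θ ^ 2 := by linarith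
  ring_nf
  rw [h2]
  ring

lemma zg_mem (L : ℕ) (x : Fin L) : 0 ≤ zg L x ∧ zg L x ≤ 1 := by
  have hx := x.2
  have : (0 : ℝ) < L := by
    have : 0 < L := by omega
    exact_mod_cast this
  unfold zg
  refine ⟨by positivity, ?_⟩
  rw [div_le_one this]
  have : ((x : ℕ) : ℝ) + 1 ≤ L := by exact_mod_cast hx
  linarith

lemma sq_le_cos_sub {x y : ℝ} (hx : 0 ≤ x ∧ x ≤ 1) (hy : 0 ≤ y ∧ y ≤ 1) :
    (x - y) ^ 2 ≤ (2 - 2 * Real.cos (Real.pi * (x - y))) / 4 ∧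
    (x - y) ^ 2 ≤ (2 - 2 * Real.cos (Real.pi * (x + y))) / 4 := by
  have key : ∀ t d : ℝ, 0 ≤ t → t ≤ 1 → |d| ≤ t → d ^ 2 ≤ (2 - 2 * Real.cos (Real.pi * t)) / 4 := by
    intro t d h0 h1 hd
    have hpi := Real.pi_pos
    have hj := Real.mul_le_sin (x := Real.pi * t / 2) (by positivity) (by nlinarith)
    have e : 2 / Real.pi * (Real.pi * t / 2) = t := by field_simp
    rw [e] at hj
    have e2 : Real.cos (Real.pi * t) = 1 - 2 * Real.sin (Real.pi * t / 2) ^ 2 := by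
      have := Real.cos_sq' (Real.pi * t / 2)
      have h2 := Real.cos_two_mul (Real.pi * t / 2)
      rw [show 2 * (Real.pi * t / 2) = Real.pi * t by ring] at h2
      rw [h2, this]; ring
    rw [e2]
    have : d ^ 2 ≤ t ^ 2 := by
      rw [← sq_abs d]; gcongr
    nlinarith
  constructor
  · rcases le_total y x with h | h
    · exact key (x - y) (x - y) (by linarith) (by linarith) (by rw [abs_of_nonneg]; linarith)
    · have := key (y - x) (x - y) (by linarith) (by linarith) (by rw [abs_sub_comm, abs_of_nonneg]; linarith)
      rwa [show Real.pi * (y - x) = -(Real.pi * (x - y)) by ring, Real.cos_neg] at this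
  · rcases le_total (x + y) 1 with h | h
    · exact key (x + y) (x - y) (by linarith) (by linarith) (by rw [abs_le]; constructor <;> linarith)
    · have := key (2 - (x + y)) (x - y) (by linarith) (by linarith) (by rw [abs_le]; constructor <;> linarith)
      rwa [show Real.pi * (2 - (x + y)) = 2 * Real.pi - (Real.pi * (x + y)) by ring,
        Real.cos_two_pi_sub] at this

lemma K1_moment (L M : ℕ) (hM : 2 ≤ M) (hL : M ≤ L) (y : Fin L) :
    ∑ x, K1 L M (cs M) x y * (zg L x - zg L y) ^ 2 ≤ 5 / M ^ 2 := by
  have hL0 : (0 : ℝ) < L := by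
    have : 0 < L := by omega
    exact_mod_cast this
  have h : ∀ x, K1 L M (cs M) x y * (zg L x - zg L y) ^ 2 ≤ (1 / 4) * K1 L (M + 1) (ds M) x y := by
    intro x
    obtain ⟨a1, a2⟩ := sq_le_cos_sub (zg_mem L x) (zg_mem L y)
    unfold K1
    rw [← kap_ds M hM, ← kap_ds M hM, div_mul_eq_mul_div, mul_div_assoc', div_le_div_iff_of_pos_right (by positivity)]
    have b1 := mul_le_mul_of_nonneg_right a1 (kap_nonneg M (cs M) (Real.pi * (zg L x - zg L y)))
    have b2 := mul_le_mul_of_nonneg_right a2 (kap_nonneg M (cs M) (Real.pi * (zg L x + zg L y)))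
    nlinarith
  calc _ ≤ ∑ x, (1 / 4) * K1 L (M + 1) (ds M) x y := Finset.sum_le_sum fun x _ => h x
    _ = 1 / 4 * ∑ j ∈ Finset.range (M + 1), ds M j ^ 2 := by
        rw [← Finset.mul_sum, K1_sum L (M + 1) (ds M) (by omega) (by omega)]
    _ ≤ 1 / 4 * (20 / M ^ 2) := by gcongr; exact ds_sum M hM
    _ = _ := by ring



/-- Abstract summary of the grid objects. -/
structure Grid (V : Type) [Fintype V] (L n H : ℝ) where
  z : V → E2
  K : V → V → ℝ
  G : V → V → ℝ
  F : Bool → V → V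
  B : Bool → V → V
  hcard : (Fintype.card V : ℝ) = L ^ 2
  K_nonneg : ∀ x y, 0 ≤ K x y
  K_symm : ∀ x y, K x y = K y x
  K_row : ∀ x, ∑ y, K x y = 1
  K_le : ∀ x y, K x y ≤ n ^ 2 / L ^ 2
  K_mom : ∀ x, ∑ y, K x y * ‖z x - z y‖ ^ 2 ≤ 10 / n ^ 2
  lap : ∀ x y, ∑ d, ((G x y - G (F d x) y) + (G x y - G (B d x) y)) = K x y - 1 / L ^ 2
  adj : ∀ d (h : V → V → ℝ), (∀ x, h x x = 0) → ∑ x, h x (B d x) = ∑ x, h (F d x) x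
  dist_F : ∀ d x, ‖z (F d x) - z x‖ ≤ 1 / L
  dist_B : ∀ d x, ‖z (B d x) - z x‖ ≤ 1 / L
  vec : ∀ x (Ψ Ψ' : Bool → ℝ), (∀ d, 0 ≤ Ψ d) → (∀ d, 0 ≤ Ψ' d) →
    ‖∑ d, (Ψ d • (z (F d x) - z x) + Ψ' d • (z (B d x) - z x))‖ ^ 2
      ≤ (∑ d, (Ψ d ^ 2 + Ψ' d ^ 2)) / L ^ 2
  KG : ∑ x, ∑ y, K x y * G x y ≤ L ^ 2 * H
  GG : ∑ x, ∑ y, G x y ^ 2 ≤ 2 * L ^ 4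

def bk (n k : ℕ) : ℝ := ∑ j ∈ Finset.range n, ∑ l ∈ Finset.range n,
  if Nat.dist j l = k then cs n j * cs n l * (if k = 0 then 1 else 1 / 2) else 0

lemma cos_dist (L j l : ℕ) (hL : 0 < L) (x y : Fin L) :
    1 / L * (Real.cos (Real.pi * ((j : ℝ) - l) * zg L x) * Real.cos (Real.pi * ((j : ℝ) - l) * zg L y))
    = (if Nat.dist j l = 0 then 1 else 1 / 2) * (eh L (Nat.dist j l) x * eh L (Nat.dist j l) y) := by
  have hL' : (0 : ℝ) < L := by exact_mod_cast hL
  have hc : ∀ t, Real.cos (Real.pi * ((j : ℝ) - l) * t)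
      = Real.cos (Real.pi * (Nat.dist j l : ℕ) * t) := by
    intro t
    rcases le_total j l with h | h
    · rw [Nat.dist_eq_sub_of_le h, Nat.cast_sub h, ← Real.cos_neg]
      congr 1; ring
    · rw [Nat.dist_eq_sub_of_le_right h, Nat.cast_sub h]
  rw [hc, hc]
  unfold eh nrm
  split_ifs with h
  · have := Real.mul_self_sqrt (show (0 : ℝ) ≤ 1 / L by positivity)
    linear_combination (-(Real.cos (Real.pi * (Nat.dist j l : ℕ) * zg L x)
      * Real.cos (Real.pi * (Nat.dist j l : ℕ) * zg L y))) * this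
  · have := Real.mul_self_sqrt (show (0 : ℝ) ≤ 2 / L by positivity)
    linear_combination (-(Real.cos (Real.pi * (Nat.dist j l : ℕ) * zg L x)
      * Real.cos (Real.pi * (Nat.dist j l : ℕ) * zg L y)) / 2) * this

lemma K1_spec (L n : ℕ) (hL : 0 < L) (x y : Fin L) :
    K1 L n (cs n) x y = ∑ k ∈ Finset.range n, bk n k * (eh L k x * eh L k y) := by
  rw [K1_expand]
  have h1 : ∀ k ∈ Finset.range n, bk n k * (eh L k x * eh L k y)
      = ∑ j ∈ Finset.range n, ∑ l ∈ Finset.range n, if Nat.dist j l = k then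
        cs n j * cs n l * (1 / L * (Real.cos (Real.pi * ((j : ℝ) - l) * zg L x)
          * Real.cos (Real.pi * ((j : ℝ) - l) * zg L y))) else 0 := by
    intro k _
    unfold bk
    rw [Finset.sum_mul]
    refine Finset.sum_congr rfl fun j _ => ?_
    rw [Finset.sum_mul]
    refine Finset.sum_congr rfl fun l _ => ?_
    rw [ite_mul, zero_mul]
    by_cases h : Nat.dist j l = k
    · rw [if_pos h, if_pos h, cos_dist L j l hL, h]; ring
    · rw [if_neg h, if_neg h]
  symm
  rw [Finset.sum_congr rfl h1, Finset.sum_comm, Finset.mul_sum]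
  refine Finset.sum_congr rfl fun j hj => ?_
  rw [Finset.sum_comm, Finset.mul_sum]
  refine Finset.sum_congr rfl fun l hl => ?_
  rw [Finset.sum_ite_eq, if_pos]
  · ring
  · rw [Finset.mem_range] at *
    unfold Nat.dist; omega

lemma bk_zero (n : ℕ) (hn : 2 ≤ n) : bk n 0 = 1 := by
  unfold bk
  refine Eq.trans ?_ (cs_sum n hn)
  refine Finset.sum_congr rfl fun j hj => ?_
  have : ∀ l ∈ Finset.range n, (if Nat.dist j l = 0 then cs n j * cs n l * (if (0:ℕ) = 0 then 1 else 1 / 2) else 0)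
      = if j = l then cs n j ^ 2 else 0 := by
    intro l _
    by_cases h : j = l
    · subst h; simp; ring
    · rw [if_neg h, if_neg]
      intro h'; exact h (Nat.eq_of_dist_eq_zero h')
  rw [Finset.sum_congr rfl this, Finset.sum_ite_eq, if_pos hj]

lemma bk_eq (L n k : ℕ) (hn : 2 ≤ n) (hnL : n ≤ L) (hk : k < n) :
    ∑ x, ∑ y, K1 L n (cs n) x y * (eh L k x * eh L k y) = bk n k := by
  simp only [K1_spec L n (by omega), Finset.sum_mul]
  have : ∀ x : Fin L, ∑ y, ∑ l ∈ Finset.range n, bk n l * (eh L l x * eh L l y) * (eh L k x * eh L k y)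
      = bk n k * (eh L k x * eh L k x) := by
    intro x
    rw [Finset.sum_comm]
    have : ∀ l ∈ Finset.range n, ∑ y, bk n l * (eh L l x * eh L l y) * (eh L k x * eh L k y)
        = if l = k then bk n k * (eh L k x * eh L k x) else 0 := by
      intro l hl
      rw [Finset.mem_range] at hl
      have h := eh_orth L l k (by omega) (by omega)
      calc _ = bk n l * (eh L l x * eh L k x) * ∑ y, eh L l y * eh L k y := by
            rw [Finset.mul_sum]; exact Finset.sum_congr rfl fun y _ => by ring
        _ = _ := by
            rw [h]; split_ifs with h
            · subst h; ring
            · ring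
    rw [Finset.sum_congr rfl this, Finset.sum_ite_eq', if_pos (Finset.mem_range.2 hk)]
  simp only [this]
  rw [← Finset.mul_sum, eh_orth L k k (by omega) (by omega)]; simp

lemma bk_abs (L n k : ℕ) (hn : 2 ≤ n) (hnL : n ≤ L) (hk : k < n) : bk n k ^ 2 ≤ 1 := by
  rw [sq_le_one_iff_abs_le_one, ← bk_eq L n k hn hnL hk]
  have hs : ∀ y, ∑ x, K1 L n (cs n) x y = 1 := fun y => by
    rw [K1_sum L n _ (by omega) (by omega), cs_sum n hn]
  have hs' : ∀ x, ∑ y, K1 L n (cs n) x y = 1 := fun x => by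
    rw [← hs x]; exact Finset.sum_congr rfl fun y _ => K1_symm _ _ _ _ _
  have ho := eh_orth L k k (by omega) (by omega)
  rw [if_pos rfl] at ho
  calc |∑ x, ∑ y, K1 L n (cs n) x y * (eh L k x * eh L k y)|
      ≤ ∑ x, ∑ y, K1 L n (cs n) x y * ((eh L k x * eh L k x + eh L k y * eh L k y) / 2) := by
        refine (Finset.abs_sum_le_sum_abs _ _).trans (Finset.sum_le_sum fun x _ =>
          (Finset.abs_sum_le_sum_abs _ _).trans (Finset.sum_le_sum fun y _ => ?_))
        rw [abs_mul, abs_of_nonneg (K1_nonneg _ _ _ _ _)]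
        refine mul_le_mul_of_nonneg_left ?_ (K1_nonneg _ _ _ _ _)
        rw [abs_le]
        constructor <;> nlinarith [sq_nonneg (eh L k x - eh L k y), sq_nonneg (eh L k x + eh L k y)]
    _ = (∑ x, (∑ y, K1 L n (cs n) x y) * (eh L k x * eh L k x)) / 2
        + (∑ y, (∑ x, K1 L n (cs n) x y) * (eh L k y * eh L k y)) / 2 := by
        simp only [Finset.sum_mul]
        rw [Finset.sum_comm (f := fun y x => K1 L n (cs n) x y * (eh L k y * eh L k y))]
        rw [← add_div, ← Finset.sum_add_distrib, Finset.sum_div]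
        refine Finset.sum_congr rfl fun x _ => ?_
        rw [← Finset.sum_add_distrib, Finset.sum_div]
        exact Finset.sum_congr rfl fun y _ => by ring
    _ = 1 := by simp only [hs, hs', one_mul, ho]; norm_num
    _ ≤ 1 := le_rfl

def lam (L k : ℕ) : ℝ := 4 * Real.sin (Real.pi * k / (2 * L)) ^ 2

def up {L : ℕ} (i : Fin L) : Fin L := if h : i.1 + 1 < L then ⟨i.1 + 1, h⟩ else i
def dn {L : ℕ} (i : Fin L) : Fin L := ⟨i.1 - 1, by omega⟩

lemma eh_up (L k : ℕ) (i : Fin L) :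
    eh L k (up i) = nrm L k * Real.cos (Real.pi * k * zg L i + 2 * (Real.pi * k / (2 * L))) := by
  have hL : (0 : ℝ) < L := by
    have : 0 < L := by have := i.2; omega
    exact_mod_cast this
  unfold eh up
  split_ifs with h
  · unfold zg; congr 2; push_cast; field_simp; ring
  · have hi : i.1 + 1 = L := by have := i.2; omega
    have hi' : (i.1 : ℝ) = L - 1 := by
      have : ((i.1 + 1 : ℕ) : ℝ) = L := by rw [hi]
      push_cast at this; linarith
    congr 1
    have e1 : Real.pi * k * zg L i = k * Real.pi - (Real.pi * k / (2 * L)) := by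
      unfold zg; rw [hi']; field_simp; ring
    have e2 : Real.pi * k * zg L i + 2 * (Real.pi * k / (2 * L))
      = k * Real.pi + (Real.pi * k / (2 * L)) := by rw [e1]; ring
    rw [e2, e1, Real.cos_sub, Real.cos_add, Real.sin_nat_mul_pi]; ring

lemma eh_dn (L k : ℕ) (i : Fin L) :
    eh L k (dn i) = nrm L k * Real.cos (Real.pi * k * zg L i - 2 * (Real.pi * k / (2 * L))) := by
  have hL : (0 : ℝ) < L := by
    have : 0 < L := by have := i.2; omega
    exact_mod_cast this
  unfold eh dn
  congr 1
  rcases Nat.eq_zero_or_pos i.1 with h | h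
  · simp only [zg, h]
    rw [← Real.cos_neg]
    congr 1; push_cast; field_simp; ring
  · simp only [zg]
    rw [Nat.cast_sub h]
    congr 1; push_cast; field_simp; ring

lemma eh_lap (L k : ℕ) (i : Fin L) :
    (eh L k i - eh L k (up i)) + (eh L k i - eh L k (dn i)) = lam L k * eh L k i := by
  rw [eh_up, eh_dn, Real.cos_add, Real.cos_sub]
  unfold eh lam
  rw [Real.cos_two_mul, Real.cos_sq']
  ring

lemma adj1 {L : ℕ} (h : Fin L → Fin L → ℝ) (h0 : ∀ x, h x x = 0) :
    ∑ x, h x (dn x) = ∑ x, h (up x) x := by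
  cases L with
  | zero => simp
  | succ m =>
    rw [Fin.sum_univ_succ, Fin.sum_univ_castSucc (fun x => h (up x) x)]
    have e1 : dn (0 : Fin (m + 1)) = 0 := by ext; simp [dn]
    have e2 : up (Fin.last m) = Fin.last m := by simp [up]
    rw [e1, e2, h0, h0, zero_add, add_zero]
    refine Finset.sum_congr rfl fun i _ => ?_
    have e3 : dn i.succ = i.castSucc := by ext; simp [dn]
    have e4 : up i.castSucc = i.succ := by ext; simp [up]
    rw [e3, e4]

lemma zg_up {L : ℕ} (i : Fin L) : ∃ t : ℝ, 0 ≤ t ∧ t ≤ 1 ∧ zg L (up i) - zg L i = t / L := by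
  have hL : (0 : ℝ) < L := by
    have : 0 < L := by have := i.2; omega
    exact_mod_cast this
  unfold up
  split_ifs with h
  · exact ⟨1, by norm_num, by norm_num, by unfold zg; push_cast; field_simp; ring⟩
  · exact ⟨0, by norm_num, by norm_num, by simp⟩

lemma zg_dn {L : ℕ} (i : Fin L) : ∃ t : ℝ, 0 ≤ t ∧ t ≤ 1 ∧ zg L (dn i) - zg L i = - t / L := by
  have hL : (0 : ℝ) < L := by
    have : 0 < L := by have := i.2; omega
    exact_mod_cast this
  rcases Nat.eq_zero_or_pos i.1 with h | h
  · refine ⟨0, by norm_num, by norm_num, ?_⟩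
    have : dn i = i := by ext; simp [dn, h]
    simp [this]
  · refine ⟨1, by norm_num, by norm_num, ?_⟩
    unfold zg dn
    simp only
    rw [Nat.cast_sub h]; push_cast; field_simp; ring


lemma arctan_step (a b : ℝ) (ha : 0 ≤ a) (hab : a ≤ b) :
    (b - a) / (1 + b ^ 2) ≤ Real.arctan b - Real.arctan a := by
  have h := Convex.mul_sub_le_image_sub_of_le_deriv (convex_Icc a b)
    (f := Real.arctan) (C := 1 / (1 + b ^ 2)) Real.continuous_arctan.continuousOn
    Real.differentiable_arctan.differentiableOn (by
      intro x hx
      rw [interior_Icc] at hx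
      rw [Real.deriv_arctan]
      have h1 : 0 ≤ x := ha.trans hx.1.le
      have h2 : x ^ 2 ≤ b ^ 2 := pow_le_pow_left₀ h1 hx.2.le 2
      exact one_div_le_one_div_of_le (by positivity) (by linarith)) a (Set.left_mem_Icc.2 hab) b (Set.right_mem_Icc.2 hab) hab
  calc _ = 1 / (1 + b ^ 2) * (b - a) := by ring
    _ ≤ _ := h

lemma sum_inv_sq_add (k m : ℕ) (hk : 0 < k) :
    ∑ j ∈ Finset.range m, 1 / ((k : ℝ) ^ 2 + ((j : ℝ) + 1) ^ 2) ≤ Real.pi / (2 * k) := by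
  have hk' : (0 : ℝ) < k := by exact_mod_cast hk
  have h : ∀ m : ℕ, ∑ j ∈ Finset.range m, 1 / ((k : ℝ) ^ 2 + ((j : ℝ) + 1) ^ 2)
      ≤ Real.arctan (m / k) / k := by
    intro m
    induction m with
    | zero => simp
    | succ m ih =>
      rw [Finset.sum_range_succ]
      have h1 := arctan_step ((m : ℝ) / k) ((m + 1 : ℝ) / k) (by positivity) (by gcongr; linarith)
      have e : ((m + 1 : ℝ) / k - m / k) / (1 + ((m + 1 : ℝ) / k) ^ 2)
        = k * (1 / ((k : ℝ) ^ 2 + ((m : ℝ) + 1) ^ 2)) := by field_simp; ring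
      rw [e] at h1
      push_cast
      rw [le_div_iff₀ hk'] at ih ⊢
      linarith
  refine (h m).trans ?_
  rw [div_le_div_iff₀ hk' (by positivity)]
  have := (Real.arctan_lt_pi_div_two ((m : ℝ) / k)).le
  nlinarith

lemma sum_inv_sq (m : ℕ) : ∑ j ∈ Finset.range m, 1 / ((j : ℝ) + 1) ^ 2 ≤ 2 := by
  have h : ∀ m : ℕ, ∑ j ∈ Finset.range (m + 1), 1 / ((j : ℝ) + 1) ^ 2 ≤ 2 - 1 / ((m : ℝ) + 1) := by
    intro m
    induction m with
    | zero => simp; norm_num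
    | succ m ih =>
      rw [Finset.sum_range_succ]
      have : 1 / ((m : ℝ) + 1 + 1) ^ 2 ≤ 1 / ((m : ℝ) + 1) - 1 / ((m : ℝ) + 1 + 1) := by
        rw [div_sub_div _ _ (by positivity) (by positivity), div_le_div_iff₀ (by positivity) (by positivity)]
        nlinarith [(Nat.cast_nonneg m : (0 : ℝ) ≤ m)]
      push_cast
      linarith
  cases m with
  | zero => simp
  | succ m =>
    have h2 := h m
    have : 0 ≤ 1 / ((m : ℝ) + 1) := by positivity
    linarith

lemma sum_inv (m : ℕ) : ∑ j ∈ Finset.range m, 1 / ((j : ℝ) + 1) ≤ 1 + Real.log m := by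
  have := harmonic_le_one_add_log m
  unfold harmonic at this
  push_cast at this
  simpa [one_div] using this

lemma gsum (n : ℕ) (hn : 2 ≤ n) :
    ∑ k ∈ Finset.range n, ∑ l ∈ Finset.range n, 1 / ((k : ℝ) ^ 2 + (l : ℝ) ^ 2)
      ≤ Real.pi / 2 * Real.log n + 6 := by
  obtain ⟨m, rfl⟩ : ∃ m, n = m + 1 := ⟨n - 1, by omega⟩
  have hm : (0 : ℝ) < m := by exact_mod_cast (by omega : 0 < m)
  rw [Finset.sum_range_succ']
  have h1 : ∀ j ∈ Finset.range m, ∑ l ∈ Finset.range (m + 1), 1 / (((j + 1 : ℕ) : ℝ) ^ 2 + (l : ℝ) ^ 2)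
      ≤ Real.pi / 2 * (1 / ((j : ℝ) + 1)) + 1 / ((j : ℝ) + 1) ^ 2 := by
    intro j _
    rw [Finset.sum_range_succ']
    have := sum_inv_sq_add (j + 1) m (by omega)
    push_cast at this ⊢
    have e : Real.pi / (2 * ((j : ℝ) + 1)) = Real.pi / 2 * (1 / ((j : ℝ) + 1)) := by field_simp
    rw [e] at this
    simp only [ne_eq, OfNat.ofNat_ne_zero, not_false_eq_true, zero_pow, add_zero]
    linarith
  have h2 : ∑ l ∈ Finset.range (m + 1), 1 / (((0 : ℕ) : ℝ) ^ 2 + (l : ℝ) ^ 2) ≤ 2 := by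
    rw [Finset.sum_range_succ']
    have := sum_inv_sq m
    simpa using this
  have h3 := Finset.sum_le_sum h1
  rw [Finset.sum_add_distrib, ← Finset.mul_sum] at h3
  have h4 := sum_inv m
  have h5 := sum_inv_sq m
  have h6 : Real.log m ≤ Real.log ((m + 1 : ℕ) : ℝ) := Real.log_le_log hm (by push_cast; linarith)
  have hp := Real.pi_pos
  have hp4 := Real.pi_le_four
  have h7 : Real.pi / 2 * ∑ j ∈ Finset.range m, 1 / ((j : ℝ) + 1) ≤ Real.pi / 2 * (1 + Real.log ((m + 1 : ℕ) : ℝ)) := by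
    gcongr; linarith
  nlinarith

lemma gsum2 (n : ℕ) :
    ∑ k ∈ Finset.range n, ∑ l ∈ Finset.range n, 1 / ((k : ℝ) ^ 2 + (l : ℝ) ^ 2) ^ 2 ≤ 27 := by
  have h1 : ∀ k l : ℕ, 1 / ((k : ℝ) ^ 2 + (l : ℝ) ^ 2) ^ 2
      ≤ 3 * ((1 / (1 + (k : ℝ) ^ 2)) * (1 / (1 + (l : ℝ) ^ 2))) := by
    intro k l
    by_cases h : k = 0 ∧ l = 0
    · obtain ⟨rfl, rfl⟩ := h; simp
    · have hs : (1 : ℝ) ≤ (k : ℝ) ^ 2 + (l : ℝ) ^ 2 := by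
        have : 1 ≤ k ^ 2 + l ^ 2 := by
          rcases Nat.eq_zero_or_pos k with h1 | h1
          · have : 0 < l := by omega
            nlinarith
          · nlinarith
        exact_mod_cast this
      have e : 3 * ((1 / (1 + (k : ℝ) ^ 2)) * (1 / (1 + (l : ℝ) ^ 2)))
        = 3 / ((1 + (k : ℝ) ^ 2) * (1 + (l : ℝ) ^ 2)) := by field_simp
      rw [e, div_le_div_iff₀ (by positivity) (by positivity)]
      nlinarith [sq_nonneg ((k : ℝ) ^ 2 - (l : ℝ) ^ 2)]
  have h2 : ∑ k ∈ Finset.range n, 1 / (1 + (k : ℝ) ^ 2) ≤ 3 := by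
    cases n with
    | zero => simp
    | succ m =>
      rw [Finset.sum_range_succ']
      have : ∑ k ∈ Finset.range m, 1 / (1 + ((k + 1 : ℕ) : ℝ) ^ 2) ≤ ∑ k ∈ Finset.range m, 1 / ((k : ℝ) + 1) ^ 2 := by
        refine Finset.sum_le_sum fun k _ => ?_
        push_cast
        apply one_div_le_one_div_of_le (by positivity); linarith
      have := sum_inv_sq m
      norm_num at *
      linarith
  have h0 : 0 ≤ ∑ k ∈ Finset.range n, 1 / (1 + (k : ℝ) ^ 2) := Finset.sum_nonneg fun _ _ => by positivity
  calc _ ≤ ∑ k ∈ Finset.range n, ∑ l ∈ Finset.range n, 3 * ((1 / (1 + (k : ℝ) ^ 2)) * (1 / (1 + (l : ℝ) ^ 2))) :=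
        Finset.sum_le_sum fun k _ => Finset.sum_le_sum fun l _ => h1 k l
    _ = 3 * ((∑ k ∈ Finset.range n, 1 / (1 + (k : ℝ) ^ 2)) * (∑ k ∈ Finset.range n, 1 / (1 + (k : ℝ) ^ 2))) := by
        rw [Finset.sum_mul_sum, Finset.mul_sum]
        exact Finset.sum_congr rfl fun k _ => by rw [Finset.mul_sum]
    _ ≤ 27 := by nlinarith

lemma lam_jordan (L k : ℕ) (hk : k < L) : 4 / (L : ℝ) ^ 2 * (k : ℝ) ^ 2 ≤ lam L k := by
  have hL : (0 : ℝ) < L := by exact_mod_cast (by omega : 0 < L)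
  have hkL : (k : ℝ) ≤ L := by exact_mod_cast hk.le
  have h := Real.mul_le_sin (x := Real.pi * k / (2 * L)) (by positivity) (by
    rw [div_le_div_iff₀ (by positivity) (by positivity)]
    nlinarith [Real.pi_pos])
  have e : 2 / Real.pi * (Real.pi * k / (2 * L)) = k / L := by field_simp
  rw [e] at h
  unfold lam
  have := pow_le_pow_left₀ (by positivity) h 2
  rw [div_pow] at this
  calc _ = 4 * ((k : ℝ) ^ 2 / L ^ 2) := by ring
    _ ≤ _ := by linarith

lemma lam_sharp (L n k : ℕ) (hk : k < n) (hn : n ≤ L) :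
    Real.pi ^ 2 / (L : ℝ) ^ 2 * (1 - 2 * (n : ℝ) ^ 2 / L ^ 2) * (k : ℝ) ^ 2 ≤ lam L k := by
  have hL : (0 : ℝ) < L := by exact_mod_cast (by omega : 0 < L)
  have hkn : (k : ℝ) ≤ n := by exact_mod_cast hk.le
  have hnL : (n : ℝ) ≤ L := by exact_mod_cast hn
  have hpi := Real.pi_pos
  rcases Nat.eq_zero_or_pos k with h0 | h0
  · subst h0; simp [lam]
  have hk0 : (0 : ℝ) < k := by exact_mod_cast h0
  set x := Real.pi * k / (2 * L) with hx
  have hx0 : 0 < x := by positivity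
  have hx1 : x ≤ 2 * n / L := by
    rw [hx, div_le_div_iff₀ (by positivity) (by positivity)]
    have : Real.pi * k ≤ 4 * n := by nlinarith [Real.pi_le_four]
    nlinarith
  have hxs : x ^ 2 ≤ 4 * (n : ℝ) ^ 2 / L ^ 2 := by
    calc x ^ 2 ≤ (2 * n / L) ^ 2 := pow_le_pow_left₀ hx0.le hx1 2
      _ = _ := by ring
  have hmain : x ^ 2 * (1 - x ^ 2 / 2) ≤ Real.sin x ^ 2 := by
    have hle : x ≤ 2 := by
      rw [hx, div_le_iff₀ (by positivity)]
      nlinarith [Real.pi_le_four]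
    have h := (Real.sin_gt_sub_cube hx0).le
    have hx4 : x ^ 2 ≤ 4 := by nlinarith
    have h0 : 0 ≤ x - x ^ 3 / 6 := by
      have : x - x ^ 3 / 6 = x * (1 - x ^ 2 / 6) := by ring
      rw [this]
      exact mul_nonneg hx0.le (by linarith)
    have := pow_le_pow_left₀ h0 h 2
    nlinarith [sq_nonneg (x ^ 3), sq_nonneg (x ^ 2)]
  unfold lam
  calc _ = 4 * (x ^ 2 * (1 - 2 * (n : ℝ) ^ 2 / L ^ 2)) := by rw [hx]; ring
    _ ≤ 4 * (x ^ 2 * (1 - x ^ 2 / 2)) := by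
        have : 1 - 2 * (n : ℝ) ^ 2 / L ^ 2 ≤ 1 - x ^ 2 / 2 := by
          have : 2 * (n : ℝ) ^ 2 / L ^ 2 = (4 * (n : ℝ) ^ 2 / L ^ 2) / 2 := by ring
          linarith
        gcongr
    _ ≤ _ := by linarith



def S2 (n : ℕ) : Finset (ℕ × ℕ) := Finset.range n ×ˢ Finset.range n
def e2 (L : ℕ) (k : ℕ × ℕ) (x : Fin L × Fin L) : ℝ := eh L k.1 x.1 * eh L k.2 x.2
def b2 (n : ℕ) (k : ℕ × ℕ) : ℝ := bk n k.1 * bk n k.2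
def l2 (L : ℕ) (k : ℕ × ℕ) : ℝ := lam L k.1 + lam L k.2
def z2 (L : ℕ) (x : Fin L × Fin L) : E2 := !₂[zg L x.1, zg L x.2]
def K2 (L n : ℕ) (x y : Fin L × Fin L) : ℝ := K1 L n (cs n) x.1 y.1 * K1 L n (cs n) x.2 y.2
def G2 (L n : ℕ) (x y : Fin L × Fin L) : ℝ :=
  ∑ k ∈ S2 n, b2 n k / l2 L k * (e2 L k x * e2 L k y)
def F2 (L : ℕ) (d : Bool) (x : Fin L × Fin L) : Fin L × Fin L :=
  if d then (up x.1, x.2) else (x.1, up x.2)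
def B2 (L : ℕ) (d : Bool) (x : Fin L × Fin L) : Fin L × Fin L :=
  if d then (dn x.1, x.2) else (x.1, dn x.2)

lemma e2_orth (L n : ℕ) (hn : n ≤ L) (k l : ℕ × ℕ) (hk : k ∈ S2 n) (hl : l ∈ S2 n) :
    ∑ x, e2 L k x * e2 L l x = if k = l then 1 else 0 := by
  simp only [S2, Finset.mem_product, Finset.mem_range] at hk hl
  rw [Fintype.sum_prod_type]
  have h1 := eh_orth L k.1 l.1 (by omega) (by omega)
  have h2 := eh_orth L k.2 l.2 (by omega) (by omega)
  calc _ = (∑ x, eh L k.1 x * eh L l.1 x) * ∑ x, eh L k.2 x * eh L l.2 x := by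
        rw [Finset.sum_mul_sum]
        refine Finset.sum_congr rfl fun x _ => Finset.sum_congr rfl fun y _ => ?_
        unfold e2; ring
    _ = _ := by
        rw [h1, h2]
        by_cases h : k = l
        · subst h; simp
        · rw [if_neg h]
          have : ¬ (k.1 = l.1 ∧ k.2 = l.2) := fun h' => h (Prod.ext h'.1 h'.2)
          by_cases h3 : k.1 = l.1
          · rw [if_neg (fun h4 => this ⟨h3, h4⟩), mul_zero]
          · rw [if_neg h3, zero_mul]

lemma K2_spec (L n : ℕ) (hL : 0 < L) (x y : Fin L × Fin L) :
    K2 L n x y = ∑ k ∈ S2 n, b2 n k * (e2 L k x * e2 L k y) := by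
  unfold K2 S2
  rw [K1_spec L n hL, K1_spec L n hL, Finset.sum_mul_sum, Finset.sum_product]
  refine Finset.sum_congr rfl fun k _ => Finset.sum_congr rfl fun l _ => ?_
  unfold b2 e2; ring

lemma bilin (L n : ℕ) (hn : n ≤ L) (α β : ℕ × ℕ → ℝ) :
    ∑ x, ∑ y, (∑ k ∈ S2 n, α k * (e2 L k x * e2 L k y)) * (∑ k ∈ S2 n, β k * (e2 L k x * e2 L k y))
      = ∑ k ∈ S2 n, α k * β k := by
  calc _ = ∑ k ∈ S2 n, ∑ l ∈ S2 n, α k * β l *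
        ((∑ x, e2 L k x * e2 L l x) * (∑ y, e2 L k y * e2 L l y)) := by
        have : ∀ x y, (∑ k ∈ S2 n, α k * (e2 L k x * e2 L k y)) * (∑ k ∈ S2 n, β k * (e2 L k x * e2 L k y))
          = ∑ k ∈ S2 n, ∑ l ∈ S2 n, α k * (e2 L k x * e2 L k y) * (β l * (e2 L l x * e2 L l y)) :=
          fun x y => Finset.sum_mul_sum _ _ _ _
        simp only [this]
        have : ∀ x, ∑ y, ∑ k ∈ S2 n, ∑ l ∈ S2 n,
          α k * (e2 L k x * e2 L k y) * (β l * (e2 L l x * e2 L l y)) =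
          ∑ k ∈ S2 n, ∑ l ∈ S2 n, ∑ y, α k * (e2 L k x * e2 L k y) * (β l * (e2 L l x * e2 L l y)) := by
          intro x
          rw [Finset.sum_comm]
          exact Finset.sum_congr rfl fun k _ => Finset.sum_comm
        simp only [this]
        rw [Finset.sum_comm]
        refine Finset.sum_congr rfl fun k _ => ?_
        rw [Finset.sum_comm]
        refine Finset.sum_congr rfl fun l _ => ?_
        rw [Finset.sum_mul_sum, Finset.mul_sum]
        refine Finset.sum_congr rfl fun x _ => ?_
        rw [Finset.mul_sum]
        exact Finset.sum_congr rfl fun y _ => by ring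
    _ = ∑ k ∈ S2 n, ∑ l ∈ S2 n, if k = l then α k * β k else 0 := by
        refine Finset.sum_congr rfl fun k hk => Finset.sum_congr rfl fun l hl => ?_
        rw [e2_orth L n hn k l hk hl]
        split_ifs with h
        · subst h; ring
        · ring
    _ = _ := by
        refine Finset.sum_congr rfl fun k hk => ?_
        rw [Finset.sum_ite_eq, if_pos hk]

lemma e2_lap (L : ℕ) (k : ℕ × ℕ) (x : Fin L × Fin L) :
    ∑ d, ((e2 L k x - e2 L k (F2 L d x)) + (e2 L k x - e2 L k (B2 L d x))) = l2 L k * e2 L k x := by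
  have h1 := eh_lap L k.1 x.1
  have h2 := eh_lap L k.2 x.2
  rw [Fintype.sum_bool]
  unfold e2 F2 B2 l2
  simp only [if_true, Bool.false_eq_true, if_false]
  linear_combination eh L k.2 x.2 * h1 + eh L k.1 x.1 * h2

lemma l2_pos (L n : ℕ) (hn : n ≤ L) (k : ℕ × ℕ) (hk : k ∈ S2 n) (h0 : k ≠ 0) : 0 < l2 L k := by
  simp only [S2, Finset.mem_product, Finset.mem_range] at hk
  have hL : (0 : ℝ) < L := by exact_mod_cast (by omega : 0 < L)
  have h1 := lam_jordan L k.1 (by omega)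
  have h2 := lam_jordan L k.2 (by omega)
  unfold l2
  have h1' : 0 ≤ 4 / (L : ℝ) ^ 2 * (k.1 : ℝ) ^ 2 := by positivity
  have h2' : 0 ≤ 4 / (L : ℝ) ^ 2 * (k.2 : ℝ) ^ 2 := by positivity
  by_cases h : k.1 = 0
  · have h3 : 0 < k.2 := by
      rcases Nat.eq_zero_or_pos k.2 with h4 | h4
      · exact absurd (Prod.ext h h4) h0
      · exact h4
    have : (0 : ℝ) < 4 / (L : ℝ) ^ 2 * (k.2 : ℝ) ^ 2 := by positivity
    linarith
  · have h3 : 0 < k.1 := Nat.pos_of_ne_zero h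
    have : (0 : ℝ) < 4 / (L : ℝ) ^ 2 * (k.1 : ℝ) ^ 2 := by positivity
    linarith

lemma G2_lap (L n : ℕ) (hn2 : 2 ≤ n) (hn : n ≤ L) (x y : Fin L × Fin L) :
    ∑ d, ((G2 L n x y - G2 L n (F2 L d x) y) + (G2 L n x y - G2 L n (B2 L d x) y))
      = K2 L n x y - 1 / (L : ℝ) ^ 2 := by
  have hL : (0 : ℝ) < L := by exact_mod_cast (by omega : 0 < L)
  rw [K2_spec L n (by omega)]
  unfold G2
  simp only [← Finset.sum_sub_distrib, ← Finset.sum_add_distrib]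
  rw [Finset.sum_comm]
  have hmem : (0 : ℕ × ℕ) ∈ S2 n := by
    simp [S2]; omega
  have h1 : ∀ k ∈ S2 n, ∑ d, ((b2 n k / l2 L k * (e2 L k x * e2 L k y) - b2 n k / l2 L k * (e2 L k (F2 L d x) * e2 L k y))
      + (b2 n k / l2 L k * (e2 L k x * e2 L k y) - b2 n k / l2 L k * (e2 L k (B2 L d x) * e2 L k y)))
      = b2 n k * (e2 L k x * e2 L k y) - if k = 0 then 1 / (L : ℝ) ^ 2 else 0 := by
    intro k hk
    have h := e2_lap L k x
    have : ∑ d, ((b2 n k / l2 L k * (e2 L k x * e2 L k y) - b2 n k / l2 L k * (e2 L k (F2 L d x) * e2 L k y))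
      + (b2 n k / l2 L k * (e2 L k x * e2 L k y) - b2 n k / l2 L k * (e2 L k (B2 L d x) * e2 L k y)))
      = b2 n k / l2 L k * e2 L k y * ∑ d, ((e2 L k x - e2 L k (F2 L d x)) + (e2 L k x - e2 L k (B2 L d x))) := by
      rw [Finset.mul_sum]; exact Finset.sum_congr rfl fun d _ => by ring
    rw [this, h]
    by_cases h0 : k = 0
    · subst h0
      rw [if_pos rfl]
      have hz : l2 L 0 = 0 := by simp [l2, lam]
      have hs := Real.mul_self_sqrt (show (0 : ℝ) ≤ (L : ℝ)⁻¹ by positivity)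
      have he : ∀ x, e2 L 0 x = (L : ℝ)⁻¹ := by
        intro x
        simp only [e2, eh, nrm, Prod.fst_zero, Prod.snd_zero]
        simpa using hs
      rw [hz, he, he, b2]
      simp only [Prod.fst_zero, Prod.snd_zero, bk_zero n hn2]
      simp; ring
    · rw [if_neg h0]
      have := (l2_pos L n hn k hk h0).ne'
      field_simp; ring
  rw [Finset.sum_congr rfl h1, Finset.sum_sub_distrib, Finset.sum_ite_eq', if_pos hmem]

lemma b2_sq (L n : ℕ) (hn2 : 2 ≤ n) (hn : n ≤ L) (k : ℕ × ℕ) (hk : k ∈ S2 n) : b2 n k ^ 2 ≤ 1 := by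
  simp only [S2, Finset.mem_product, Finset.mem_range] at hk
  unfold b2
  rw [mul_pow]
  exact mul_le_one₀ (bk_abs L n _ hn2 hn hk.1) (sq_nonneg _) (bk_abs L n _ hn2 hn hk.2)

lemma KG2 (L n : ℕ) (hn2 : 2 ≤ n) (hn : n ≤ L) (hθ : 0 < 1 - 2 * (n : ℝ) ^ 2 / L ^ 2) :
    ∑ x, ∑ y, K2 L n x y * G2 L n x y ≤ (L : ℝ) ^ 2 *
      (1 / (Real.pi ^ 2 * (1 - 2 * (n : ℝ) ^ 2 / L ^ 2)) * (Real.pi / 2 * Real.log n + 6)) := by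
  have hL : (0 : ℝ) < L := by exact_mod_cast (by omega : 0 < L)
  simp only [K2_spec L n (by omega : 0 < L)]
  unfold G2
  rw [bilin L n hn]
  set θ := 1 - 2 * (n : ℝ) ^ 2 / L ^ 2
  have hpi := Real.pi_pos
  have h1 : ∀ k ∈ S2 n, b2 n k * (b2 n k / l2 L k) ≤
      (L : ℝ) ^ 2 * (1 / (Real.pi ^ 2 * θ)) * (1 / ((k.1 : ℝ) ^ 2 + (k.2 : ℝ) ^ 2)) := by
    intro k hk
    by_cases h0 : k = 0
    · subst h0
      have hz : l2 L 0 = 0 := by simp [l2, lam]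
      rw [hz]; simp
    · have hl := l2_pos L n hn k hk h0
      have hb := b2_sq L n hn2 hn k hk
      have hk' := hk
      simp only [S2, Finset.mem_product, Finset.mem_range] at hk'
      have g1 := lam_sharp L n k.1 hk'.1 hn
      have g2 := lam_sharp L n k.2 hk'.2 hn
      have hs : (0 : ℝ) < (k.1 : ℝ) ^ 2 + (k.2 : ℝ) ^ 2 := by
        by_cases h : k.1 = 0
        · have h3 : 0 < k.2 := by
            rcases Nat.eq_zero_or_pos k.2 with h4 | h4
            · exact absurd (Prod.ext h h4) h0
            · exact h4
          positivity
        · have h3 : 0 < k.1 := Nat.pos_of_ne_zero h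
          positivity
      have g3 : Real.pi ^ 2 / (L : ℝ) ^ 2 * θ * ((k.1 : ℝ) ^ 2 + (k.2 : ℝ) ^ 2) ≤ l2 L k := by
        unfold l2; linarith
      calc b2 n k * (b2 n k / l2 L k) = b2 n k ^ 2 / l2 L k := by ring
        _ ≤ 1 / (Real.pi ^ 2 / (L : ℝ) ^ 2 * θ * ((k.1 : ℝ) ^ 2 + (k.2 : ℝ) ^ 2)) := by
            apply div_le_div₀ zero_le_one hb (by positivity) g3
        _ = _ := by field_simp
  refine (Finset.sum_le_sum h1).trans ?_
  rw [← Finset.mul_sum]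
  have hg := gsum n hn2
  unfold S2
  rw [Finset.sum_product]
  rw [mul_assoc]
  gcongr

lemma GG2 (L n : ℕ) (hn2 : 2 ≤ n) (hn : n ≤ L) :
    ∑ x, ∑ y, G2 L n x y ^ 2 ≤ 2 * (L : ℝ) ^ 4 := by
  have hL : (0 : ℝ) < L := by exact_mod_cast (by omega : 0 < L)
  simp only [sq (G2 L n _ _)]
  unfold G2
  rw [bilin L n hn]
  have h1 : ∀ k ∈ S2 n, (b2 n k / l2 L k) * (b2 n k / l2 L k) ≤
      (L : ℝ) ^ 4 / 16 * (1 / ((k.1 : ℝ) ^ 2 + (k.2 : ℝ) ^ 2) ^ 2) := by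
    intro k hk
    by_cases h0 : k = 0
    · subst h0
      have hz : l2 L 0 = 0 := by simp [l2, lam]
      rw [hz]; simp
    · have hl := l2_pos L n hn k hk h0
      have hb := b2_sq L n hn2 hn k hk
      have hk' := hk
      simp only [S2, Finset.mem_product, Finset.mem_range] at hk'
      have g1 := lam_jordan L k.1 (by omega)
      have g2 := lam_jordan L k.2 (by omega)
      have hs : (0 : ℝ) < (k.1 : ℝ) ^ 2 + (k.2 : ℝ) ^ 2 := by
        by_cases h : k.1 = 0
        · have h3 : 0 < k.2 := by
            rcases Nat.eq_zero_or_pos k.2 with h4 | h4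
            · exact absurd (Prod.ext h h4) h0
            · exact h4
          positivity
        · have h3 : 0 < k.1 := Nat.pos_of_ne_zero h
          positivity
      have g3 : 4 / (L : ℝ) ^ 2 * ((k.1 : ℝ) ^ 2 + (k.2 : ℝ) ^ 2) ≤ l2 L k := by
        unfold l2; linarith
      have g4 := pow_le_pow_left₀ (by positivity) g3 2
      calc (b2 n k / l2 L k) * (b2 n k / l2 L k) = b2 n k ^ 2 / l2 L k ^ 2 := by ring
        _ ≤ 1 / (4 / (L : ℝ) ^ 2 * ((k.1 : ℝ) ^ 2 + (k.2 : ℝ) ^ 2)) ^ 2 := by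
            apply div_le_div₀ zero_le_one hb (by positivity) g4
        _ = _ := by field_simp; norm_num
  refine (Finset.sum_le_sum h1).trans ?_
  rw [← Finset.mul_sum]
  have hg := gsum2 n
  unfold S2
  rw [Finset.sum_product]
  calc _ ≤ (L : ℝ) ^ 4 / 16 * 27 := by gcongr
    _ ≤ _ := by nlinarith [pow_pos hL 4]

lemma norm_z2 (v w : ℝ) : ‖(!₂[v, w] : E2)‖ ^ 2 = v ^ 2 + w ^ 2 := by
  rw [EuclideanSpace.norm_sq_eq]; simp

lemma z2_sub (L : ℕ) (x y : Fin L × Fin L) :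
    z2 L x - z2 L y = !₂[zg L x.1 - zg L y.1, zg L x.2 - zg L y.2] := by
  ext i; fin_cases i <;> simp [z2]

def mkGrid (L n : ℕ) (hn2 : 2 ≤ n) (hn : n ≤ L) (hθ : 0 < 1 - 2 * (n : ℝ) ^ 2 / L ^ 2) :
    Grid (Fin L × Fin L) L n
      (1 / (Real.pi ^ 2 * (1 - 2 * (n : ℝ) ^ 2 / L ^ 2)) * (Real.pi / 2 * Real.log n + 6)) where
  z := z2 L
  K := K2 L n
  G := G2 L n
  F := F2 L
  B := B2 L
  hcard := by simp; ring
  K_nonneg x y := mul_nonneg (K1_nonneg _ _ _ _ _) (K1_nonneg _ _ _ _ _)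
  K_symm x y := by unfold K2; rw [K1_symm, K1_symm L n (cs n) x.2]
  K_row x := by
    have hs : ∀ y, ∑ x, K1 L n (cs n) y x = 1 := fun y => by
      rw [← cs_sum n hn2, ← K1_sum L n _ (by omega) (by omega) y]
      exact Finset.sum_congr rfl fun _ _ => K1_symm _ _ _ _ _
    unfold K2
    rw [Fintype.sum_prod_type]
    simp only [← Finset.mul_sum, ← Finset.sum_mul, hs, mul_one]
  K_le x y := by
    unfold K2
    have h1 := K1_le L n (cs n) (by omega) (cs_sum n hn2) x.1 y.1
    have h2 := K1_le L n (cs n) (by omega) (cs_sum n hn2) x.2 y.2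
    calc _ ≤ (n : ℝ) / L * (n / L) := mul_le_mul h1 h2 (K1_nonneg _ _ _ _ _) (by positivity)
      _ = _ := by ring
  K_mom x := by
    have hs : ∀ y, ∑ x, K1 L n (cs n) y x = 1 := fun y => by
      rw [← cs_sum n hn2, ← K1_sum L n _ (by omega) (by omega) y]
      exact Finset.sum_congr rfl fun _ _ => K1_symm _ _ _ _ _
    have hm : ∀ y, ∑ x, K1 L n (cs n) y x * (zg L y - zg L x) ^ 2 ≤ 5 / (n : ℝ) ^ 2 := fun y => by
      refine le_trans (le_of_eq ?_) (K1_moment L n hn2 hn y)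
      exact Finset.sum_congr rfl fun _ _ => by rw [K1_symm]; ring
    unfold K2
    rw [Fintype.sum_prod_type]
    simp only [z2_sub, norm_z2]
    calc _ = (∑ y, K1 L n (cs n) x.1 y * (zg L x.1 - zg L y) ^ 2) * (∑ y, K1 L n (cs n) x.2 y)
          + (∑ y, K1 L n (cs n) x.1 y) * (∑ y, K1 L n (cs n) x.2 y * (zg L x.2 - zg L y) ^ 2) := by
          rw [Finset.sum_mul_sum, Finset.sum_mul_sum, ← Finset.sum_add_distrib]
          refine Finset.sum_congr rfl fun a _ => ?_
          rw [← Finset.sum_add_distrib]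
          exact Finset.sum_congr rfl fun b _ => by ring
      _ ≤ 5 / (n : ℝ) ^ 2 + 5 / (n : ℝ) ^ 2 := by
          rw [hs, hs, mul_one, one_mul]; exact add_le_add (hm _) (hm _)
      _ = _ := by ring
  lap := G2_lap L n hn2 hn
  adj d h h0 := by
    cases d
    · rw [Fintype.sum_prod_type, Fintype.sum_prod_type]
      refine Finset.sum_congr rfl fun a _ => ?_
      exact adj1 (fun s t => h (a, s) (a, t)) (fun s => h0 _)
    · rw [Fintype.sum_prod_type_right, Fintype.sum_prod_type_right]
      refine Finset.sum_congr rfl fun a _ => ?_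
      exact adj1 (fun s t => h (s, a) (t, a)) (fun s => h0 _)
  dist_F d x := by
    have hL : (0 : ℝ) < L := by exact_mod_cast (by omega : 0 < L)
    apply abs_le_of_sq_le_sq' _ (by positivity) |>.2
    cases d
    · obtain ⟨t, h0, h1, h2⟩ := zg_up x.2
      rw [z2_sub, norm_z2]; simp only [F2, Bool.false_eq_true, if_false, h2]
      rw [div_pow, div_pow, one_pow, sub_self, zero_pow two_ne_zero, zero_add]
      gcongr; nlinarith
    · obtain ⟨t, h0, h1, h2⟩ := zg_up x.1
      rw [z2_sub, norm_z2]; simp only [F2, if_true, h2]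
      rw [div_pow, div_pow, one_pow, sub_self, zero_pow two_ne_zero, add_zero]
      gcongr; nlinarith
  dist_B d x := by
    have hL : (0 : ℝ) < L := by exact_mod_cast (by omega : 0 < L)
    apply abs_le_of_sq_le_sq' _ (by positivity) |>.2
    cases d
    · obtain ⟨t, h0, h1, h2⟩ := zg_dn x.2
      rw [z2_sub, norm_z2]; simp only [B2, Bool.false_eq_true, if_false, h2]
      rw [div_pow, div_pow, one_pow, sub_self, zero_pow two_ne_zero, zero_add]
      gcongr; nlinarith
    · obtain ⟨t, h0, h1, h2⟩ := zg_dn x.1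
      rw [z2_sub, norm_z2]; simp only [B2, if_true, h2]
      rw [div_pow, div_pow, one_pow, sub_self, zero_pow two_ne_zero, add_zero]
      gcongr; nlinarith
  vec x Ψ Ψ' hΨ hΨ' := by
    have hL : (0 : ℝ) < L := by exact_mod_cast (by omega : 0 < L)
    obtain ⟨t, t0, t1, t2⟩ := zg_up x.1
    obtain ⟨s, s0, s1, s2⟩ := zg_dn x.1
    obtain ⟨t', t0', t1', t2'⟩ := zg_up x.2
    obtain ⟨s', s0', s1', s2'⟩ := zg_dn x.2
    have e : ∑ d, (Ψ d • (z2 L (F2 L d x) - z2 L x) + Ψ' d • (z2 L (B2 L d x) - z2 L x))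
      = !₂[(t * Ψ true - s * Ψ' true) / L, (t' * Ψ false - s' * Ψ' false) / L] := by
      rw [Fintype.sum_bool]
      simp only [z2_sub, F2, B2, if_true, Bool.false_eq_true, if_false, sub_self, t2, s2, t2', s2']
      ext i; fin_cases i
      · simp; ring
      · simp; ring
    rw [e, norm_z2, Fintype.sum_bool, div_pow, div_pow, ← add_div]
    have key : ∀ a b t s : ℝ, 0 ≤ a → 0 ≤ b → 0 ≤ t → t ≤ 1 → 0 ≤ s → s ≤ 1 →
        (t * a - s * b) ^ 2 ≤ a ^ 2 + b ^ 2 := by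
      intro a b t s ha hb ht ht1 hs hs1
      have h1 : 0 ≤ t * a * (s * b) := by positivity
      have h2 : (t * a) ^ 2 ≤ a ^ 2 := by
        apply pow_le_pow_left₀ (by positivity); nlinarith
      have h3 : (s * b) ^ 2 ≤ b ^ 2 := by
        apply pow_le_pow_left₀ (by positivity); nlinarith
      nlinarith
    refine div_le_div_of_nonneg_right ?_ (by positivity)
    exact add_le_add (key _ _ _ _ (hΨ _) (hΨ' _) t0 t1 s0 s1) (key _ _ _ _ (hΨ _) (hΨ' _) t0' t1' s0' s1')
  KG := KG2 L n hn2 hn hθ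
  GG := GG2 L n hn2 hn


section
variable {V : Type} [Fintype V] [DecidableEq V] {L n H : ℝ}

/-- squared positive increments -/
def Grid.gp (g : Grid V L n H) (φ : V → ℝ) (x : V) : ℝ :=
  ∑ d, (max (φ (g.F d x) - φ x) 0 ^ 2 + max (φ (g.B d x) - φ x) 0 ^ 2)

lemma Grid.gp_nonneg (g : Grid V L n H) (φ : V → ℝ) (x : V) : 0 ≤ g.gp φ x :=
  Finset.sum_nonneg fun _ _ => by positivity

lemma Grid.flow (g : Grid V L n H) (hL : 0 < L) {u q φ : V → ℝ} (hu : ∀ x, 0 ≤ u x)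
    (hq : ∀ x, 0 < q x) {η Bd : ℝ} (hη : 0 < η) (hη1 : η ≤ 1)
    (hlap : ∀ x, ∑ d, ((φ x - φ (g.F d x)) + (φ x - φ (g.B d x))) = u x - q x) (hBd : 0 ≤ Bd)
    (hB : ∀ s ∈ Set.Icc (0 : ℝ) 1, ∑ x, g.gp φ x / L ^ 2 / (q x + s * ((1 - η) * (u x - q x))) ≤ Bd ^ 2) :
    Cpl g.z q (fun x => (1 - η) * u x + η * q x)
      ((Bd + √((1 / (2 * L)) * ∑ x, g.gp φ x + 2 / L)) ^ 2) := by
  set w : V → V → ℝ := fun s t => (1 - η) * max (φ s - φ t) 0 with hw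
  have h1η : 0 ≤ 1 - η := by linarith
  have hw0 : ∀ s t, 0 ≤ w s t := fun s t => mul_nonneg h1η (le_max_right _ _)
  have hwd : ∀ s, w s s = 0 := fun s => by simp [hw]
  set Φ : V → V → ℝ := fun x y => ∑ d, ((if y = g.F d x then w y x else 0)
    + (if y = g.B d x then w y x else 0)) with hΦdef
  have hΦ : ∀ x y, 0 ≤ Φ x y := fun x y => Finset.sum_nonneg fun d _ => by
    have := hw0 y x
    split_ifs <;> positivity
  have hout : ∀ {M : Type} [AddCommGroup M] [Module ℝ M] (F : V → M) (x : V), ∑ y, Φ x y • F y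
      = ∑ d, (w (g.F d x) x • F (g.F d x) + w (g.B d x) x • F (g.B d x)) := by
    intro M _ _ F x
    simp only [hΦdef, Finset.sum_smul, add_smul, ite_smul, zero_smul]
    rw [Finset.sum_comm]
    refine Finset.sum_congr rfl fun d _ => ?_
    rw [Finset.sum_add_distrib]
    simp
  have hout1 : ∀ (F : V → ℝ) (x : V), ∑ y, Φ x y * F y
      = ∑ d, (w (g.F d x) x * F (g.F d x) + w (g.B d x) x * F (g.B d x)) := fun F x => hout F x
  have hin : ∀ x, ∑ y, Φ y x = ∑ d, (w x (g.B d x) + w x (g.F d x)) := by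
    intro x
    simp only [hΦdef]
    rw [Finset.sum_comm]
    refine Finset.sum_congr rfl fun d _ => ?_
    rw [Finset.sum_add_distrib]
    have h1 := g.adj d (fun s t => if x = s then w x t else 0) (fun s => by
      by_cases h : x = s
      · rw [if_pos h, h, hwd]
      · rw [if_neg h])
    have h2 := g.adj d (fun s t => if x = t then w x s else 0) (fun s => by
      by_cases h : x = s
      · rw [if_pos h, h, hwd]
      · rw [if_neg h])
    rw [← h1, h2]
    simp
  have hbal : ∀ x, ((1 - η) * u x + η * q x) - q x = ∑ y, Φ y x - ∑ y, Φ x y := by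
    intro x
    have h1 := hout1 (fun _ => 1) x
    simp only [mul_one] at h1
    rw [hin, h1, ← Finset.sum_sub_distrib]
    have h2 : ((1 - η) * u x + η * q x) - q x = (1 - η) * (u x - q x) := by ring
    rw [h2, ← hlap, Finset.mul_sum]
    refine Finset.sum_congr rfl fun d _ => ?_
    have hm : ∀ s t, w s t - w t s = (1 - η) * (φ s - φ t) := by
      intro s t
      simp only [hw]
      rcases le_total (φ s) (φ t) with h | h
      · rw [max_eq_right (by linarith), max_eq_left (by linarith)]; ring
      · rw [max_eq_left (by linarith), max_eq_right (by linarith)]; ring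
    have a1 := hm x (g.F d x)
    have a2 := hm x (g.B d x)
    linarith
  have hw2 : ∀ s t, w s t ^ 2 ≤ max (φ s - φ t) 0 ^ 2 := by
    intro s t
    apply pow_le_pow_left₀ (hw0 s t)
    have := le_max_right (φ s - φ t) 0
    simp only [hw]; nlinarith
  have hBm : ∀ s ∈ Set.Icc (0 : ℝ) 1,
      ∑ x, ‖∑ y, Φ x y • (g.z y - g.z x)‖ ^ 2 /
        (q x + s * (((1 - η) * u x + η * q x) - q x)) ≤ Bd ^ 2 := by
    intro s hs
    refine le_trans (Finset.sum_le_sum fun x _ => ?_) (hB s hs)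
    have e : q x + s * (((1 - η) * u x + η * q x) - q x) = q x + s * ((1 - η) * (u x - q x)) := by ring
    rw [e]
    have hpos : 0 < q x + s * ((1 - η) * (u x - q x)) := by
      have h1 := hq x
      have h2 := hu x
      have : q x + s * ((1 - η) * (u x - q x)) = (1 - s * (1 - η)) * q x + s * (1 - η) * u x := by ring
      rw [this]
      have h3 : 0 < 1 - s * (1 - η) := by nlinarith [hs.1, hs.2]
      have h4 : 0 ≤ s * (1 - η) := mul_nonneg hs.1 h1η
      positivity
    refine div_le_div_of_nonneg_right ?_ hpos.le
    rw [hout (fun y => g.z y - g.z x)]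
    refine (g.vec x (fun d => w (g.F d x) x) (fun d => w (g.B d x) x) (fun d => hw0 _ _) (fun d => hw0 _ _)).trans ?_
    refine div_le_div_of_nonneg_right ?_ (by positivity)
    exact Finset.sum_le_sum fun d _ => add_le_add (hw2 _ _) (hw2 _ _)
  have hflow := Cpl.flow hΦ hq (m₁ := fun x => (1 - η) * u x + η * q x) (fun x => by
    have := hq x; have := hu x; positivity) hBd hbal hBm
  refine hflow.mono ?_
  have hσ : ∑ x, ∑ y, Φ x y * ‖g.z y - g.z x‖ ^ 2 ≤ (1 / (2 * L)) * ∑ x, g.gp φ x + 2 / L := by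
    have hone : ∀ x, ∑ y, Φ x y * ‖g.z y - g.z x‖ ^ 2 ≤ (1 / (2 * L)) * g.gp φ x + 2 / L ^ 3 := by
      intro x
      rw [hout1 (fun y => ‖g.z y - g.z x‖ ^ 2)]
      have hb : ∀ y, ‖g.z y - g.z x‖ ≤ 1 / L → w y x * ‖g.z y - g.z x‖ ^ 2 ≤
          (1 / (2 * L)) * max (φ y - φ x) 0 ^ 2 + 1 / (2 * L ^ 3) := by
        intro y hy
        have h2 : ‖g.z y - g.z x‖ ^ 2 ≤ (1 / L) ^ 2 := pow_le_pow_left₀ (norm_nonneg _) hy 2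
        have h0 := le_max_right (φ y - φ x) 0
        set t := max (φ y - φ x) 0
        have hwt : w y x ≤ t := by simp only [hw]; nlinarith
        calc w y x * ‖g.z y - g.z x‖ ^ 2 ≤ t * (1 / L) ^ 2 :=
              mul_le_mul hwt h2 (by positivity) h0
          _ ≤ _ := by
            have : (1 / (2 * L)) * t ^ 2 + 1 / (2 * L ^ 3) - t * (1 / L) ^ 2 = (1 / (2 * L)) * (t - 1 / L) ^ 2 := by
              field_simp; ring
            have : 0 ≤ (1 / (2 * L)) * (t - 1 / L) ^ 2 := by positivity
            linarith
      have := Finset.sum_le_sum fun d (_ : d ∈ (Finset.univ : Finset Bool)) =>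
        add_le_add (hb _ (g.dist_F d x)) (hb _ (g.dist_B d x))
      refine this.trans (le_of_eq ?_)
      unfold Grid.gp
      rw [Finset.mul_sum, Fintype.sum_bool, Fintype.sum_bool]
      field_simp; ring
    refine (Finset.sum_le_sum fun x _ => hone x).trans (le_of_eq ?_)
    rw [Finset.sum_add_distrib, ← Finset.mul_sum, Finset.sum_const, nsmul_eq_mul, Finset.card_univ, g.hcard]
    field_simp
  have := Real.sqrt_le_sqrt hσ
  have h0 := Real.sqrt_nonneg (∑ x, ∑ y, Φ x y * ‖g.z y - g.z x‖ ^ 2)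
  gcongr

/-- elementary bound on the reciprocal of the interpolated density -/
lemma inv_interp {q u t η δ : ℝ} (hq : 0 < q) (hu : 0 ≤ u) (hη : 0 < η) (ht : 0 ≤ t) (ht1 : t ≤ 1 - η)
    (hδ : 0 < δ) :
    1 / (q + t * (u - q)) ≤ (1 / q) * (1 + δ + (1 / (4 * δ) + 1 / η) * ((u - q) / q) ^ 2) := by
  set r := (u - q) / q with hr
  have hr1 : -1 ≤ r := by rw [hr, le_div_iff₀ hq]; linarith
  have e : q + t * (u - q) = q * (1 + t * r) := by rw [hr]; field_simp
  have hp : η ≤ 1 + t * r := by nlinarith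
  have hp0 : 0 < 1 + t * r := by linarith
  rw [e, one_div_mul_eq_div, one_div, mul_inv, inv_eq_one_div, mul_comm, inv_eq_one_div, mul_one_div]
  refine div_le_div_of_nonneg_right ?_ hq.le
  have e2 : 1 / (1 + t * r) = 1 - t * r + t ^ 2 * r ^ 2 / (1 + t * r) := by field_simp; ring
  rw [e2]
  have h1 : t ^ 2 * r ^ 2 / (1 + t * r) ≤ 1 / η * r ^ 2 := by
    rw [one_div_mul_eq_div]
    apply div_le_div₀ (by positivity) _ hη hp
    have : t ^ 2 ≤ 1 := by nlinarith
    nlinarith [sq_nonneg r]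
  have h2 : - (t * r) ≤ δ + 1 / (4 * δ) * r ^ 2 := by
    have h3 : δ + 1 / (4 * δ) * r ^ 2 + t * r = 1 / (4 * δ) * (r + 2 * δ * t) ^ 2 + δ * (1 - t ^ 2) := by
      field_simp; ring
    have h4 : 0 ≤ δ * (1 - t ^ 2) := mul_nonneg hδ.le (by nlinarith)
    have h5 : 0 ≤ 1 / (4 * δ) * (r + 2 * δ * t) ^ 2 := by positivity
    linarith
  linarith

end


section
variable {V : Type} [Fintype V] {L n H : ℝ}

/-- Hypotheses on the discrete density. -/
structure Dens (g : Grid V L n H) (p : V → ℝ) (a P κ : ℝ) : Prop where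
  ha : 0 < a
  hP : 0 < P
  hκ : 0 ≤ κ
  lo : ∀ x, a / L ^ 2 ≤ p x
  hi : ∀ x, p x ≤ P / L ^ 2
  lip : ∀ x y, |p x - p y| ≤ κ / L ^ 2 * ‖g.z x - g.z y‖
  one : ∑ x, p x = 1

/-- smoothing -/
def Grid.sm (g : Grid V L n H) (m : V → ℝ) (x : V) : ℝ := ∑ y, m y * g.K y x

lemma Grid.sm_nonneg (g : Grid V L n H) {m : V → ℝ} (hm : ∀ x, 0 ≤ m x) (x : V) : 0 ≤ g.sm m x :=
  Finset.sum_nonneg fun y _ => mul_nonneg (hm y) (g.K_nonneg _ _)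

lemma Grid.sm_sum (g : Grid V L n H) (m : V → ℝ) : ∑ x, g.sm m x = ∑ x, m x := by
  unfold Grid.sm
  rw [Finset.sum_comm]
  refine Finset.sum_congr rfl fun y _ => ?_
  rw [← Finset.mul_sum, g.K_row, mul_one]

lemma Grid.K_col (g : Grid V L n H) (x : V) : ∑ y, g.K y x = 1 := by
  rw [← g.K_row x]; exact Finset.sum_congr rfl fun y _ => g.K_symm _ _

variable {g : Grid V L n H} {p : V → ℝ} {a P κ : ℝ}

lemma Dens.pos (h : Dens g p a P κ) (hL : 0 < L) (x : V) : 0 < p x :=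
  lt_of_lt_of_le (div_pos h.ha (by positivity)) (h.lo x)

lemma Dens.sm_lo (h : Dens g p a P κ) (x : V) : a / L ^ 2 ≤ g.sm p x := by
  unfold Grid.sm
  calc a / L ^ 2 = ∑ y, a / L ^ 2 * g.K y x := by rw [← Finset.mul_sum, g.K_col, mul_one]
    _ ≤ _ := Finset.sum_le_sum fun y _ => mul_le_mul_of_nonneg_right (h.lo y) (g.K_nonneg _ _)

lemma Dens.sm_ge (h : Dens g p a P κ) (hL : 0 < L) (hn : 0 < n) {ε : ℝ} (hε : 0 < ε)
    (hs : 6 * κ ≤ ε * a * n) (x : V) : p x ≤ (1 + ε) * g.sm p x := by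
  have h1 : p x - g.sm p x = ∑ y, g.K x y * (p x - p y) := by
    unfold Grid.sm
    simp only [mul_sub, Finset.sum_sub_distrib, ← Finset.sum_mul, g.K_row, one_mul]
    congr 1
    exact Finset.sum_congr rfl fun y _ => by rw [g.K_symm]; ring
  have h2 : ∑ y, g.K x y * (p x - p y) ≤ κ / L ^ 2 * ∑ y, g.K x y * (n / 2 * ‖g.z x - g.z y‖ ^ 2 + 1 / (2 * n)) := by
    rw [Finset.mul_sum]
    refine Finset.sum_le_sum fun y _ => ?_
    have k0 := g.K_nonneg x y
    have hk : 0 ≤ κ / L ^ 2 := div_nonneg h.hκ (by positivity)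
    have h3 := (le_abs_self _).trans (h.lip x y)
    have h4 : ‖g.z x - g.z y‖ ≤ n / 2 * ‖g.z x - g.z y‖ ^ 2 + 1 / (2 * n) := by
      have : n / 2 * ‖g.z x - g.z y‖ ^ 2 + 1 / (2 * n) - ‖g.z x - g.z y‖
        = n / 2 * (‖g.z x - g.z y‖ - 1 / n) ^ 2 := by field_simp; ring
      have : 0 ≤ n / 2 * (‖g.z x - g.z y‖ - 1 / n) ^ 2 := by positivity
      linarith
    calc _ ≤ g.K x y * (κ / L ^ 2 * (n / 2 * ‖g.z x - g.z y‖ ^ 2 + 1 / (2 * n))) := by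
          apply mul_le_mul_of_nonneg_left _ k0
          exact h3.trans (mul_le_mul_of_nonneg_left h4 hk)
      _ = _ := by ring
  have h5 : ∑ y, g.K x y * (n / 2 * ‖g.z x - g.z y‖ ^ 2 + 1 / (2 * n)) ≤ 6 / n := by
    have e : ∑ y, g.K x y * (n / 2 * ‖g.z x - g.z y‖ ^ 2 + 1 / (2 * n))
      = n / 2 * ∑ y, g.K x y * ‖g.z x - g.z y‖ ^ 2 + 1 / (2 * n) := by
      simp only [mul_add, Finset.sum_add_distrib, ← Finset.sum_mul, g.K_row, one_mul, Finset.mul_sum]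
      congr 1
      exact Finset.sum_congr rfl fun y _ => by ring
    rw [e]
    calc _ ≤ n / 2 * (10 / n ^ 2) + 1 / (2 * n) := by
          have := g.K_mom x
          gcongr
      _ ≤ 6 / n := by
          have : 6 / n - (n / 2 * (10 / n ^ 2) + 1 / (2 * n)) = 1 / (2 * n) := by field_simp; ring
          have : 0 ≤ 1 / (2 * n) := by positivity
          linarith
  have hk : 0 ≤ κ / L ^ 2 := div_nonneg h.hκ (by positivity)
  have h6 : p x - g.sm p x ≤ κ / L ^ 2 * (6 / n) := by
    rw [h1]; exact h2.trans (mul_le_mul_of_nonneg_left h5 hk)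
  have h7 : κ / L ^ 2 * (6 / n) ≤ ε * (a / L ^ 2) := by
    have : κ / L ^ 2 * (6 / n) = (6 * κ) / (L ^ 2 * n) := by field_simp
    rw [this]
    have : ε * (a / L ^ 2) = (ε * a * n) / (L ^ 2 * n) := by field_simp
    rw [this]
    gcongr
  have h8 := mul_le_mul_of_nonneg_left (h.sm_lo x) hε.le
  linarith

lemma sample_Cpl [DecidableEq V] (h : Dens g p a P κ) (hL : 0 < L) (hn : 0 < n) {ε ζ : ℝ} (hε : 0 < ε)
    (hε1 : ε < 1) (hζ : 0 < ζ) (hs : 6 * κ ≤ ε * a * n) {m φ : V → ℝ} (hm : ∀ x, 0 ≤ m x)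
    (hm1 : ∑ x, m x = 1)
    (hlap : ∀ x, ∑ d, ((φ x - φ (g.F d x)) + (φ x - φ (g.B d x))) = g.sm m x - g.sm p x) :
    Cpl g.z m p
      ((1 + ε) ^ 2 * ((1 + ε) / (1 - ε) * ((1 + ε) * (∑ x, g.gp φ x * ((1 + ε) ^ 2 * (1 / (L ^ 2 * p x))
          + (1 / (4 * ε) + 2 / ε ^ 2) / a ^ 3 * L ^ 4 * (g.sm m x - g.sm p x) ^ 2))
        + (1 + 1 / ε) * ((1 / (2 * L)) * ∑ x, g.gp φ x + 2 / L)) + ζ)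
        + (2 + ε) * (1 + 1 / ε) * (10 / n ^ 2)) := by
  set u := g.sm m
  set q := g.sm p
  have ha := h.ha
  have hq0 : ∀ x, 0 < q x := fun x => lt_of_lt_of_le (div_pos h.ha (by positivity)) (h.sm_lo x)
  have hu0 : ∀ x, 0 ≤ u x := g.sm_nonneg hm
  have hp0 := h.pos hL
  have hu1 : ∑ x, u x = 1 := by rw [g.sm_sum, hm1]
  have hq1 : ∑ x, q x = 1 := by rw [g.sm_sum, h.one]
  set C₂ := 1 / (4 * ε) + 2 / ε ^ 2 with hC₂
  have hC₂0 : 0 < C₂ := by positivity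
  set B2 := ∑ x, g.gp φ x * ((1 + ε) ^ 2 * (1 / (L ^ 2 * p x)) + C₂ / a ^ 3 * L ^ 4 * (u x - q x) ^ 2) with hB2
  have hB20 : 0 ≤ B2 := Finset.sum_nonneg fun x _ => mul_nonneg (g.gp_nonneg φ x) (by
    have := hp0 x; positivity)
  set σ := (1 / (2 * L)) * ∑ x, g.gp φ x + 2 / L with hσ
  have hσ0 : 0 ≤ σ := by
    have : 0 ≤ ∑ x, g.gp φ x := Finset.sum_nonneg fun x _ => g.gp_nonneg φ x
    positivity
  set η := ε ^ 2 / 2 with hη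
  have hη0 : 0 < η := by positivity
  have hη1 : η ≤ 1 := by rw [hη]; nlinarith
  have hfl := g.flow hL hu0 hq0 hη0 hη1 hlap (Real.sqrt_nonneg B2) (by
    intro s hs'
    rw [Real.sq_sqrt hB20]
    refine Finset.sum_le_sum fun x _ => ?_
    have hi := inv_interp (hq0 x) (hu0 x) hη0 (t := s * (1 - η)) (mul_nonneg hs'.1 (by linarith))
      (by nlinarith [hs'.2]) hε
    have e : q x + s * ((1 - η) * (u x - q x)) = q x + s * (1 - η) * (u x - q x) := by ring
    rw [e, div_eq_mul_one_div _ (q x + s * (1 - η) * (u x - q x)), div_mul_eq_mul_div, mul_div_assoc]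
    refine mul_le_mul_of_nonneg_left ?_ (g.gp_nonneg φ x)
    rw [div_le_iff₀ (by positivity)]
    refine hi.trans ?_
    have hqx := hq0 x
    have hpx := hp0 x
    have e2 : 1 / (4 * ε) + 1 / η = C₂ := by rw [hη, hC₂]; field_simp
    rw [e2]
    have t1 : 1 / q x ≤ (1 + ε) * (1 / p x) := by
      rw [mul_one_div, div_le_div_iff₀ hqx hpx]
      have := h.sm_ge hL hn hε hs x
      linarith
    have t2 : 1 / q x ^ 3 ≤ L ^ 6 / a ^ 3 := by
      have h1 := pow_le_pow_left₀ (by positivity) (h.sm_lo x) 3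
      calc 1 / q x ^ 3 ≤ 1 / (a / L ^ 2) ^ 3 := one_div_le_one_div_of_le (by positivity) h1
        _ = _ := by field_simp
    calc _ = (1 + ε) * (1 / q x) + C₂ * (u x - q x) ^ 2 * (1 / q x ^ 3) := by field_simp
      _ ≤ (1 + ε) * ((1 + ε) * (1 / p x)) + C₂ * (u x - q x) ^ 2 * (L ^ 6 / a ^ 3) := by gcongr
      _ = _ := by field_simp)
  have hB : (√B2 + √σ) ^ 2 ≤ (1 + ε) * B2 + (1 + 1 / ε) * σ := by
    have h1 := Real.sq_sqrt hB20
    have h2 := Real.sq_sqrt hσ0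
    have : (1 + ε) * √B2 ^ 2 + (1 + 1 / ε) * √σ ^ 2 - (√B2 + √σ) ^ 2 = (1 / ε) * (ε * √B2 - √σ) ^ 2 := by
      field_simp; ring
    have : 0 ≤ (1 / ε) * (ε * √B2 - √σ) ^ 2 := by positivity
    rw [h1, h2] at *
    linarith
  have himp := Cpl.improve hu0 (fun x => (hq0 x).le) hu1 hq1 hη0.le hη1 hε hε1 (by
    rw [hη]
    have : (1 + 1 / ε) * (ε ^ 2 / 2) = (ε ^ 2 + ε) / 2 := by field_simp
    rw [this]; nlinarith) hζ (hfl.mono hB)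
  have hk : ∀ m' : V → ℝ, (∀ x, 0 ≤ m' x) → ∑ x, m' x = 1 → Cpl g.z m' (g.sm m') (10 / n ^ 2) := by
    intro m' h0 h1
    refine (Cpl.kernel (z := g.z) g.K m' h0 g.K_nonneg g.K_row).mono ?_
    calc _ ≤ ∑ x, m' x * (10 / n ^ 2) := Finset.sum_le_sum fun x _ =>
          mul_le_mul_of_nonneg_left (g.K_mom x) (h0 x)
      _ = _ := by rw [← Finset.sum_mul, h1, one_mul]
  have h1 := hk m hm hm1
  have h2 := hk p (fun x => (hp0 x).le) h.one
  have h3 := himp.comp h2.symm hε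
  have h4 := (h3.symm.comp h1.symm hε).symm
  refine h4.mono (le_of_eq ?_)
  ring

end


section
variable {V : Type} [Fintype V] {L n H : ℝ}

lemma Grid.energy (g : Grid V L n H) (f φ : V → ℝ) :
    ∑ x, ∑ d, f (g.F d x) * (φ (g.F d x) - φ x) ^ 2
      = ∑ x, f x * φ x * (∑ d, ((φ x - φ (g.F d x)) + (φ x - φ (g.B d x))))
        - ∑ x, ∑ d, φ x * (f (g.F d x) - f x) * (φ (g.F d x) - φ x) := by
  have h1 : ∑ x, f x * φ x * (∑ d, ((φ x - φ (g.F d x)) + (φ x - φ (g.B d x))))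
      = ∑ d, ∑ x, (f x * φ x * (φ x - φ (g.F d x)) + f (g.F d x) * φ (g.F d x) * (φ (g.F d x) - φ x)) := by
    simp only [Finset.mul_sum]
    rw [Finset.sum_comm]
    refine Finset.sum_congr rfl fun d _ => ?_
    have := g.adj d (fun s t => f s * φ s * (φ s - φ t)) (fun s => by ring)
    simp only [mul_add, Finset.sum_add_distrib]
    rw [this]
  rw [h1, Finset.sum_comm, Finset.sum_comm (f := fun x d => φ x * (f (g.F d x) - f x) * (φ (g.F d x) - φ x)),
    ← Finset.sum_sub_distrib]
  refine Finset.sum_congr rfl fun d _ => ?_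
  rw [← Finset.sum_sub_distrib]
  exact Finset.sum_congr rfl fun x _ => by ring

lemma Grid.G_abs (g : Grid V L n H) : ∑ y, ∑ x, |g.G x y| ≤ 3 / 2 * L ^ 4 := by
  have h : ∀ t : ℝ, |t| ≤ 1 / 2 * t ^ 2 + 1 / 2 := fun t => by
    nlinarith [sq_nonneg (|t| - 1), sq_abs t]
  calc _ ≤ ∑ y, ∑ x, (1 / 2 * g.G x y ^ 2 + 1 / 2) :=
        Finset.sum_le_sum fun y _ => Finset.sum_le_sum fun x _ => h _
    _ = 1 / 2 * (∑ x, ∑ y, g.G x y ^ 2) + 1 / 2 * (L ^ 2 * L ^ 2) := by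
        simp only [Finset.sum_add_distrib, ← Finset.mul_sum, Finset.sum_const, nsmul_eq_mul,
          Finset.card_univ, g.hcard]
        rw [Finset.sum_comm]; ring
    _ ≤ _ := by nlinarith [g.GG]

lemma Grid.EG (g : Grid V L n H) (hL : 0 < L) :
    ∑ y, ∑ x, ∑ d, (g.G (g.F d x) y - g.G x y) ^ 2 ≤ L ^ 2 * (H + 3 / 2) := by
  have h1 : ∀ y, ∑ x, ∑ d, (g.G (g.F d x) y - g.G x y) ^ 2 = ∑ x, g.G x y * (g.K x y - 1 / L ^ 2) := by
    intro y
    have := g.energy (fun _ => 1) (fun x => g.G x y)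
    simp only [one_mul, g.lap, sub_self, mul_zero, zero_mul, Finset.sum_const_zero, sub_zero] at this
    exact this
  simp only [h1]
  calc _ ≤ ∑ y, ∑ x, (g.K x y * g.G x y + 1 / L ^ 2 * |g.G x y|) := by
        refine Finset.sum_le_sum fun y _ => Finset.sum_le_sum fun x _ => ?_
        have : 0 ≤ 1 / L ^ 2 := by positivity
        nlinarith [neg_abs_le (g.G x y)]
    _ = ∑ x, ∑ y, g.K x y * g.G x y + 1 / L ^ 2 * ∑ y, ∑ x, |g.G x y| := by
        simp only [Finset.sum_add_distrib, Finset.mul_sum]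
        rw [Finset.sum_comm]
    _ ≤ L ^ 2 * H + 1 / L ^ 2 * (3 / 2 * L ^ 4) := by
        have := g.G_abs
        exact add_le_add g.KG (by gcongr)
    _ = _ := by field_simp

variable {g : Grid V L n H} {p : V → ℝ} {a P κ : ℝ}

lemma Dens.Sw (h : Dens g p a P κ) (hL : 0 < L) (hn : 0 < n) {τ : ℝ} (hτ : 0 < τ) :
    ∑ y, p y * ∑ x, ∑ d, (1 / (L ^ 2 * p (g.F d x))) * (g.G (g.F d x) y - g.G x y) ^ 2
      ≤ H + 6 * κ / a + 3 * P / (2 * a) + P * κ / a ^ 2 * (2 / τ + τ / 2 * (H + 3 / 2)) := by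
  have ha := h.ha
  have hP := h.hP
  have hκ := h.hκ
  have hp := h.pos hL
  have e1 : ∀ y, ∑ x, ∑ d, (1 / (L ^ 2 * p (g.F d x))) * (g.G (g.F d x) y - g.G x y) ^ 2
      = ∑ x, 1 / (L ^ 2 * p x) * g.G x y * (g.K x y - 1 / L ^ 2)
        - ∑ x, ∑ d, g.G x y * (1 / (L ^ 2 * p (g.F d x)) - 1 / (L ^ 2 * p x)) * (g.G (g.F d x) y - g.G x y) := by
    intro y
    have := g.energy (fun x => 1 / (L ^ 2 * p x)) (fun x => g.G x y)
    simp only [g.lap] at this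
    exact this
  -- inverse bounds
  have hinv : ∀ x, 1 / (L ^ 2 * p x) ≤ 1 / a := by
    intro x
    apply one_div_le_one_div_of_le ha
    have := h.lo x
    rw [div_le_iff₀ (by positivity)] at this
    linarith
  have hinv0 : ∀ x, 0 ≤ 1 / (L ^ 2 * p x) := fun x => by have := hp x; positivity
  -- pointwise bounds
  have t12 : ∀ x y, p y * (1 / (L ^ 2 * p x) * g.G x y * (g.K x y - 1 / L ^ 2))
      ≤ 1 / L ^ 2 * (g.K x y * g.G x y)
        + κ / (a * L ^ 2) * (n ^ 2 / 2 * (g.K x y * ‖g.z x - g.z y‖ ^ 2) + 1 / 2 * (L ^ 2)⁻¹ * g.G x y ^ 2)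
        + P / (a * L ^ 4) * |g.G x y| := by
    intro x y
    have hpx := hp x
    have hpy := hp y
    have k0 := g.K_nonneg x y
    have eq1 : p y * (1 / (L ^ 2 * p x) * g.G x y * (g.K x y - 1 / L ^ 2))
      = 1 / L ^ 2 * (g.K x y * g.G x y) + (p y - p x) * (1 / (L ^ 2 * p x)) * g.K x y * g.G x y
        - p y * (1 / (L ^ 2 * p x)) * (1 / L ^ 2) * g.G x y := by
      field_simp; ring
    rw [eq1]
    have b1 : (p y - p x) * (1 / (L ^ 2 * p x)) * g.K x y * g.G x y
        ≤ κ / (a * L ^ 2) * (n ^ 2 / 2 * (g.K x y * ‖g.z x - g.z y‖ ^ 2) + 1 / 2 * (L ^ 2)⁻¹ * g.G x y ^ 2) := by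
      have c1 : |(p y - p x) * (1 / (L ^ 2 * p x))| ≤ κ / L ^ 2 * ‖g.z x - g.z y‖ * (1 / a) := by
        rw [abs_mul, abs_of_nonneg (hinv0 x), abs_sub_comm]
        exact mul_le_mul (h.lip x y) (hinv x) (hinv0 x) (by positivity)
      have c2 : g.K x y * (‖g.z x - g.z y‖ * |g.G x y|) ≤
          n ^ 2 / 2 * (g.K x y * ‖g.z x - g.z y‖ ^ 2) + 1 / 2 * (L ^ 2)⁻¹ * g.G x y ^ 2 := by
        have d1 : ‖g.z x - g.z y‖ * |g.G x y| ≤ n ^ 2 / 2 * ‖g.z x - g.z y‖ ^ 2 + 1 / (2 * n ^ 2) * g.G x y ^ 2 := by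
          have : n ^ 2 / 2 * ‖g.z x - g.z y‖ ^ 2 + 1 / (2 * n ^ 2) * |g.G x y| ^ 2 - ‖g.z x - g.z y‖ * |g.G x y|
            = 1 / (2 * n ^ 2) * (n ^ 2 * ‖g.z x - g.z y‖ - |g.G x y|) ^ 2 := by field_simp; ring
          have : 0 ≤ 1 / (2 * n ^ 2) * (n ^ 2 * ‖g.z x - g.z y‖ - |g.G x y|) ^ 2 := by positivity
          rw [← sq_abs (g.G x y)]; linarith
        have d2 : g.K x y * (1 / (2 * n ^ 2) * g.G x y ^ 2) ≤ n ^ 2 / L ^ 2 * (1 / (2 * n ^ 2) * g.G x y ^ 2) :=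
          mul_le_mul_of_nonneg_right (g.K_le x y) (by positivity)
        have d3 : n ^ 2 / L ^ 2 * (1 / (2 * n ^ 2) * g.G x y ^ 2) = 1 / 2 * (L ^ 2)⁻¹ * g.G x y ^ 2 := by
          field_simp
        calc _ ≤ g.K x y * (n ^ 2 / 2 * ‖g.z x - g.z y‖ ^ 2 + 1 / (2 * n ^ 2) * g.G x y ^ 2) :=
              mul_le_mul_of_nonneg_left d1 k0
          _ = n ^ 2 / 2 * (g.K x y * ‖g.z x - g.z y‖ ^ 2) + g.K x y * (1 / (2 * n ^ 2) * g.G x y ^ 2) := by ring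
          _ ≤ _ := by linarith
      calc _ ≤ |(p y - p x) * (1 / (L ^ 2 * p x)) * g.K x y * g.G x y| := le_abs_self _
        _ = |(p y - p x) * (1 / (L ^ 2 * p x))| * (g.K x y * |g.G x y|) := by
            rw [abs_mul, abs_mul _ (g.K x y), abs_of_nonneg k0]; ring
        _ ≤ κ / L ^ 2 * ‖g.z x - g.z y‖ * (1 / a) * (g.K x y * |g.G x y|) :=
            mul_le_mul_of_nonneg_right c1 (by positivity)
        _ = κ / (a * L ^ 2) * (g.K x y * (‖g.z x - g.z y‖ * |g.G x y|)) := by field_simp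
        _ ≤ _ := mul_le_mul_of_nonneg_left c2 (by positivity)
    have b2 : - (p y * (1 / (L ^ 2 * p x)) * (1 / L ^ 2) * g.G x y) ≤ P / (a * L ^ 4) * |g.G x y| := by
      have c1 : p y * (1 / (L ^ 2 * p x)) * (1 / L ^ 2) ≤ P / L ^ 2 * (1 / a) * (1 / L ^ 2) := by
        have := h.hi y
        have := hinv x
        have := hinv0 x
        gcongr
      have c2 : P / L ^ 2 * (1 / a) * (1 / L ^ 2) = P / (a * L ^ 4) := by field_simp
      rw [c2] at c1
      have c3 : 0 ≤ p y * (1 / (L ^ 2 * p x)) * (1 / L ^ 2) := by have := hinv0 x; positivity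
      calc _ ≤ |(p y * (1 / (L ^ 2 * p x)) * (1 / L ^ 2) * g.G x y)| := neg_le_abs _
        _ = p y * (1 / (L ^ 2 * p x)) * (1 / L ^ 2) * |g.G x y| := by rw [abs_mul, abs_of_nonneg c3]
        _ ≤ _ := mul_le_mul_of_nonneg_right c1 (abs_nonneg _)
    linarith
  have t3 : ∀ x y d, - (p y * (g.G x y * (1 / (L ^ 2 * p (g.F d x)) - 1 / (L ^ 2 * p x)) * (g.G (g.F d x) y - g.G x y)))
      ≤ P * κ / (a ^ 2 * L ^ 3) * (1 / (2 * τ * L) * g.G x y ^ 2 + τ * L / 2 * (g.G (g.F d x) y - g.G x y) ^ 2) := by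
    intro x y d
    have hpx := hp x
    have hpy := hp y
    have hpf := hp (g.F d x)
    set D := g.G (g.F d x) y - g.G x y
    have c1 : |1 / (L ^ 2 * p (g.F d x)) - 1 / (L ^ 2 * p x)| ≤ κ / (a ^ 2 * L) := by
      have e : 1 / (L ^ 2 * p (g.F d x)) - 1 / (L ^ 2 * p x)
        = L ^ 2 * (p x - p (g.F d x)) * ((1 / (L ^ 2 * p (g.F d x))) * (1 / (L ^ 2 * p x))) := by
        field_simp
      rw [e, abs_mul, abs_of_nonneg (mul_nonneg (hinv0 _) (hinv0 _)), abs_mul, abs_of_nonneg (by positivity : 0 ≤ L ^ 2)]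
      have l1 := h.lip x (g.F d x)
      have l2 := g.dist_F d x
      rw [norm_sub_rev] at l2
      have l3 : |p x - p (g.F d x)| ≤ κ / L ^ 2 * (1 / L) := l1.trans (by gcongr)
      have i1 := hinv x
      have i2 := hinv (g.F d x)
      have i3 := hinv0 x
      calc _ ≤ L ^ 2 * (κ / L ^ 2 * (1 / L)) * (1 / a * (1 / a)) := by gcongr
        _ = _ := by field_simp
    have c2 : |g.G x y| * |D| ≤ 1 / (2 * τ * L) * g.G x y ^ 2 + τ * L / 2 * D ^ 2 := by
      have : 1 / (2 * τ * L) * |g.G x y| ^ 2 + τ * L / 2 * |D| ^ 2 - |g.G x y| * |D|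
        = 1 / (2 * τ * L) * (|g.G x y| - τ * L * |D|) ^ 2 := by field_simp; ring
      have : 0 ≤ 1 / (2 * τ * L) * (|g.G x y| - τ * L * |D|) ^ 2 := by positivity
      rw [← sq_abs (g.G x y), ← sq_abs D]; linarith
    calc _ ≤ |p y * (g.G x y * (1 / (L ^ 2 * p (g.F d x)) - 1 / (L ^ 2 * p x)) * D)| := neg_le_abs _
      _ = p y * |1 / (L ^ 2 * p (g.F d x)) - 1 / (L ^ 2 * p x)| * (|g.G x y| * |D|) := by
          rw [abs_mul, abs_mul, abs_mul, abs_of_pos hpy]; ring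
      _ ≤ P / L ^ 2 * (κ / (a ^ 2 * L)) * (1 / (2 * τ * L) * g.G x y ^ 2 + τ * L / 2 * D ^ 2) := by
          have := h.hi y
          gcongr
      _ = _ := by field_simp
  have hEG := g.EG hL
  have hGG : ∑ y, ∑ x, g.G x y ^ 2 ≤ 2 * L ^ 4 := by rw [Finset.sum_comm]; exact g.GG
  have hKG : ∑ y, ∑ x, g.K x y * g.G x y ≤ L ^ 2 * H := by rw [Finset.sum_comm]; exact g.KG
  have hKm : ∑ y, ∑ x, g.K x y * ‖g.z x - g.z y‖ ^ 2 ≤ L ^ 2 * (10 / n ^ 2) := by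
    rw [Finset.sum_comm]
    refine (Finset.sum_le_sum fun x _ => g.K_mom x).trans ?_
    rw [Finset.sum_const, nsmul_eq_mul, Finset.card_univ, g.hcard]
  have hGa := g.G_abs
  calc _ = ∑ y, ∑ x, p y * (1 / (L ^ 2 * p x) * g.G x y * (g.K x y - 1 / L ^ 2))
        + ∑ y, ∑ x, ∑ d, - (p y * (g.G x y * (1 / (L ^ 2 * p (g.F d x)) - 1 / (L ^ 2 * p x)) * (g.G (g.F d x) y - g.G x y))) := by
        simp only [e1, mul_sub, Finset.sum_sub_distrib, Finset.sum_neg_distrib, Finset.mul_sum]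
        ring
    _ ≤ ∑ y, ∑ x, (1 / L ^ 2 * (g.K x y * g.G x y)
        + κ / (a * L ^ 2) * (n ^ 2 / 2 * (g.K x y * ‖g.z x - g.z y‖ ^ 2) + 1 / 2 * (L ^ 2)⁻¹ * g.G x y ^ 2)
        + P / (a * L ^ 4) * |g.G x y|) +
        ∑ y, ∑ x, ∑ d : Bool, P * κ / (a ^ 2 * L ^ 3) * (1 / (2 * τ * L) * g.G x y ^ 2 + τ * L / 2 * (g.G (g.F d x) y - g.G x y) ^ 2) := by
        refine add_le_add (Finset.sum_le_sum fun y _ => Finset.sum_le_sum fun x _ => t12 x y)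
          (Finset.sum_le_sum fun y _ => Finset.sum_le_sum fun x _ => Finset.sum_le_sum fun d _ => t3 x y d)
    _ = 1 / L ^ 2 * (∑ y, ∑ x, g.K x y * g.G x y)
        + κ / (a * L ^ 2) * (n ^ 2 / 2 * (∑ y, ∑ x, g.K x y * ‖g.z x - g.z y‖ ^ 2) + 1 / 2 * (L ^ 2)⁻¹ * ∑ y, ∑ x, g.G x y ^ 2)
        + P / (a * L ^ 4) * (∑ y, ∑ x, |g.G x y|)
        + P * κ / (a ^ 2 * L ^ 3) * (1 / (2 * τ * L) * (2 * ∑ y, ∑ x, g.G x y ^ 2) + τ * L / 2 * ∑ y, ∑ x, ∑ d, (g.G (g.F d x) y - g.G x y) ^ 2) := by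
        simp only [mul_add, Finset.sum_add_distrib, ← Finset.mul_sum, Finset.sum_const, nsmul_eq_mul,
          Finset.card_univ, Fintype.card_bool]
        push_cast
        ring
    _ ≤ 1 / L ^ 2 * (L ^ 2 * H)
        + κ / (a * L ^ 2) * (n ^ 2 / 2 * (L ^ 2 * (10 / n ^ 2)) + 1 / 2 * (L ^ 2)⁻¹ * (2 * L ^ 4))
        + P / (a * L ^ 4) * (3 / 2 * L ^ 4)
        + P * κ / (a ^ 2 * L ^ 3) * (1 / (2 * τ * L) * (2 * (2 * L ^ 4)) + τ * L / 2 * (L ^ 2 * (H + 3 / 2))) := by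
        gcongr
    _ = _ := by field_simp; ring

end


section
variable {V : Type} [Fintype V]

def cen (p h : V → ℝ) (y : V) : ℝ := h y - ∑ y', p y' * h y'

/-- centred empirical average -/
def av (p : V → ℝ) {N : ℕ} (h : V → ℝ) (ω : Fin N → V) : ℝ := (1 / N : ℝ) * ∑ i, cen p h (ω i)

lemma cen_zero {p : V → ℝ} (h1 : ∑ x, p x = 1) (h : V → ℝ) : ∑ y, p y * cen p h y = 0 := by
  simp only [cen, mul_sub, Finset.sum_sub_distrib, ← Finset.sum_mul, h1, one_mul, sub_self]

lemma cen_sq {p : V → ℝ} (h1 : ∑ x, p x = 1) (h : V → ℝ) :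
    ∑ y, p y * cen p h y ^ 2 ≤ ∑ y, p y * h y ^ 2 := by
  set m := ∑ y', p y' * h y' with hm
  have : ∑ y, p y * cen p h y ^ 2 = ∑ y, p y * h y ^ 2 - m ^ 2 := by
    have e : ∀ y, p y * cen p h y ^ 2 = p y * h y ^ 2 - 2 * m * (p y * h y) + m ^ 2 * p y := by
      intro y; simp only [cen, ← hm]; ring
    simp only [e, Finset.sum_add_distrib, Finset.sum_sub_distrib, ← Finset.mul_sum, h1, ← hm]
    ring
  rw [this]; nlinarith [sq_nonneg m]

lemma av_sub {p : V → ℝ} {N : ℕ} (h k : V → ℝ) (ω : Fin N → V) :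
    av p h ω - av p k ω = av p (fun y => h y - k y) ω := by
  simp only [av, cen]
  rw [← mul_sub, ← Finset.sum_sub_distrib]
  congr 1
  refine Finset.sum_congr rfl fun i _ => ?_
  simp only [mul_sub, Finset.sum_sub_distrib]; ring

lemma Ex_av {p : V → ℝ} {N : ℕ} (hN : 0 < N) (h1 : ∑ x, p x = 1) (h : V → ℝ) :
    Ex p N (fun ω => av p h ω ^ 2) ≤ (1 / N : ℝ) * ∑ y, p y * h y ^ 2 := by
  have hN' : (0 : ℝ) < N := by exact_mod_cast hN
  have e : (fun ω : Fin N → V => av p h ω ^ 2) = fun ω => (1 / N : ℝ) ^ 2 *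
      ((∑ i, cen p h (ω i)) * (∑ i, cen p h (ω i))) := by
    funext ω; simp only [av]; ring
  rw [e, Ex_mul, Ex_bil h1 (cen_zero h1 h) (cen_zero h1 h)]
  have := cen_sq h1 h
  simp only [← sq (cen p h _)]
  calc (1 / N : ℝ) ^ 2 * (N * ∑ x, p x * cen p h x ^ 2) = (1 / N : ℝ) * ∑ x, p x * cen p h x ^ 2 := by
        field_simp
    _ ≤ _ := by gcongr

lemma Ex_av4 {p : V → ℝ} {N : ℕ} (hN : 0 < N) (hp : ∀ x, 0 ≤ p x) (h1 : ∑ x, p x = 1) (h k : V → ℝ)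
    {M S : ℝ} (hM : ∀ y, cen p k y ^ 2 ≤ M ^ 2) (hS : ∑ y, p y * k y ^ 2 ≤ S) :
    Ex p N (fun ω => av p h ω ^ 2 * av p k ω ^ 2)
      ≤ (M ^ 2 / N ^ 3 + 3 * S / N ^ 2) * ∑ y, p y * h y ^ 2 := by
  have hN' : (0 : ℝ) < N := by exact_mod_cast hN
  have e : (fun ω : Fin N → V => av p h ω ^ 2 * av p k ω ^ 2) = fun ω => (1 / N : ℝ) ^ 4 *
      ((∑ i, cen p h (ω i)) ^ 2 * (∑ i, cen p k (ω i)) ^ 2) := by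
    funext ω; simp only [av]; ring
  rw [e, Ex_mul]
  have hq := Ex_quad (N := N) hp h1 (cen_zero h1 h) (cen_zero h1 k)
  have c1 := cen_sq h1 h
  have c2 := (cen_sq h1 k).trans hS
  have n1 : 0 ≤ ∑ y, p y * cen p h y ^ 2 := Finset.sum_nonneg fun y _ => mul_nonneg (hp y) (sq_nonneg _)
  have n2 : 0 ≤ ∑ y, p y * cen p k y ^ 2 := Finset.sum_nonneg fun y _ => mul_nonneg (hp y) (sq_nonneg _)
  have c3 : ∑ x, p x * (cen p h x ^ 2 * cen p k x ^ 2) ≤ M ^ 2 * ∑ y, p y * cen p h y ^ 2 := by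
    rw [Finset.mul_sum]
    refine Finset.sum_le_sum fun y _ => ?_
    have := mul_le_mul_of_nonneg_left (hM y) (mul_nonneg (hp y) (sq_nonneg (cen p h y)))
    linarith
  calc _ ≤ (1 / N : ℝ) ^ 4 * (N * (M ^ 2 * ∑ y, p y * h y ^ 2)
          + 3 * N ^ 2 * ((∑ y, p y * h y ^ 2) * S)) := by
        refine mul_le_mul_of_nonneg_left (hq.trans ?_) (by positivity)
        have c4 : M ^ 2 * ∑ y, p y * cen p h y ^ 2 ≤ M ^ 2 * ∑ y, p y * h y ^ 2 := by gcongr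
        have c5 := c3.trans c4
        have := n1.trans c1
        gcongr
    _ = _ := by field_simp

def emp {N : ℕ} [DecidableEq V] (ω : Fin N → V) (x : V) : ℝ := (1 / N : ℝ) * ∑ i, if ω i = x then 1 else 0

variable {L n H : ℝ} {g : Grid V L n H} {p : V → ℝ} {a P κ : ℝ}

lemma emp_nonneg {N : ℕ} [DecidableEq V] (ω : Fin N → V) (x : V) : 0 ≤ emp ω x :=
  mul_nonneg (by positivity) (Finset.sum_nonneg fun i _ => by split_ifs <;> norm_num)

lemma emp_int {N : ℕ} [DecidableEq V] (ω : Fin N → V) (h : V → ℝ) :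
    ∑ x, emp ω x * h x = (1 / N : ℝ) * ∑ i, h (ω i) := by
  simp only [emp, mul_assoc, ← Finset.mul_sum, Finset.sum_mul]
  rw [Finset.sum_comm]
  congr 1
  refine Finset.sum_congr rfl fun i _ => ?_
  simp

lemma emp_one {N : ℕ} (hN : 0 < N) [DecidableEq V] (ω : Fin N → V) : ∑ x, emp ω x = 1 := by
  have hN' : (0 : ℝ) < N := by exact_mod_cast hN
  have := emp_int ω (fun _ => 1)
  simp only [mul_one, Finset.sum_const, Finset.card_univ, Fintype.card_fin, nsmul_eq_mul] at this
  rw [this]; field_simp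

lemma sm_emp {N : ℕ} (hN : 0 < N) [DecidableEq V] (g : Grid V L n H) (p : V → ℝ) (ω : Fin N → V) (x : V) :
    g.sm (emp ω) x - g.sm p x = av p (fun y => g.K y x) ω := by
  have hN' : (0 : ℝ) < N := by exact_mod_cast hN
  unfold Grid.sm
  rw [emp_int ω (fun y => g.K y x)]
  simp only [av, cen, Finset.sum_sub_distrib, Finset.sum_const, Finset.card_univ, Fintype.card_fin,
    nsmul_eq_mul]
  field_simp

lemma av_lap {N : ℕ} (hN : 0 < N) [DecidableEq V] (h1 : ∑ x, p x = 1) (ω : Fin N → V) (x : V) :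
    ∑ d, ((av p (g.G x) ω - av p (g.G (g.F d x)) ω) + (av p (g.G x) ω - av p (g.G (g.B d x)) ω))
      = g.sm (emp ω) x - g.sm p x := by
  rw [sm_emp hN]
  have h2 : ∀ y, ∑ d, ((cen p (g.G x) y - cen p (g.G (g.F d x)) y) + (cen p (g.G x) y - cen p (g.G (g.B d x)) y))
      = cen p (fun y => g.K y x) y := by
    intro y
    have e : ∀ d, (cen p (g.G x) y - cen p (g.G (g.F d x)) y) + (cen p (g.G x) y - cen p (g.G (g.B d x)) y)
      = ((g.G x y - g.G (g.F d x) y) + (g.G x y - g.G (g.B d x) y))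
        - ∑ y', p y' * ((g.G x y' - g.G (g.F d x) y') + (g.G x y' - g.G (g.B d x) y')) := by
      intro d
      simp only [cen, mul_add, mul_sub, Finset.sum_add_distrib, Finset.sum_sub_distrib]; ring
    simp only [e, Finset.sum_sub_distrib]
    rw [Finset.sum_comm]
    simp only [← Finset.mul_sum, g.lap, mul_sub, Finset.sum_sub_distrib, ← Finset.sum_mul, h1, cen]
    simp only [g.K_symm x]
    ring
  have h3 : ∀ d, (av p (g.G x) ω - av p (g.G (g.F d x)) ω) + (av p (g.G x) ω - av p (g.G (g.B d x)) ω)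
      = 1 / N * ∑ i, ((cen p (g.G x) (ω i) - cen p (g.G (g.F d x)) (ω i))
        + (cen p (g.G x) (ω i) - cen p (g.G (g.B d x)) (ω i))) := by
    intro d
    simp only [av, Finset.sum_add_distrib, Finset.sum_sub_distrib]
    ring
  have h4 : av p (fun y => g.K y x) ω = 1 / N * ∑ i, cen p (fun y => g.K y x) (ω i) := rfl
  rw [Finset.sum_congr rfl fun d _ => h3 d, ← Finset.mul_sum, Finset.sum_comm, h4,
    Finset.sum_congr rfl fun i _ => h2 (ω i)]

/-- total (unweighted) energy against p -/
lemma Dens.T_le (h : Dens g p a P κ) (hL : 0 < L) :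
    ∑ x, ∑ d, (∑ y, p y * (g.G (g.F d x) y - g.G x y) ^ 2 + ∑ y, p y * (g.G (g.B d x) y - g.G x y) ^ 2)
      ≤ 2 * P * (H + 3 / 2) := by
  have hP := h.hP
  have h1 : ∀ y d, ∑ x, (g.G (g.B d x) y - g.G x y) ^ 2 = ∑ x, (g.G (g.F d x) y - g.G x y) ^ 2 := by
    intro y d
    have := g.adj d (fun s t => (g.G t y - g.G s y) ^ 2) (fun s => by ring)
    rw [this]
    exact Finset.sum_congr rfl fun x _ => by ring
  have h2 : ∑ x, ∑ d, (∑ y, p y * (g.G (g.F d x) y - g.G x y) ^ 2 + ∑ y, p y * (g.G (g.B d x) y - g.G x y) ^ 2)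
      = 2 * ∑ y, p y * ∑ x, ∑ d, (g.G (g.F d x) y - g.G x y) ^ 2 := by
    calc _ = ∑ d, ∑ y, p y * (∑ x, (g.G (g.F d x) y - g.G x y) ^ 2 + ∑ x, (g.G (g.B d x) y - g.G x y) ^ 2) := by
          rw [Finset.sum_comm]
          refine Finset.sum_congr rfl fun d _ => ?_
          simp only [← Finset.sum_add_distrib, ← mul_add]
          rw [Finset.sum_comm]
          simp only [Finset.mul_sum]
      _ = ∑ d, ∑ y, p y * (2 * ∑ x, (g.G (g.F d x) y - g.G x y) ^ 2) := by
          simp only [h1, ← two_mul]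
      _ = _ := by
          rw [Finset.sum_comm, Finset.mul_sum]
          refine Finset.sum_congr rfl fun y _ => ?_
          rw [← Finset.mul_sum, Finset.sum_comm (f := fun x d => (g.G (g.F d x) y - g.G x y) ^ 2), ← Finset.mul_sum]
          ring
  rw [h2]
  have h3 : ∑ y, p y * ∑ x, ∑ d, (g.G (g.F d x) y - g.G x y) ^ 2
      ≤ P / L ^ 2 * ∑ y, ∑ x, ∑ d, (g.G (g.F d x) y - g.G x y) ^ 2 := by
    rw [Finset.mul_sum]
    exact Finset.sum_le_sum fun y _ => mul_le_mul_of_nonneg_right (h.hi y)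
      (Finset.sum_nonneg fun _ _ => Finset.sum_nonneg fun _ _ => sq_nonneg _)
  have h4 : P / L ^ 2 * ∑ y, ∑ x, ∑ d, (g.G (g.F d x) y - g.G x y) ^ 2 ≤ P / L ^ 2 * (L ^ 2 * (H + 3 / 2)) := by
    have := g.EG hL
    gcongr
  have h5 : P / L ^ 2 * (L ^ 2 * (H + 3 / 2)) = P * (H + 3 / 2) := by field_simp
  linarith

lemma pos_sq_le (t : ℝ) : max t 0 ^ 2 ≤ t ^ 2 := by
  rcases le_total t 0 with h | h
  · rw [max_eq_right h]; nlinarith [sq_nonneg t]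
  · rw [max_eq_left h]

lemma gp_le (g : Grid V L n H) (φ : V → ℝ) (x : V) :
    g.gp φ x ≤ ∑ d, ((φ (g.F d x) - φ x) ^ 2 + (φ (g.B d x) - φ x) ^ 2) :=
  Finset.sum_le_sum fun _ _ => add_le_add (pos_sq_le _) (pos_sq_le _)

lemma Dens.gp_main (h : Dens g p a P κ) (hL : 0 < L) {ε : ℝ} (hε : 0 < ε) (hs : κ ≤ ε * a * L) (φ : V → ℝ) :
    ∑ x, g.gp φ x * (1 / (L ^ 2 * p x))
      ≤ (1 + ε) * ∑ x, ∑ d, 1 / (L ^ 2 * p (g.F d x)) * (φ (g.F d x) - φ x) ^ 2 := by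
  have hp := h.pos hL
  have hf : ∀ d x, 1 / (L ^ 2 * p x) ≤ (1 + ε) * (1 / (L ^ 2 * p (g.F d x))) := by
    intro d x
    have h1 := hp x
    have h2 := hp (g.F d x)
    have h3 : p (g.F d x) ≤ (1 + ε) * p x := by
      have l1 := (le_abs_self _).trans (h.lip (g.F d x) x)
      have l2 : κ / L ^ 2 * ‖g.z (g.F d x) - g.z x‖ ≤ κ / L ^ 2 * (1 / L) := by
        have := g.dist_F d x
        have := h.hκ
        gcongr
      have l3 : κ / L ^ 2 * (1 / L) ≤ ε * (a / L ^ 2) := by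
        have e1 : κ / L ^ 2 * (1 / L) = κ / L ^ 3 := by field_simp
        have e2 : ε * (a / L ^ 2) = ε * a * L / L ^ 3 := by field_simp
        rw [e1, e2]; gcongr
      have l4 := mul_le_mul_of_nonneg_left (h.lo x) hε.le
      linarith
    rw [mul_one_div, div_le_div_iff₀ (by positivity) (by positivity)]
    nlinarith [sq_nonneg L]
  have e : ∑ x, g.gp φ x * (1 / (L ^ 2 * p x))
      = ∑ d, ∑ x, (1 / (L ^ 2 * p x) * max (φ (g.F d x) - φ x) 0 ^ 2
        + 1 / (L ^ 2 * p (g.F d x)) * max (φ x - φ (g.F d x)) 0 ^ 2) := by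
    unfold Grid.gp
    simp only [Finset.sum_mul]
    rw [Finset.sum_comm]
    refine Finset.sum_congr rfl fun d _ => ?_
    have := g.adj d (fun s t => 1 / (L ^ 2 * p s) * max (φ t - φ s) 0 ^ 2) (fun s => by simp)
    rw [Finset.sum_add_distrib, ← this, ← Finset.sum_add_distrib]
    exact Finset.sum_congr rfl fun x _ => by ring
  rw [e, Finset.sum_comm, Finset.mul_sum]
  refine Finset.sum_le_sum fun x _ => ?_
  rw [Finset.mul_sum]
  refine Finset.sum_le_sum fun d _ => ?_
  have h1 := hf d x
  have h2 : 0 ≤ 1 / (L ^ 2 * p (g.F d x)) := by have := hp (g.F d x); positivity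
  set F := 1 / (L ^ 2 * p (g.F d x))
  set f := 1 / (L ^ 2 * p x)
  set s := φ (g.F d x)
  set t := φ x
  rcases le_total s t with hst | hst
  · rw [max_eq_right (by linarith), max_eq_left (by linarith)]
    have : 0 ≤ F * (s - t) ^ 2 := by positivity
    nlinarith
  · rw [max_eq_left (by linarith), max_eq_right (by linarith : t - s ≤ 0)]
    nlinarith [mul_le_mul_of_nonneg_right h1 (sq_nonneg (s - t))]

theorem core [DecidableEq V] (h : Dens g p a P κ) (hL : 0 < L) (hn : 0 < n) {N : ℕ} (hN : 0 < N)
    {ε ζ τ : ℝ} (hε : 0 < ε)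
    (hε1 : ε < 1) (hζ : 0 < ζ) (hτ : 0 < τ) (hs : 6 * κ ≤ ε * a * n) (hs2 : κ ≤ ε * a * L) :
    ∃ c : (Fin N → V) → ℝ, (∀ ω, Cpl g.z (emp ω) p (c ω)) ∧ Ex p N c ≤
      (1 + ε) ^ 2 * ((1 + ε) / (1 - ε) * ((1 + ε) * ((1 + ε) ^ 3 * (1 / N *
          (H + 6 * κ / a + 3 * P / (2 * a) + P * κ / a ^ 2 * (2 / τ + τ / 2 * (H + 3 / 2))))
          + (1 / (4 * ε) + 2 / ε ^ 2) / a ^ 3 * ((n ^ 4 / N ^ 3 + 3 * P * n ^ 2 / N ^ 2) * (2 * P * (H + 3 / 2))))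
        + (1 + 1 / ε) * ((1 / (2 * L)) * (1 / N * (2 * P * (H + 3 / 2))) + 2 / L)) + ζ)
        + (2 + ε) * (1 + 1 / ε) * (10 / n ^ 2) := by
  have ha := h.ha
  have hP := h.hP
  have hp := h.pos hL
  have hp0 : ∀ x, 0 ≤ p x := fun x => (hp x).le
  have hN' : (0 : ℝ) < N := by exact_mod_cast hN
  set φ : (Fin N → V) → V → ℝ := fun ω x => av p (g.G x) ω with hφ
  set C := (1 / (4 * ε) + 2 / ε ^ 2) / a ^ 3 with hC
  have hC0 : 0 ≤ C := by positivity
  set X1 : (Fin N → V) → ℝ := fun ω => ∑ x, ∑ d, 1 / (L ^ 2 * p (g.F d x)) * (φ ω (g.F d x) - φ ω x) ^ 2 with hX1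
  set X2 : (Fin N → V) → ℝ := fun ω => ∑ x, ∑ d, ((φ ω (g.F d x) - φ ω x) ^ 2 * (g.sm (emp ω) x - g.sm p x) ^ 2
    + (φ ω (g.B d x) - φ ω x) ^ 2 * (g.sm (emp ω) x - g.sm p x) ^ 2) with hX2
  set X3 : (Fin N → V) → ℝ := fun ω => ∑ x, ∑ d, ((φ ω (g.F d x) - φ ω x) ^ 2 + (φ ω (g.B d x) - φ ω x) ^ 2) with hX3
  have h1ε : 0 < 1 - ε := by linarith
  refine ⟨fun ω => (1 + ε) ^ 2 * ((1 + ε) / (1 - ε) * ((1 + ε) * ((1 + ε) ^ 3 * X1 ω + C * (L ^ 4 * X2 ω))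
        + (1 + 1 / ε) * ((1 / (2 * L)) * X3 ω + 2 / L)) + ζ)
        + (2 + ε) * (1 + 1 / ε) * (10 / n ^ 2), ?_, ?_⟩
  · intro ω
    refine (sample_Cpl h hL hn hε hε1 hζ hs (emp_nonneg ω) (emp_one hN ω) (φ := φ ω)
      (av_lap hN h.one ω)).mono ?_
    have b3 : ∑ x, g.gp (φ ω) x ≤ X3 ω := Finset.sum_le_sum fun x _ => gp_le g _ x
    have b1 := h.gp_main hL hε hs2 (φ ω)
    have b2 : ∑ x, g.gp (φ ω) x * (g.sm (emp ω) x - g.sm p x) ^ 2 ≤ X2 ω := by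
      refine Finset.sum_le_sum fun x _ => ?_
      refine (mul_le_mul_of_nonneg_right (gp_le g _ x) (sq_nonneg _)).trans (le_of_eq ?_)
      rw [Finset.sum_mul]
      exact Finset.sum_congr rfl fun d _ => by ring
    have b4 : ∑ x, g.gp (φ ω) x * ((1 + ε) ^ 2 * (1 / (L ^ 2 * p x)) + C * L ^ 4 * (g.sm (emp ω) x - g.sm p x) ^ 2)
        ≤ (1 + ε) ^ 3 * X1 ω + C * (L ^ 4 * X2 ω) := by
      have e : ∑ x, g.gp (φ ω) x * ((1 + ε) ^ 2 * (1 / (L ^ 2 * p x)) + C * L ^ 4 * (g.sm (emp ω) x - g.sm p x) ^ 2)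
        = (1 + ε) ^ 2 * ∑ x, g.gp (φ ω) x * (1 / (L ^ 2 * p x))
          + C * (L ^ 4 * ∑ x, g.gp (φ ω) x * (g.sm (emp ω) x - g.sm p x) ^ 2) := by
        simp only [Finset.mul_sum, ← Finset.sum_add_distrib]
        exact Finset.sum_congr rfl fun x _ => by ring
      rw [e]
      calc _ ≤ (1 + ε) ^ 2 * ((1 + ε) * X1 ω) + C * (L ^ 4 * X2 ω) := by gcongr
        _ = _ := by ring
    beta_reduce
    gcongr
  · -- expectations
    have hd : ∀ s x ω, φ ω s - φ ω x = av p (fun y => g.G s y - g.G x y) ω := fun s x ω => av_sub _ _ _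
    have E1 : Ex p N X1 ≤ 1 / N *
          (H + 6 * κ / a + 3 * P / (2 * a) + P * κ / a ^ 2 * (2 / τ + τ / 2 * (H + 3 / 2))) := by
      rw [hX1, Ex_sum]
      simp only [Ex_sum, Ex_mul, hd]
      calc _ ≤ ∑ x, ∑ d, 1 / (L ^ 2 * p (g.F d x)) * (1 / N * ∑ y, p y * (g.G (g.F d x) y - g.G x y) ^ 2) := by
            refine Finset.sum_le_sum fun x _ => Finset.sum_le_sum fun d _ => ?_
            refine mul_le_mul_of_nonneg_left (Ex_av hN h.one _) ?_
            have := hp (g.F d x)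
            positivity
        _ = 1 / N * ∑ y, p y * ∑ x, ∑ d, (1 / (L ^ 2 * p (g.F d x))) * (g.G (g.F d x) y - g.G x y) ^ 2 := by
            simp only [Finset.mul_sum]
            rw [Finset.sum_comm (s := (Finset.univ : Finset V)) (t := (Finset.univ : Finset V))]
            refine Finset.sum_congr rfl fun x _ => ?_
            rw [Finset.sum_comm]
            refine Finset.sum_congr rfl fun d _ => Finset.sum_congr rfl fun y _ => ?_
            ring
        _ ≤ _ := by
            have := h.Sw hL hn hτ
            gcongr
    have hT := h.T_le hL
    have E3 : Ex p N X3 ≤ 1 / N * (2 * P * (H + 3 / 2)) := by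
      rw [hX3, Ex_sum]
      simp only [Ex_sum, Ex_add, hd]
      calc _ ≤ ∑ x, ∑ d, (1 / N * ∑ y, p y * (g.G (g.F d x) y - g.G x y) ^ 2
              + 1 / N * ∑ y, p y * (g.G (g.B d x) y - g.G x y) ^ 2) :=
            Finset.sum_le_sum fun x _ => Finset.sum_le_sum fun d _ => add_le_add
              (Ex_av hN h.one _) (Ex_av hN h.one _)
        _ = 1 / N * ∑ x, ∑ d, (∑ y, p y * (g.G (g.F d x) y - g.G x y) ^ 2 + ∑ y, p y * (g.G (g.B d x) y - g.G x y) ^ 2) := by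
            rw [Finset.mul_sum]
            refine Finset.sum_congr rfl fun x _ => ?_
            rw [Finset.mul_sum]
            exact Finset.sum_congr rfl fun x _ => by rw [mul_add]
        _ ≤ _ := by gcongr
    have E2 : Ex p N X2 ≤ ((n ^ 2 / L ^ 2) ^ 2 / N ^ 3 + 3 * (n ^ 2 / L ^ 2 * (P / L ^ 2)) / N ^ 2) * (2 * P * (H + 3 / 2)) := by
      rw [hX2, Ex_sum]
      simp only [Ex_sum, Ex_add, hd, sm_emp hN]
      have hq : ∀ x (k : V → ℝ), Ex p N (fun ω => av p k ω ^ 2 * av p (fun y => g.K y x) ω ^ 2)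
          ≤ ((n ^ 2 / L ^ 2) ^ 2 / N ^ 3 + 3 * (n ^ 2 / L ^ 2 * (P / L ^ 2)) / N ^ 2) * ∑ y, p y * k y ^ 2 := by
        intro x k
        refine Ex_av4 hN hp0 h.one _ _ (fun y => ?_) ?_
        · apply sq_le_sq'
          · have h1 := g.K_nonneg y x
            have h2 : ∑ y', p y' * g.K y' x ≤ ∑ y', p y' * (n ^ 2 / L ^ 2) :=
              Finset.sum_le_sum fun y _ => mul_le_mul_of_nonneg_left (g.K_le _ _) (hp0 y)
            rw [← Finset.sum_mul, h.one, one_mul] at h2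
            simp only [cen]; linarith
          · have h1 := g.K_le y x
            have h2 : 0 ≤ ∑ y', p y' * g.K y' x :=
              Finset.sum_nonneg fun y _ => mul_nonneg (hp0 y) (g.K_nonneg _ _)
            simp only [cen]; linarith
        · calc ∑ y, p y * g.K y x ^ 2 ≤ ∑ y, (n ^ 2 / L ^ 2 * (P / L ^ 2)) * g.K y x := by
                refine Finset.sum_le_sum fun y _ => ?_
                have h1 := g.K_le y x
                have h2 := h.hi y
                have h3 := g.K_nonneg y x
                have h4 := hp0 y
                calc p y * g.K y x ^ 2 = g.K y x * p y * g.K y x := by ring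
                  _ ≤ _ := by gcongr
            _ = _ := by rw [← Finset.mul_sum, g.K_col, mul_one]
      set D := ((n ^ 2 / L ^ 2) ^ 2 / N ^ 3 + 3 * (n ^ 2 / L ^ 2 * (P / L ^ 2)) / N ^ 2)
      have hD : 0 ≤ D := by positivity
      calc _ ≤ ∑ x, ∑ d, (D * ∑ y, p y * (g.G (g.F d x) y - g.G x y) ^ 2
              + D * ∑ y, p y * (g.G (g.B d x) y - g.G x y) ^ 2) :=
            Finset.sum_le_sum fun x _ => Finset.sum_le_sum fun d _ => add_le_add (hq _ _) (hq _ _)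
        _ = D * ∑ x, ∑ d, (∑ y, p y * (g.G (g.F d x) y - g.G x y) ^ 2 + ∑ y, p y * (g.G (g.B d x) y - g.G x y) ^ 2) := by
            rw [Finset.mul_sum]
            refine Finset.sum_congr rfl fun x _ => ?_
            rw [Finset.mul_sum]
            exact Finset.sum_congr rfl fun x _ => by rw [mul_add]
        _ ≤ _ := by gcongr
    have E2' : L ^ 4 * Ex p N X2 ≤ (n ^ 4 / N ^ 3 + 3 * P * n ^ 2 / N ^ 2) * (2 * P * (H + 3 / 2)) := by
      have := mul_le_mul_of_nonneg_left E2 (by positivity : 0 ≤ L ^ 4)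
      refine this.trans (le_of_eq ?_)
      field_simp
    simp only [Ex_add, Ex_mul, Ex_const h.one]
    gcongr

end


/-! ### Part L: snapping to the grid -/

/-- index of the cell containing `t` -/
def sn (L : ℕ) (hL : 0 < L) (t : ℝ) : Fin L := ⟨min ⌊(L : ℝ) * t⌋₊ (L - 1), by omega⟩

lemma sn_meas (L : ℕ) (hL : 0 < L) : Measurable (sn L hL) := by
  have : sn L hL = (fun k : ℕ => (⟨min k (L - 1), by omega⟩ : Fin L)) ∘ (fun t : ℝ => ⌊(L : ℝ) * t⌋₊) := rfl
  rw [this]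
  exact measurable_from_nat.comp (Nat.measurable_floor.comp (measurable_const.mul measurable_id))

lemma sn_mem (L : ℕ) (hL : 0 < L) {t : ℝ} (h0 : 0 ≤ t) (h1 : t ≤ 1) :
    ((sn L hL t : ℕ) : ℝ) / L ≤ t ∧ t ≤ ((sn L hL t : ℕ) + 1 : ℝ) / L := by
  have hL' : (0 : ℝ) < L := by exact_mod_cast hL
  rw [div_le_iff₀ hL', le_div_iff₀ hL']
  have hf := Nat.floor_le (mul_nonneg hL'.le h0)
  have hg := Nat.lt_floor_add_one ((L : ℝ) * t)
  simp only [sn]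
  rcases le_total ⌊(L : ℝ) * t⌋₊ (L - 1) with h | h
  · rw [min_eq_left h]; constructor <;> linarith
  · rw [min_eq_right h]
    have h2 : ((L - 1 : ℕ) : ℝ) ≤ ⌊(L : ℝ) * t⌋₊ := by exact_mod_cast h
    have h3 : ((L - 1 : ℕ) : ℝ) + 1 = L := by
      rw [Nat.cast_sub (by omega)]; simp
    constructor
    · linarith
    · rw [h3]; nlinarith

lemma sn_eq (L : ℕ) (hL : 0 < L) {t : ℝ} (j : Fin L) (h0 : ((j : ℕ) : ℝ) / L ≤ t)
    (h1 : t < ((j : ℕ) + 1 : ℝ) / L) : sn L hL t = j := by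
  have hL' : (0 : ℝ) < L := by exact_mod_cast hL
  rw [div_le_iff₀ hL'] at h0
  rw [lt_div_iff₀ hL'] at h1
  have : ⌊(L : ℝ) * t⌋₊ = j := by
    rw [Nat.floor_eq_iff (le_trans (Nat.cast_nonneg _) (h0.trans (by rw [mul_comm])))]
    constructor <;> linarith
  ext
  simp only [sn, this]
  have := j.2
  omega

lemma vol_cell1 (L : ℕ) (hL : 0 < L) (j : Fin L) :
    volume {t : ℝ | t ∈ Set.Icc (0 : ℝ) 1 ∧ sn L hL t = j} = ENNReal.ofReal (1 / L) := by
  have hL' : (0 : ℝ) < L := by exact_mod_cast hL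
  have e : ((j : ℕ) + 1 : ℝ) / L - ((j : ℕ) : ℝ) / L = 1 / L := by ring
  apply le_antisymm
  · rw [← e, ← Real.volume_Icc]
    refine measure_mono ?_
    rintro t ⟨ht, rfl⟩
    exact sn_mem L hL ht.1 ht.2
  · rw [← e, ← Real.volume_Ico]
    refine measure_mono ?_
    rintro t ⟨h0, h1⟩
    have hj : ((j : ℕ) + 1 : ℝ) ≤ L := by exact_mod_cast j.2
    refine ⟨⟨le_trans (by positivity) h0, h1.le.trans ?_⟩, sn_eq L hL j h0 h1⟩
    rw [div_le_one hL']; exact hj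

/-- the snapping map on the plane -/
def sn2 (L : ℕ) (hL : 0 < L) (x : E2) : Fin L × Fin L := (sn L hL (x 0), sn L hL (x 1))

lemma sn2_meas (L : ℕ) (hL : 0 < L) : Measurable (sn2 L hL) := by
  refine Measurable.prodMk ((sn_meas L hL).comp ?_) ((sn_meas L hL).comp ?_)
  · fun_prop
  · fun_prop

lemma unitSq_meas : MeasurableSet unitSq := by
  have : unitSq = ⋂ i : Fin 2, (fun x : E2 => x i) ⁻¹' Set.Icc (0 : ℝ) 1 := by
    ext x; simp [unitSq]
  rw [this]
  refine MeasurableSet.iInter fun i => ?_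
  have : Measurable (fun x : E2 => x i) := by fun_prop
  exact this measurableSet_Icc

lemma vol_cell2 (L : ℕ) (hL : 0 < L) (c : Fin L × Fin L) :
    volume (sn2 L hL ⁻¹' {c} ∩ unitSq) = ENNReal.ofReal (1 / L ^ 2) := by
  have e : sn2 L hL ⁻¹' {c} ∩ unitSq = (WithLp.ofLp : E2 → Fin 2 → ℝ) ⁻¹' (Set.univ.pi fun i =>
      {t : ℝ | t ∈ Set.Icc (0 : ℝ) 1 ∧ sn L hL t = (if i = 0 then c.1 else c.2)}) := by
    ext x
    simp only [sn2, unitSq, Set.mem_inter_iff, Set.mem_preimage, Set.mem_singleton_iff, Prod.ext_iff,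
      Set.mem_setOf_eq, Set.mem_univ_pi, Fin.forall_fin_two]
    simp
    tauto
  have hm : MeasurableSet (Set.univ.pi fun i : Fin 2 =>
      {t : ℝ | t ∈ Set.Icc (0 : ℝ) 1 ∧ sn L hL t = (if i = 0 then c.1 else c.2)}) := by
    refine MeasurableSet.univ_pi fun i => ?_
    exact measurableSet_Icc.inter ((sn_meas L hL) (measurableSet_singleton _))
  rw [e, (PiLp.volume_preserving_ofLp (Fin 2)).measure_preimage hm.nullMeasurableSet, volume_pi,
    Measure.pi_pi]
  simp only [vol_cell1, Fin.prod_univ_two]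
  rw [← ENNReal.ofReal_mul (by positivity)]
  congr 1; ring

lemma sn2_dist (L : ℕ) (hL : 0 < L) {x : E2} (hx : x ∈ unitSq) : ‖x - z2 L (sn2 L hL x)‖ ≤ 1 / L := by
  have hL' : (0 : ℝ) < L := by exact_mod_cast hL
  have e : x - z2 L (sn2 L hL x) = !₂[x 0 - zg L (sn L hL (x 0)), x 1 - zg L (sn L hL (x 1))] := by
    ext i; fin_cases i <;> simp [z2, sn2]
  have k : ∀ i, (x i - zg L (sn L hL (x i))) ^ 2 ≤ (1 / (2 * L)) ^ 2 := by
    intro i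
    obtain ⟨h0, h1⟩ := sn_mem L hL (hx i).1 (hx i).2
    apply sq_le_sq'
    · have : zg L (sn L hL (x i)) = ((sn L hL (x i) : ℕ) : ℝ) / L + 1 / (2 * L) := by
        unfold zg; field_simp
      linarith
    · have : zg L (sn L hL (x i)) = ((sn L hL (x i) : ℕ) + 1 : ℝ) / L - 1 / (2 * L) := by
        unfold zg; field_simp; ring
      linarith
  refine le_of_sq_le_sq ?_ (by positivity)
  rw [e, norm_z2]
  have h2 : (1 / (2 * L : ℝ)) ^ 2 + (1 / (2 * L)) ^ 2 ≤ (1 / L) ^ 2 := by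
    have : (1 / (2 * L : ℝ)) = 1 / 2 * (1 / L) := by field_simp
    rw [this]; nlinarith [sq_nonneg (1 / L : ℝ)]
  linarith [k 0, k 1]

lemma z2_mem (L : ℕ) (c : Fin L × Fin L) : z2 L c ∈ unitSq := by
  intro i; fin_cases i
  · simpa [z2] using zg_mem L c.1
  · simpa [z2] using zg_mem L c.2

lemma zg_sep (L : ℕ) (hL : 0 < L) {i j : Fin L} (h : i ≠ j) : (1 / L : ℝ) ^ 2 ≤ (zg L i - zg L j) ^ 2 := by
  have hL' : (0 : ℝ) < L := by exact_mod_cast hL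
  have e : zg L i - zg L j = (1 / L) * (((i : ℕ) : ℝ) - (j : ℕ)) := by unfold zg; field_simp; ring
  rw [e, mul_pow]
  have h1 : (1 : ℝ) ≤ (((i : ℕ) : ℝ) - (j : ℕ)) ^ 2 := by
    have h2 : ((i : ℕ) : ℤ) - (j : ℕ) ≠ 0 := by
      intro h3; apply h; ext; omega
    have h3 : (1 : ℤ) ≤ (((i : ℕ) : ℤ) - (j : ℕ)) ^ 2 := by
      have := sq_pos_of_ne_zero h2
      linarith
    exact_mod_cast h3
  exact le_mul_of_one_le_right (by positivity) h1

lemma z2_sep (L : ℕ) (hL : 0 < L) {c d : Fin L × Fin L} (h : c ≠ d) : 1 / (L : ℝ) ≤ ‖z2 L c - z2 L d‖ := by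
  refine le_of_sq_le_sq ?_ (norm_nonneg _)
  rw [z2_sub, norm_z2]
  by_cases h1 : c.1 = d.1
  · have h2 : c.2 ≠ d.2 := fun h2 => h (Prod.ext h1 h2)
    nlinarith [zg_sep L hL h2, sq_nonneg (zg L c.1 - zg L d.1)]
  · nlinarith [zg_sep L hL h1, sq_nonneg (zg L c.2 - zg L d.2)]

section
variable {ρ : E2 → ℝ} {μ : Measure E2} [IsProbabilityMeasure μ] {L : ℕ} {hL : 0 < L}

/-- the discretised density -/
def pd (μ : Measure E2) (L : ℕ) (hL : 0 < L) (c : Fin L × Fin L) : ℝ := (μ (sn2 L hL ⁻¹' {c})).toReal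

lemma mu_cell (hμ : μ = (volume.restrict unitSq).withDensity fun x => ENNReal.ofReal (ρ x))
    (c : Fin L × Fin L) :
    μ (sn2 L hL ⁻¹' {c}) = ∫⁻ x in sn2 L hL ⁻¹' {c} ∩ unitSq, ENNReal.ofReal (ρ x) := by
  have hm : MeasurableSet (sn2 L hL ⁻¹' {c}) := sn2_meas L hL (measurableSet_singleton c)
  conv_lhs => rw [hμ]
  rw [withDensity_apply _ hm, Measure.restrict_restrict hm]

lemma pd_lo (hμ : μ = (volume.restrict unitSq).withDensity fun x => ENNReal.ofReal (ρ x))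
    (c : Fin L × Fin L) {l : ℝ} (h : ∀ x ∈ unitSq, sn2 L hL x = c → l ≤ ρ x) :
    l / L ^ 2 ≤ pd μ L hL c := by
  have hm : MeasurableSet (sn2 L hL ⁻¹' {c}) := sn2_meas L hL (measurableSet_singleton c)
  unfold pd
  rw [← ENNReal.ofReal_le_iff_le_toReal (measure_ne_top _ _), mu_cell hμ]
  calc ENNReal.ofReal (l / L ^ 2) ≤ ENNReal.ofReal l * volume (sn2 L hL ⁻¹' {c} ∩ unitSq) := by
        rw [vol_cell2]
        rcases le_total 0 l with h0 | h0
        · rw [← ENNReal.ofReal_mul h0]; apply le_of_eq; congr 1; ring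
        · rw [ENNReal.ofReal_of_nonpos (div_nonpos_of_nonpos_of_nonneg h0 (by positivity))]; simp
    _ = ∫⁻ x in sn2 L hL ⁻¹' {c} ∩ unitSq, ENNReal.ofReal l := by rw [setLIntegral_const]
    _ ≤ _ := setLIntegral_mono' (hm.inter unitSq_meas) fun x hx =>
        ENNReal.ofReal_le_ofReal (h x hx.2 hx.1)

lemma pd_hi (hμ : μ = (volume.restrict unitSq).withDensity fun x => ENNReal.ofReal (ρ x))
    (c : Fin L × Fin L) {l : ℝ} (hl : 0 ≤ l) (h : ∀ x ∈ unitSq, sn2 L hL x = c → ρ x ≤ l) :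
    pd μ L hL c ≤ l / L ^ 2 := by
  have hm : MeasurableSet (sn2 L hL ⁻¹' {c}) := sn2_meas L hL (measurableSet_singleton c)
  unfold pd
  refine ENNReal.toReal_le_of_le_ofReal (by positivity) ?_
  rw [mu_cell hμ]
  calc _ ≤ ∫⁻ x in sn2 L hL ⁻¹' {c} ∩ unitSq, ENNReal.ofReal l :=
        setLIntegral_mono' (hm.inter unitSq_meas) fun x hx =>
        ENNReal.ofReal_le_ofReal (h x hx.2 hx.1)
    _ = ENNReal.ofReal l * volume (sn2 L hL ⁻¹' {c} ∩ unitSq) := by rw [setLIntegral_const]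
    _ = _ := by
        rw [vol_cell2, ← ENNReal.ofReal_mul hl]; congr 1; ring

lemma pd_one : ∑ c, pd μ L hL c = 1 := by
  unfold pd
  rw [← ENNReal.toReal_sum fun _ _ => measure_ne_top _ _]
  have : ∑ c, μ (sn2 L hL ⁻¹' {c}) = μ Set.univ := by
    rw [sum_measure_preimage_singleton _ fun c _ => sn2_meas L hL (measurableSet_singleton c)]
    simp
  rw [this]; simp

lemma pd_Dens {n H : ℝ} {g : Grid (Fin L × Fin L) L n H} (hg : g.z = z2 L) {a P K : ℝ} (ha : 0 < a)
    (hK : 0 ≤ K)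
    (hμ : μ = (volume.restrict unitSq).withDensity fun x => ENNReal.ofReal (ρ x))
    (hlo : ∀ x ∈ unitSq, a ≤ ρ x) (hhi : ∀ x ∈ unitSq, ρ x ≤ P) (hP : 0 < P)
    (hlip : ∀ x ∈ unitSq, ∀ y ∈ unitSq, |ρ x - ρ y| ≤ K * ‖x - y‖) :
    Dens g (pd μ L hL) a P (3 * K) where
  ha := ha
  hP := hP
  hκ := by positivity
  lo c := pd_lo hμ c fun x hx _ => hlo x hx
  hi c := pd_hi hμ c hP.le fun x hx _ => hhi x hx
  one := pd_one
  lip c d := by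
    have hL' : (0 : ℝ) < L := by exact_mod_cast hL
    rw [hg]
    by_cases hcd : c = d
    · subst hcd; simp
    have hsep := z2_sep L hL hcd
    have key : ∀ c, |pd μ L hL c - ρ (z2 L c) / L ^ 2| ≤ K * (1 / L) / L ^ 2 := by
      intro c
      have hb : ∀ x ∈ unitSq, sn2 L hL x = c → |ρ x - ρ (z2 L c)| ≤ K * (1 / L) := by
        intro x hx hc
        refine (hlip x hx _ (z2_mem L c)).trans ?_
        have := sn2_dist L hL hx
        rw [hc] at this
        gcongr
      have h1 := pd_lo (L := L) (hL := hL) hμ c (l := ρ (z2 L c) - K * (1 / L)) fun x hx hc => by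
        have := abs_le.1 (hb x hx hc); linarith
      have h2 := pd_hi (L := L) (hL := hL) hμ c (l := ρ (z2 L c) + K * (1 / L))
        (by
          have h3 := hlo _ (z2_mem L c)
          have h4 : 0 ≤ K * (1 / (L : ℝ)) := by positivity
          linarith) fun x hx hc => by
        have := abs_le.1 (hb x hx hc); linarith
      rw [sub_div] at h1
      rw [add_div] at h2
      rw [abs_le]; constructor <;> linarith
    have h1 := abs_le.1 (key c)
    have h2 := abs_le.1 (key d)
    have h3 : |ρ (z2 L c) / L ^ 2 - ρ (z2 L d) / L ^ 2| ≤ K * ‖z2 L c - z2 L d‖ / L ^ 2 := by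
      rw [← sub_div, abs_div, abs_of_pos (by positivity : (0 : ℝ) < L ^ 2)]
      gcongr
      exact hlip _ (z2_mem L c) _ (z2_mem L d)
    have h3 := abs_le.1 h3
    have h4 : K * (1 / L) / L ^ 2 ≤ K * ‖z2 L c - z2 L d‖ / L ^ 2 := by gcongr
    have h5 : 3 * K / L ^ 2 * ‖z2 L c - z2 L d‖ = 3 * (K * ‖z2 L c - z2 L d‖ / L ^ 2) := by ring
    rw [h5, abs_le]; constructor <;> linarith

lemma int_Ex (N : ℕ) (f : (Fin N → Fin L × Fin L) → ℝ) :
    Integrable (fun x : Fin N → E2 => f (fun i => sn2 L hL (x i))) (Measure.pi fun _ => μ) ∧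
    ∫ x : Fin N → E2, f (fun i => sn2 L hL (x i)) ∂(Measure.pi fun _ => μ) = Ex (pd μ L hL) N f := by
  have hs := sn2_meas L hL
  have hm : Measurable (fun (x : Fin N → E2) (i : Fin N) => sn2 L hL (x i)) :=
    measurable_pi_lambda _ fun i => hs.comp (measurable_pi_apply i)
  haveI : IsProbabilityMeasure (Measure.map (sn2 L hL) μ) := Measure.isProbabilityMeasure_map hs.aemeasurable
  have hmap : Measure.map (fun (x : Fin N → E2) (i : Fin N) => sn2 L hL (x i)) (Measure.pi fun _ => μ)
      = Measure.pi fun _ => Measure.map (sn2 L hL) μ :=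
    Measure.pi_map_pi (μ := fun _ : Fin N => μ) (f := fun _ => sn2 L hL) fun _ => hs.aemeasurable
  have hf : Measurable f := measurable_of_finite f
  have hi : Integrable f (Measure.pi fun _ : Fin N => Measure.map (sn2 L hL) μ) := Integrable.of_finite
  constructor
  · rw [← hmap] at hi
    exact hi.comp_measurable hm
  · rw [← integral_map hm.aemeasurable hf.aestronglyMeasurable, hmap, integral_fintype hi]
    unfold Ex
    refine Finset.sum_congr rfl fun ω _ => ?_
    rw [smul_eq_mul]
    congr 1
    rw [Measure.real, Measure.pi_singleton, ENNReal.toReal_prod]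
    refine Finset.prod_congr rfl fun i _ => ?_
    rw [Measure.map_apply hs (measurableSet_singleton _)]; rfl

lemma emp_cell {N : ℕ} (x : Fin N → E2) (c : Fin L × Fin L) :
    (empMeas x (sn2 L hL ⁻¹' {c})).toReal = emp (fun i => sn2 L hL (x i)) c := by
  have hm : MeasurableSet (sn2 L hL ⁻¹' {c}) := sn2_meas L hL (measurableSet_singleton c)
  simp only [empMeas, emp, Measure.smul_apply, Measure.finsetSum_apply, smul_eq_mul,
    ENNReal.toReal_mul, ENNReal.toReal_inv, ENNReal.toReal_natCast, one_div]
  congr 1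
  rw [ENNReal.toReal_sum fun _ _ => measure_ne_top _ _]
  refine Finset.sum_congr rfl fun i _ => ?_
  rw [Measure.dirac_apply' _ hm]
  by_cases h : sn2 L hL (x i) = c <;> simp [h]

lemma empMeas_prob {N : ℕ} (hN : 0 < N) (x : Fin N → E2) : IsProbabilityMeasure (empMeas x) := by
  constructor
  simp only [empMeas, Measure.smul_apply, Measure.finsetSum_apply, smul_eq_mul, measure_univ]
  simp
  exact ENNReal.inv_mul_cancel (by exact_mod_cast hN.ne') (by simp)

lemma W2sq_nonneg (ν₁ ν₂ : Measure E2) : 0 ≤ W2sq ν₁ ν₂ := by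
  apply Real.sInf_nonneg
  rintro c ⟨J, _, _, _, rfl⟩
  exact integral_nonneg fun p => by positivity

/-- the main reduction -/
lemma E_le {N : ℕ} (hN : 0 < N) {ε : ℝ} (hε : 0 < ε)
    (hμ : μ = (volume.restrict unitSq).withDensity fun x => ENNReal.ofReal (ρ x))
    (c : (Fin N → Fin L × Fin L) → ℝ) (hc : ∀ ω, Cpl (z2 L) (emp ω) (pd μ L hL) (c ω)) :
    ∫ x : Fin N → E2, W2sq (empMeas x) μ ∂(Measure.pi fun _ => μ)
      ≤ (1 + ε) * Ex (pd μ L hL) N c + (1 + 1 / ε) * (4 * (1 / L) ^ 2) := by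
  obtain ⟨hi, he⟩ := int_Ex (μ := μ) (hL := hL) N c
  have hQ : ∀ᵐ x ∂μ, x ∈ unitSq := by
    have h1 : ∀ᵐ x ∂(volume.restrict unitSq), x ∈ unitSq := ae_restrict_mem unitSq_meas
    have h2 : μ ≪ volume.restrict unitSq := by rw [hμ]; exact withDensity_absolutelyContinuous _ _
    exact h2.ae_le h1
  have hQN : ∀ᵐ x ∂(Measure.pi fun _ : Fin N => μ), ∀ i, x i ∈ unitSq := by
    rw [ae_all_iff]
    intro i
    exact (measurePreserving_eval (fun _ : Fin N => μ) i).quasiMeasurePreserving.ae hQ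
  calc _ ≤ ∫ x : Fin N → E2, ((1 + ε) * c (fun i => sn2 L hL (x i)) + (1 + 1 / ε) * (4 * (1 / L) ^ 2))
          ∂(Measure.pi fun _ => μ) := by
        refine integral_mono_of_nonneg (ae_of_all _ fun x => W2sq_nonneg _ _)
          ((hi.const_mul _).add (integrable_const _)) ?_
        filter_upwards [hQN] with x hx
        haveI := empMeas_prob hN x
        refine W2sq_le_of_Cpl (sn2 L hL) (sn2_meas L hL) (z2 L) (empMeas x) μ hε ?_ ?_ ?_
        · have : ∀ᵐ y ∂(empMeas x), y ∈ unitSq := by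
            rw [ae_iff]
            have hm : MeasurableSet {y | y ∉ unitSq} := unitSq_meas.compl
            simp only [empMeas, Measure.smul_apply, Measure.finsetSum_apply, smul_eq_mul]
            rw [Finset.sum_eq_zero, mul_zero]
            intro i _
            rw [Measure.dirac_apply' _ hm]
            simp [hx i]
          filter_upwards [this] with y hy using sn2_dist L hL hy
        · filter_upwards [hQ] with y hy using sn2_dist L hL hy
        · simp only [emp_cell]
          exact hc _
    _ = _ := by
        rw [integral_add (hi.const_mul _) (integrable_const _), integral_const_mul, he]
        simp

end


/-! ### Part M: the limit -/

/-- normalised bound -/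
def RR (ε τ a P κ h u w v q : ℝ) : ℝ :=
  4 * Real.pi * ((1 + ε) * ((1 + ε) ^ 2 * ((1 + ε) / (1 - ε) * ((1 + ε) * ((1 + ε) ^ 3 *
          (h + 6 * κ / a * u + 3 * P / (2 * a) * u + P * κ / a ^ 2 * (2 / τ * u + τ / 2 * (h + 3 / 2 * u)))
          + (1 / (4 * ε) + 2 / ε ^ 2) / a ^ 3 * ((w ^ 2 + 3 * P * w) * (2 * P * (h + 3 / 2 * u))))
        + (1 + 1 / ε) * ((1 / 2 * q) * (2 * P * (h + 3 / 2 * u)) + 2 * u)) + u)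
        + (2 + ε) * (1 + 1 / ε) * (10 * v)) + (1 + 1 / ε) * (4 * u * q))

lemma RR_eq {ε τ a P κ H n N ℓ : ℝ} (hn : 0 < n) (hN : 0 < N) (hℓ : 0 < ℓ) :
    4 * Real.pi * N / ℓ * ((1 + ε) * ((1 + ε) ^ 2 * ((1 + ε) / (1 - ε) * ((1 + ε) * ((1 + ε) ^ 3 * (1 / N *
          (H + 6 * κ / a + 3 * P / (2 * a) + P * κ / a ^ 2 * (2 / τ + τ / 2 * (H + 3 / 2))))
          + (1 / (4 * ε) + 2 / ε ^ 2) / a ^ 3 * ((n ^ 4 / N ^ 3 + 3 * P * n ^ 2 / N ^ 2) * (2 * P * (H + 3 / 2))))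
        + (1 + 1 / ε) * ((1 / (2 * N)) * (1 / N * (2 * P * (H + 3 / 2))) + 2 / N)) + 1 / N)
        + (2 + ε) * (1 + 1 / ε) * (10 / n ^ 2)) + (1 + 1 / ε) * (4 * (1 / N) ^ 2))
      = RR ε τ a P κ (H / ℓ) (1 / ℓ) (n ^ 2 / N) (N / (ℓ * n ^ 2)) (1 / N) := by
  unfold RR
  generalize (1 + ε) / (1 - ε) = D
  generalize (1 / (4 * ε) + 2 / ε ^ 2) / a ^ 3 = C
  generalize 1 / ε = i
  generalize 6 * κ / a = c0
  generalize 3 * P / (2 * a) = c1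
  generalize P * κ / a ^ 2 = c2
  generalize 2 / τ = t
  have e1 : 4 * Real.pi * N / ℓ = 4 * Real.pi * (N * (1 / ℓ)) := by ring
  rw [e1, mul_assoc (4 * Real.pi)]
  congr 1
  have k1 : N * (1 / ℓ) * (1 / N * (H + c0 + c1 + c2 * (t + τ / 2 * (H + 3 / 2))))
      = H / ℓ + c0 * (1 / ℓ) + c1 * (1 / ℓ) + c2 * (t * (1 / ℓ) + τ / 2 * (H / ℓ + 3 / 2 * (1 / ℓ))) := by
    field_simp
  have k2 : N * (1 / ℓ) * ((n ^ 4 / N ^ 3 + 3 * P * n ^ 2 / N ^ 2) * (2 * P * (H + 3 / 2)))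
      = ((n ^ 2 / N) ^ 2 + 3 * P * (n ^ 2 / N)) * (2 * P * (H / ℓ + 3 / 2 * (1 / ℓ))) := by
    field_simp
  have k3 : N * (1 / ℓ) * ((1 / (2 * N)) * (1 / N * (2 * P * (H + 3 / 2))) + 2 / N)
      = (1 / 2 * (1 / N)) * (2 * P * (H / ℓ + 3 / 2 * (1 / ℓ))) + 2 * (1 / ℓ) := by
    field_simp
  have k4 : N * (1 / ℓ) * (1 / N) = 1 / ℓ := by field_simp
  have k5 : N * (1 / ℓ) * (10 / n ^ 2) = 10 * (N / (ℓ * n ^ 2)) := by field_simp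
  have k6 : N * (1 / ℓ) * (4 * (1 / N) ^ 2) = 4 * (1 / ℓ) * (1 / N) := by field_simp
  have expand : ∀ M A B E z T S : ℝ,
      M * ((1 + ε) * ((1 + ε) ^ 2 * (D * ((1 + ε) * ((1 + ε) ^ 3 * A + C * B) + (1 + i) * E) + z)
        + (2 + ε) * (1 + i) * T) + (1 + i) * S)
      = (1 + ε) * ((1 + ε) ^ 2 * (D * ((1 + ε) * ((1 + ε) ^ 3 * (M * A) + C * (M * B)) + (1 + i) * (M * E)) + M * z)
        + (2 + ε) * (1 + i) * (M * T)) + (1 + i) * (M * S) := by intros; ring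
  rw [expand, k1, k2, k3, k4, k5, k6]

lemma RR_mono {ε τ a P κ h h' u w w' v v' q : ℝ} (hε : 0 < ε) (hε1 : ε < 1) (hτ : 0 < τ) (ha : 0 < a)
    (hP : 0 < P) (hκ : 0 ≤ κ) (hh : 0 ≤ h) (hu : 0 ≤ u) (hw : 0 ≤ w) (hq : 0 ≤ q)
    (h1 : h ≤ h') (h2 : w ≤ w') (h3 : v ≤ v') : RR ε τ a P κ h u w v q ≤ RR ε τ a P κ h' u w' v' q := by
  unfold RR
  have : 0 < 1 - ε := by linarith
  have := Real.pi_pos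
  have hh' := hh.trans h1
  have hw' := hw.trans h2
  gcongr

lemma RR_zero {ε τ a P κ h : ℝ} :
    RR ε τ a P κ h 0 0 0 0 = 4 * Real.pi * ((1 + ε) ^ 7 * ((1 + ε) / (1 - ε)) * (h + P * κ / a ^ 2 * (τ / 2 * h))) := by
  unfold RR
  ring

/-- The bound for fixed `N`. -/
lemma bound_N {ρ : E2 → ℝ} {μ : Measure E2} [IsProbabilityMeasure μ] {a P K : ℝ} (ha : 0 < a)
    (hK : 0 ≤ K)
    (hμ : μ = (volume.restrict unitSq).withDensity fun x => ENNReal.ofReal (ρ x))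
    (hlo : ∀ x ∈ unitSq, a ≤ ρ x) (hhi : ∀ x ∈ unitSq, ρ x ≤ P) (hP : 0 < P)
    (hlip : ∀ x ∈ unitSq, ∀ y ∈ unitSq, |ρ x - ρ y| ≤ K * ‖x - y‖)
    {N n : ℕ} (hn2 : 2 ≤ n) (hn : n ≤ N) (hθ : 0 < 1 - 2 * (n : ℝ) ^ 2 / N ^ 2) {ε τ : ℝ} (hε : 0 < ε)
    (hε1 : ε < 1) (hτ : 0 < τ) (hs : 6 * (3 * K) ≤ ε * a * n) (hs2 : 3 * K ≤ ε * a * N) :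
    (4 * Real.pi * N / Real.log N) *
          ∫ x : Fin N → E2, W2sq (empMeas x) μ ∂(Measure.pi fun _ => μ)
      ≤ RR ε τ a P (3 * K)
          (1 / (Real.pi ^ 2 * (1 - 2 * (n : ℝ) ^ 2 / N ^ 2)) * (Real.pi / 2 * Real.log n + 6) / Real.log N)
          (1 / Real.log N) ((n : ℝ) ^ 2 / N) (N / (Real.log N * (n : ℝ) ^ 2)) (1 / N) := by
  have hN : 0 < N := by omega
  have hN' : (0 : ℝ) < N := by exact_mod_cast hN
  have hn' : (0 : ℝ) < n := by exact_mod_cast (by omega : 0 < n)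
  have hℓ : 0 < Real.log N := Real.log_pos (by exact_mod_cast (by omega : 1 < N))
  have hD := pd_Dens (μ := μ) (L := N) (hL := hN) (g := mkGrid N n hn2 hn hθ) rfl ha hK hμ hlo hhi hP hlip
  obtain ⟨c, hc, hE⟩ := core hD hN' hn' hN hε hε1 (ζ := 1 / N) (by positivity) hτ hs hs2
  rw [← RR_eq hn' hN' hℓ]
  refine mul_le_mul_of_nonneg_left ?_ (by positivity)
  refine (E_le hN hε hμ c hc).trans ?_
  gcongr



/-- the mesoscopic frequency cutoff -/
def nn (N : ℕ) : ℕ := ⌊√((N : ℝ) * (1 / √(Real.log N)))⌋₊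

lemma log_tend : Tendsto (fun N : ℕ => Real.log N) atTop atTop :=
  Real.tendsto_log_atTop.comp tendsto_natCast_atTop_atTop

lemma u_tend : Tendsto (fun N : ℕ => 1 / Real.log N) atTop (𝓝 0) := by
  simp only [one_div]
  exact log_tend.inv_tendsto_atTop

lemma s_tend : Tendsto (fun N : ℕ => 1 / √(Real.log N)) atTop (𝓝 0) := by
  simp only [one_div]
  exact (Real.tendsto_sqrt_atTop.comp log_tend).inv_tendsto_atTop

lemma q_tend : Tendsto (fun N : ℕ => 1 / (N : ℝ)) atTop (𝓝 0) :=
  tendsto_one_div_atTop_nhds_zero_nat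

lemma x_tend : Tendsto (fun N : ℕ => √((N : ℝ) * (1 / √(Real.log N)))) atTop atTop := by
  refine Real.tendsto_sqrt_atTop.comp ?_
  refine tendsto_atTop_mono' _ ?_ (Real.tendsto_sqrt_atTop.comp tendsto_natCast_atTop_atTop)
  filter_upwards [log_tend.eventually_ge_atTop 1, eventually_gt_atTop 0] with N h1 h2
  have hN' : (0 : ℝ) < N := by exact_mod_cast h2
  have h3 : Real.log N ≤ N := (Real.log_le_sub_one_of_pos hN').trans (by linarith)
  have h4 : 0 < √(Real.log N) := Real.sqrt_pos.2 (by linarith)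
  have h5 := Real.sqrt_le_sqrt h3
  simp only [Function.comp]
  rw [mul_one_div, le_div_iff₀ h4]
  calc √(N : ℝ) * √(Real.log N) ≤ √N * √N := by gcongr
    _ = N := Real.mul_self_sqrt hN'.le

lemma nn_tend : Tendsto nn atTop atTop := tendsto_nat_floor_atTop.comp x_tend

lemma nn_facts : ∀ᶠ N : ℕ in atTop, 2 ≤ nn N ∧ nn N ≤ N ∧ 0 < 1 - 2 / (N : ℝ) ∧
    1 - 2 / (N : ℝ) ≤ 1 - 2 * (nn N : ℝ) ^ 2 / N ^ 2 ∧
    1 / (Real.pi ^ 2 * (1 - 2 * (nn N : ℝ) ^ 2 / N ^ 2)) * (Real.pi / 2 * Real.log (nn N) + 6) / Real.log N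
      ≤ 1 / (Real.pi ^ 2 * (1 - 2 * (1 / N))) * (Real.pi / 4 + 6 * (1 / Real.log N)) ∧
    (nn N : ℝ) ^ 2 / N ≤ 1 / √(Real.log N) ∧
    N / (Real.log N * (nn N : ℝ) ^ 2) ≤ 4 * (1 / √(Real.log N)) ∧ 0 < Real.log N := by
  filter_upwards [log_tend.eventually_ge_atTop 1, eventually_gt_atTop 2, nn_tend.eventually_ge_atTop 2,
    x_tend.eventually_ge_atTop 2] with N hℓ hN hn hx
  have hN' : (2 : ℝ) < N := by exact_mod_cast hN
  have hn' : (2 : ℝ) ≤ nn N := by exact_mod_cast hn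
  have hs0 : 1 ≤ √(Real.log N) := by rw [← Real.sqrt_one]; exact Real.sqrt_le_sqrt hℓ
  have hss : √(Real.log N) * √(Real.log N) = Real.log N := Real.mul_self_sqrt (by linarith)
  set r := √(Real.log N) with hr
  have hs1 : 1 / r ≤ 1 := by rw [div_le_one (by linarith)]; exact hs0
  have hs2 : 0 < 1 / r := by positivity
  set x := √((N : ℝ) * (1 / r)) with hxdef
  have hxx : x ^ 2 = N * (1 / r) := Real.sq_sqrt (by positivity)
  have h1 : (nn N : ℝ) ≤ x := Nat.floor_le (by positivity)
  have h2 : x < nn N + 1 := Nat.lt_floor_add_one x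
  have h3 : (nn N : ℝ) ^ 2 ≤ N * (1 / r) := by rw [← hxx]; gcongr
  have h4 : (nn N : ℝ) ^ 2 ≤ N := h3.trans (mul_le_of_le_one_right (by linarith) hs1)
  have h5 : N * (1 / r) / 4 ≤ (nn N : ℝ) ^ 2 := by rw [← hxx]; nlinarith
  have h6 : (nn N : ℝ) ≤ N := by nlinarith
  have h7 : 0 < 1 - 2 / (N : ℝ) := by
    rw [sub_pos, div_lt_one (by linarith)]; exact hN'
  have h8 : 1 - 2 / (N : ℝ) ≤ 1 - 2 * (nn N : ℝ) ^ 2 / N ^ 2 := by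
    have : 2 * (nn N : ℝ) ^ 2 / N ^ 2 ≤ 2 / N := by
      rw [div_le_div_iff₀ (by positivity) (by positivity)]; nlinarith
    linarith
  refine ⟨hn, by exact_mod_cast h6, h7, h8, ?_, ?_, ?_, by linarith⟩
  · have hlog : Real.log (nn N) ≤ Real.log N / 2 := by
      have := Real.log_le_log (by positivity) h4
      rw [Real.log_pow] at this
      push_cast at this; linarith
    have hpi := Real.pi_pos
    calc _ ≤ 1 / (Real.pi ^ 2 * (1 - 2 / (N : ℝ))) * (Real.pi / 2 * (Real.log N / 2) + 6) / Real.log N := by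
          have hl0 : 0 ≤ Real.log (nn N) := Real.log_nonneg (by linarith)
          gcongr
      _ = _ := by
          have : Real.log N ≠ 0 := by linarith
          have e : (1 : ℝ) - 2 * (1 / N) = 1 - 2 / N := by ring
          rw [e]
          generalize 1 / (Real.pi ^ 2 * (1 - 2 / (N : ℝ))) = y
          field_simp
          ring
  · rw [div_le_iff₀ (by linarith)]; linarith
  · rw [div_le_iff₀ (by positivity), ← hss]
    have : 4 * (1 / r) * (r * r * (N * (1 / r) / 4)) = N := by field_simp
    calc (N : ℝ) = 4 * (1 / r) * (r * r * (N * (1 / r) / 4)) := this.symm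
      _ ≤ _ := by gcongr

lemma hb_tend : Tendsto (fun N : ℕ => 1 / (Real.pi ^ 2 * (1 - 2 * (1 / (N : ℝ)))) *
    (Real.pi / 4 + 6 * (1 / Real.log N))) atTop (𝓝 (1 / (4 * Real.pi))) := by
  have hpi := Real.pi_pos
  have h1 : Tendsto (fun N : ℕ => Real.pi ^ 2 * (1 - 2 * (1 / (N : ℝ)))) atTop
      (𝓝 (Real.pi ^ 2 * (1 - 2 * 0))) := (tendsto_const_nhds.sub (q_tend.const_mul 2)).const_mul _
  have h2 : Tendsto (fun N : ℕ => Real.pi / 4 + 6 * (1 / Real.log N)) atTop (𝓝 (Real.pi / 4 + 6 * 0)) :=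
    tendsto_const_nhds.add (u_tend.const_mul 6)
  have h3 := (tendsto_const_nhds (x := (1 : ℝ))).div h1 (by simp [hpi.ne']) |>.mul h2
  have e : 1 / (Real.pi ^ 2 * (1 - 2 * 0)) * (Real.pi / 4 + 6 * 0) = 1 / (4 * Real.pi) := by
    field_simp; ring
  rw [e] at h3
  exact h3

lemma RR_cont (ε τ a P κ : ℝ) :
    Continuous (fun y : ℝ × ℝ × ℝ × ℝ × ℝ => RR ε τ a P κ y.1 y.2.1 y.2.2.1 y.2.2.2.1 y.2.2.2.2) := by
  unfold RR
  generalize (1 + ε) / (1 - ε) = D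
  generalize (1 / (4 * ε) + 2 / ε ^ 2) / a ^ 3 = C
  generalize 1 / ε = i
  generalize 6 * κ / a = c0
  generalize 3 * P / (2 * a) = c1
  generalize P * κ / a ^ 2 = c2
  generalize 2 / τ = t
  fun_prop

lemma tend5 {R : ℝ → ℝ → ℝ → ℝ → ℝ → ℝ}
    (hc : Continuous (fun y : ℝ × ℝ × ℝ × ℝ × ℝ => R y.1 y.2.1 y.2.2.1 y.2.2.2.1 y.2.2.2.2))
    {f1 f2 f3 f4 f5 : ℕ → ℝ} {h u w v q : ℝ}
    (h1 : Tendsto f1 atTop (𝓝 h)) (h2 : Tendsto f2 atTop (𝓝 u)) (h3 : Tendsto f3 atTop (𝓝 w))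
    (h4 : Tendsto f4 atTop (𝓝 v)) (h5 : Tendsto f5 atTop (𝓝 q)) :
    Tendsto (fun N : ℕ => R (f1 N) (f2 N) (f3 N) (f4 N) (f5 N)) atTop (𝓝 (R h u w v q)) := by
  have ht := h1.prodMk_nhds (h2.prodMk_nhds (h3.prodMk_nhds (h4.prodMk_nhds h5)))
  exact (hc.tendsto (h, u, w, v, q)).comp ht

lemma RR_tend (ε τ a P κ : ℝ) :
    Tendsto (fun N : ℕ => RR ε τ a P κ
      (1 / (Real.pi ^ 2 * (1 - 2 * (1 / (N : ℝ)))) * (Real.pi / 4 + 6 * (1 / Real.log N)))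
      (1 / Real.log N) (1 / √(Real.log N)) (4 * (1 / √(Real.log N))) (1 / N)) atTop
      (𝓝 (RR ε τ a P κ (1 / (4 * Real.pi)) 0 0 0 0)) := by
  have h4 : Tendsto (fun N : ℕ => 4 * (1 / √(Real.log N))) atTop (𝓝 0) := by
    simpa using s_tend.const_mul 4
  exact tend5 (R := RR ε τ a P κ) (RR_cont ε τ a P κ) hb_tend u_tend s_tend h4 q_tend

lemma eps_exists {η : ℝ} (hη : 0 < η) : ∃ ε : ℝ, 0 < ε ∧ ε < 1 ∧ (1 + ε) ^ 9 / (1 - ε) < 1 + η := by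
  have hc : ContinuousAt (fun ε : ℝ => (1 + ε) ^ 9 / (1 - ε)) 0 := by
    refine ContinuousAt.div (by fun_prop) (by fun_prop) (by norm_num)
  have h1 : ∀ᶠ ε : ℝ in 𝓝 0, (1 + ε) ^ 9 / (1 - ε) < 1 + η :=
    hc.eventually_lt_const (by simpa using hη)
  have h2 : ∀ᶠ ε : ℝ in 𝓝[>] 0, (1 + ε) ^ 9 / (1 - ε) < 1 + η := h1.filter_mono nhdsWithin_le_nhds
  have h3 : ∀ᶠ ε : ℝ in 𝓝[>] 0, ε ∈ Set.Ioo (0 : ℝ) 1 := Ioo_mem_nhdsGT one_pos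
  obtain ⟨ε, h4, h5⟩ := (h2.and h3).exists
  exact ⟨ε, h5.1, h5.2, h4⟩



/-- limsup_{N→∞} (4πN / log N) · E_μ[W₂²(X^N, μ)] ≤ 1, where `X^N` is the
empirical measure of `N` points sampled from the measure `μ` with Lipschitz,
strictly positive density `ρ` on the unit square. -/
theorem empirical_to_density_wasserstein_upper_bound
    (ρ : E2 → ℝ) (a : ℝ) (ha : 0 < a)
    (hlip : ∃ K : ℝ≥0, LipschitzOnWith K ρ unitSq)
    (hpos : ∀ x ∈ unitSq, a ≤ ρ x)
    (hint : ∫ x in unitSq, ρ x = 1)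
    (μ : Measure E2)
    (hμ : μ = (volume.restrict unitSq).withDensity fun x => ENNReal.ofReal (ρ x))
    (hprob : IsProbabilityMeasure μ) :
    limsup (fun N : ℕ =>
        (4 * Real.pi * N / Real.log N) *
          ∫ x : Fin N → E2, W2sq (empMeas x) μ ∂(Measure.pi fun _ => μ))
      atTop ≤ 1 := by
  obtain ⟨K, hK⟩ := hlip
  have hpi := Real.pi_pos
  have hl : ∀ x ∈ unitSq, ∀ y ∈ unitSq, |ρ x - ρ y| ≤ (K : ℝ) * ‖x - y‖ := by
    intro x hx y hy
    have := hK.dist_le_mul x hx y hy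
    rwa [Real.dist_eq, dist_eq_norm] at this
  have hK0 : (0 : ℝ) ≤ K := K.2
  have h0 : (0 : E2) ∈ unitSq := fun i => by simp
  obtain ⟨P, hP, hhi⟩ : ∃ P : ℝ, 0 < P ∧ ∀ x ∈ unitSq, ρ x ≤ P := by
    refine ⟨ρ 0 + K * 2, by
      have h1 := hpos 0 h0
      linarith, fun x hx => ?_⟩
    have h1 := (abs_le.1 (hl x hx 0 h0)).2
    have h2 : ‖x - 0‖ ≤ 2 := by
      refine le_of_sq_le_sq ?_ (by norm_num)
      rw [sub_zero, EuclideanSpace.norm_sq_eq, Fin.sum_univ_two]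
      have k : ∀ i, ‖x i‖ ^ 2 ≤ 1 := fun i => by
        have := hx i
        rw [Real.norm_eq_abs, sq_abs]; nlinarith [this.1, this.2]
      linarith [k 0, k 1]
    have h3 : (K : ℝ) * ‖x - 0‖ ≤ K * 2 := by gcongr
    linarith
  apply le_of_forall_pos_le_add
  intro η hη
  obtain ⟨ε, hε, hε1, hεη⟩ := eps_exists hη
  have hc1 : 0 ≤ P * (3 * (K : ℝ)) / a ^ 2 := by positivity
  set c1 := P * (3 * (K : ℝ)) / a ^ 2 with hc1d
  set τ := 2 * ε / (c1 + 1) with hτd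
  have hτ : 0 < τ := by positivity
  have hlim : RR ε τ a P (3 * K) (1 / (4 * Real.pi)) 0 0 0 0 < 1 + η := by
    rw [RR_zero, ← hc1d]
    have h1 : c1 * (τ / 2) ≤ ε := by
      rw [hτd]
      have : c1 * (2 * ε / (c1 + 1) / 2) = ε * (c1 / (c1 + 1)) := by field_simp
      rw [this]
      exact mul_le_of_le_one_right hε.le (by rw [div_le_one (by positivity)]; linarith)
    have h1ε : 0 < 1 - ε := by linarith
    calc _ = (1 + ε) ^ 8 / (1 - ε) * (1 + c1 * (τ / 2)) := by field_simp
      _ ≤ (1 + ε) ^ 8 / (1 - ε) * (1 + ε) := by gcongr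
      _ = (1 + ε) ^ 9 / (1 - ε) := by ring
      _ < _ := hεη
  have hev := (RR_tend ε τ a P (3 * K)).eventually_lt_const hlim
  have hE0 : ∀ N : ℕ, 0 ≤ (4 * Real.pi * N / Real.log N) *
          ∫ x : Fin N → E2, W2sq (empMeas x) μ ∂(Measure.pi fun _ => μ) := fun N => by
    have h1 : 0 ≤ Real.log N := Real.log_natCast_nonneg N
    have h2 : 0 ≤ ∫ x : Fin N → E2, W2sq (empMeas x) μ ∂(Measure.pi fun _ => μ) :=
      integral_nonneg fun x => W2sq_nonneg _ _
    positivity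
  refine limsup_le_of_le (IsBoundedUnder.isCoboundedUnder_le
    (isBoundedUnder_of ⟨0, fun N => hE0 N⟩)) ?_
  have hea : 0 < ε * a := by positivity
  have t1 : ∀ᶠ N : ℕ in atTop, 6 * (3 * (K : ℝ)) / (ε * a) ≤ (nn N : ℝ) :=
    (tendsto_natCast_atTop_atTop.comp nn_tend).eventually_ge_atTop _
  have t2 : ∀ᶠ N : ℕ in atTop, 3 * (K : ℝ) / (ε * a) ≤ (N : ℝ) :=
    tendsto_natCast_atTop_atTop.eventually_ge_atTop _
  filter_upwards [hev, nn_facts, t1, t2] with N hR ⟨f1, f2, f3, f4, f5, f6, f7, f8⟩ t1 t2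
  rw [div_le_iff₀' hea] at t1 t2
  have hθ := f3.trans_le f4
  refine (bound_N ha hK0 hμ hpos hhi hP hl f1 f2 hθ hε hε1 hτ t1 t2).trans (le_trans ?_ hR.le)
  refine RR_mono hε hε1 hτ ha hP (by positivity) ?_ (by positivity) (by positivity) (by positivity) f5 f6 f7
  have : 0 ≤ Real.log (nn N) := Real.log_natCast_nonneg _
  positivity
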